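/- Let Ω ⊂ ℝ^d (d ≥ 2) be a bounded domain with boundary of class C^{2,γ} and let f ∈ C^∞(cl(Ω)×ℝ×ℝ^d, ℝ). Let p be either a time-periodic classical solution of ∂_t u = Δu + f(x, u, ∇u) with homogeneous Dirichlet boundary condition with minimal period ω > 0, or an equilibrium solution (with the convention ω = 0), with p and ∇p uniformly bounded. Let u be a bounded complete classical solution of the same equation such that p(·,t) ≠ u(·,s) as functions on Ω for every (t,s) ∈ ℝ². Then there exists a dense open set of points (x₀,t₀) ∈ Ω×ℝ such that (u(x₀,t₀), ∇u(x₀,t₀)) ≠ (p(x₀,t), ∇p(x₀,t)) for all t ∈ ℝ. -/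

import Mathlib

open Set MeasureTheory

/-- The partial derivative of `f` in the `i`-th coordinate direction. -/
noncomputable def pd {d : ℕ} (i : Fin d) (f : (Fin d → ℝ) → ℝ) (x : Fin d → ℝ) : ℝ :=
  fderiv ℝ f x (Pi.single i 1)

/-- The Laplacian of `f`. -/
noncomputable def lap {d : ℕ} (f : (Fin d → ℝ) → ℝ) (x : Fin d → ℝ) : ℝ :=
  ∑ i, pd i (pd i f) x

/-- `Ω` is a domain with boundary of class `C^{2,γ}`: it admits a global defining
function `φ` of class `C²` whose second derivative is `γ`-Hölder continuous, with
nonvanishing gradient on the boundary. -/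
def HasC2HolderBoundary {d : ℕ} (Ω : Set (Fin d → ℝ)) (γ : NNReal) : Prop :=
  ∃ (φ : (Fin d → ℝ) → ℝ) (C : NNReal),
    ContDiff ℝ 2 φ ∧ HolderWith C γ (iteratedFDeriv ℝ 2 φ) ∧
    Ω = {x | φ x < 0} ∧ ∀ x ∈ frontier Ω, fderiv ℝ φ x ≠ 0



open Set MeasureTheory Filter Topology

set_option linter.unusedSectionVars false
set_option linter.unusedSimpArgs false

section CXcalc

variable {d : ℕ}
variable {F G H X : Type} [NormedAddCommGroup F] [NormedSpace ℝ F]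
  [NormedAddCommGroup G] [NormedSpace ℝ G] [NormedAddCommGroup H] [NormedSpace ℝ H]
  [NormedAddCommGroup X] [NormedSpace ℝ X]

/-- Spatial partial derivative of a time dependent function. -/
noncomputable def dX (i : Fin d) (g : (Fin d → ℝ) → ℝ → F) : (Fin d → ℝ) → ℝ → F :=
  fun x t => fderiv ℝ (fun y => g y t) x (Pi.single i 1)

/-- Local Hölder continuity (exponent one half) in the space variable. -/
def HolX (O : Set ((Fin d → ℝ) × ℝ)) (g : (Fin d → ℝ) → ℝ → F) : Prop :=
  ∀ q ∈ O, ∃ U ∈ 𝓝 q, ∃ L : ℝ, ∀ x y t, (x, t) ∈ U → (y, t) ∈ U →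
    ‖g x t - g y t‖ ≤ L * Real.sqrt ‖x - y‖

/-- `k` spatial derivatives, jointly continuous (and Hölder if `h`). -/
def CX (h : Prop) (O : Set ((Fin d → ℝ) × ℝ)) : ℕ → ((Fin d → ℝ) → ℝ → F) → Prop
  | 0, g => ContinuousOn (fun q : (Fin d → ℝ) × ℝ => g q.1 q.2) O ∧ (h → HolX O g)
  | k + 1, g => ContinuousOn (fun q : (Fin d → ℝ) × ℝ => g q.1 q.2) O ∧
      (∀ q ∈ O, DifferentiableAt ℝ (fun y => g y q.2) q.1) ∧ ∀ i, CX h O k (dX i g)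

variable {h : Prop} {O O' : Set ((Fin d → ℝ) × ℝ)} {k : ℕ}

lemma CX.cont {g : (Fin d → ℝ) → ℝ → F} (hg : CX h O k g) :
    ContinuousOn (fun q : (Fin d → ℝ) × ℝ => g q.1 q.2) O := by
  cases k with
  | zero => exact hg.1
  | succ k => exact hg.1

lemma CX.weaken {h' : Prop} (hh : h' → h) {g : (Fin d → ℝ) → ℝ → F} (hg : CX h O k g) :
    CX h' O k g := by
  induction k generalizing g with
  | zero => exact ⟨hg.1, fun a => hg.2 (hh a)⟩
  | succ k ih => exact ⟨hg.1, hg.2.1, fun i => ih (hg.2.2 i)⟩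

lemma CX.mono (hO : O' ⊆ O) {g : (Fin d → ℝ) → ℝ → F} (hg : CX h O k g) : CX h O' k g := by
  induction k generalizing g with
  | zero => exact ⟨hg.1.mono hO, fun a q hq => hg.2 a q (hO hq)⟩
  | succ k ih => exact ⟨hg.1.mono hO, fun q hq => hg.2.1 q (hO hq), fun i => ih (hg.2.2 i)⟩

lemma CX.of_local {g : (Fin d → ℝ) → ℝ → F}
    (hl : ∀ q ∈ O, ∃ O', q ∈ O' ∧ IsOpen O' ∧ CX h O' k g) : CX h O k g := by
  have hc : ContinuousOn (fun q : (Fin d → ℝ) × ℝ => g q.1 q.2) O := by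
    intro q hq
    obtain ⟨O', hq', ho, hc⟩ := hl q hq
    exact (hc.cont.continuousAt (ho.mem_nhds hq')).continuousWithinAt
  induction k generalizing g with
  | zero =>
    refine ⟨hc, fun a q hq => ?_⟩
    obtain ⟨O', hq', ho, hc⟩ := hl q hq
    exact hc.2 a q hq'
  | succ k ih =>
    refine ⟨hc, fun q hq => ?_, fun i => ?_⟩
    · obtain ⟨O', hq', ho, hc⟩ := hl q hq
      exact hc.2.1 q hq'
    · have hl' : ∀ q ∈ O, ∃ O', q ∈ O' ∧ IsOpen O' ∧ CX h O' k (dX i g) := by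
        intro q hq
        obtain ⟨O', hq', ho, hc⟩ := hl q hq
        exact ⟨O', hq', ho, hc.2.2 i⟩
      refine ih hl' ?_
      intro q hq
      obtain ⟨O', hq', ho, hc⟩ := hl' q hq
      exact (hc.cont.continuousAt (ho.mem_nhds hq')).continuousWithinAt

lemma slice_nhds (hO : IsOpen O) {x : Fin d → ℝ} {t : ℝ} (hq : (x, t) ∈ O) :
    ∀ᶠ y in 𝓝 x, (y, t) ∈ O := by
  have : Continuous (fun y : Fin d → ℝ => (y, t)) := by fun_prop
  exact this.continuousAt.eventually_mem (hO.mem_nhds hq)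

lemma slice_eq (hO : IsOpen O) {g g' : (Fin d → ℝ) → ℝ → F}
    (he : ∀ x t, (x, t) ∈ O → g x t = g' x t) {x : Fin d → ℝ} {t : ℝ} (hq : (x, t) ∈ O) :
    (fun y => g y t) =ᶠ[𝓝 x] (fun y => g' y t) := by
  filter_upwards [slice_nhds hO hq] with y hy using he y t hy

lemma dX_congr (hO : IsOpen O) {g g' : (Fin d → ℝ) → ℝ → F}
    (he : ∀ x t, (x, t) ∈ O → g x t = g' x t) (i : Fin d) :
    ∀ x t, (x, t) ∈ O → dX i g x t = dX i g' x t := by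
  intro x t hq
  unfold dX
  rw [(slice_eq hO he hq).fderiv_eq]

lemma CX.congr (hO : IsOpen O) {g g' : (Fin d → ℝ) → ℝ → F} (hg : CX h O k g)
    (he : ∀ x t, (x, t) ∈ O → g x t = g' x t) : CX h O k g' := by
  induction k generalizing g g' with
  | zero =>
    refine ⟨hg.1.congr (fun q hq => (he q.1 q.2 hq).symm), fun a q hq => ?_⟩
    obtain ⟨U, hU, L, hL⟩ := hg.2 a q hq
    refine ⟨U ∩ O, inter_mem hU (hO.mem_nhds hq), L, fun x y t hx hy => ?_⟩
    rw [← he x t hx.2, ← he y t hy.2]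
    exact hL x y t hx.1 hy.1
  | succ k ih =>
    refine ⟨hg.1.congr (fun q hq => (he q.1 q.2 hq).symm), fun q hq => ?_, fun i => ?_⟩
    · exact (hg.2.1 q hq).congr_of_eventuallyEq (slice_eq hO he hq).symm
    · exact ih (hg.2.2 i) (dX_congr hO he i)

lemma clm_eq_sum (A : (Fin d → ℝ) →L[ℝ] F) (v : Fin d → ℝ) :
    A v = ∑ i, v i • A (Pi.single i 1) := by
  conv_lhs => rw [pi_eq_sum_univ' v]
  simp [map_sum, Pi.single]

lemma clm_norm_le (A : (Fin d → ℝ) →L[ℝ] F) {M : ℝ} (hM : 0 ≤ M)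
    (hA : ∀ i, ‖A (Pi.single i 1)‖ ≤ M) : ‖A‖ ≤ d * M := by
  refine A.opNorm_le_bound (by positivity) fun v => ?_
  rw [clm_eq_sum A v]
  refine (norm_sum_le _ _).trans ?_
  calc ∑ i, ‖v i • A (Pi.single i 1)‖ ≤ ∑ _i : Fin d, M * ‖v‖ := by
        refine Finset.sum_le_sum fun i _ => ?_
        rw [norm_smul, mul_comm]
        exact mul_le_mul (hA i) (norm_le_pi_norm v i) (norm_nonneg _) hM
    _ = d * M * ‖v‖ := by simp; ring

lemma holX_of_C1 (hO : IsOpen O) {g : (Fin d → ℝ) → ℝ → F} (hg : CX h O 1 g) : HolX O g := by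
  intro q hq
  have hb : ∀ᶠ q' in 𝓝 q, q' ∈ O ∧ ∀ i, ‖dX i g q'.1 q'.2‖ ≤ (∑ i, ‖dX i g q.1 q.2‖) + 1 := by
    refine (show ∀ᶠ q' in 𝓝 q, q' ∈ O from hO.mem_nhds hq).and ?_
    rw [eventually_all]
    intro i
    have hc : ContinuousAt (fun q' : (Fin d → ℝ) × ℝ => ‖dX i g q'.1 q'.2‖) q :=
      ((hg.2.2 i).cont.continuousAt (hO.mem_nhds hq)).norm
    have : ‖dX i g q.1 q.2‖ < (∑ i, ‖dX i g q.1 q.2‖) + 1 := by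
      have := Finset.single_le_sum (f := fun i => ‖dX i g q.1 q.2‖)
        (fun i _ => norm_nonneg _) (Finset.mem_univ i)
      linarith
    exact (hc.eventually_lt continuousAt_const this).mono fun _ hh => hh.le
  obtain ⟨ε, hε, hball⟩ := Metric.eventually_nhds_iff_ball.1 hb
  set M := (∑ i, ‖dX i g q.1 q.2‖) + 1 with hM
  have hM0 : 0 ≤ M := by positivity
  refine ⟨Metric.ball q (min ε (1/2)), Metric.ball_mem_nhds _ (by positivity), d * M,
    fun x y t hx hy => ?_⟩
  have hb' : Metric.ball q (min ε (1/2)) =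
    Metric.ball q.1 (min ε (1/2)) ×ˢ Metric.ball q.2 (min ε (1/2)) := (ball_prod_same _ _ _).symm
  rw [hb'] at hx hy
  have hsub : ∀ z ∈ Metric.ball q.1 (min ε (1/2)), (z, t) ∈ Metric.ball q ε := by
    intro z hz
    have : (z, t) ∈ Metric.ball q (min ε (1/2)) := by rw [hb']; exact ⟨hz, hx.2⟩
    exact Metric.ball_subset_ball (min_le_left _ _) this
  have key := (convex_ball q.1 (min ε (1/2))).norm_image_sub_le_of_norm_fderiv_le (𝕜 := ℝ)
    (f := fun z => g z t) (C := d * M)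
    (fun z hz => hg.2.1 (z, t) (hball _ (hsub z hz)).1)
    (fun z hz => clm_norm_le _ hM0 (hball _ (hsub z hz)).2) hy.1 hx.1
  refine key.trans ?_
  have hd1 : ‖x - y‖ ≤ 1 := by
    rw [← dist_eq_norm]
    have h1 := Metric.mem_ball.1 hx.1
    have h2 := Metric.mem_ball.1 hy.1
    have := min_le_right ε (1/2)
    have := dist_triangle_right x y q.1
    linarith
  have : ‖x - y‖ ≤ Real.sqrt ‖x - y‖ := by
    apply Real.le_sqrt_of_sq_le
    have := norm_nonneg (x - y)
    nlinarith
  exact mul_le_mul_of_nonneg_left this (by positivity)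

lemma CX.pred (hO : IsOpen O) {h' : Prop} {g : (Fin d → ℝ) → ℝ → F} (hg : CX h O (k + 1) g) :
    CX h' O k g := by
  induction k generalizing g with
  | zero => exact ⟨hg.1, fun _ => holX_of_C1 hO hg⟩
  | succ k ih => exact ⟨hg.1, hg.2.1, fun i => ih (hg.2.2 i)⟩

lemma CX.const (c : F) : CX h O k (fun (_ : Fin d → ℝ) (_ : ℝ) => c) := by
  induction k generalizing c with
  | zero =>
    exact ⟨continuousOn_const, fun _ q _ => ⟨univ, univ_mem, 0, by simp⟩⟩
  | succ k ih =>
    refine ⟨continuousOn_const, fun _ _ => differentiableAt_const _, fun i => ?_⟩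
    have : dX i (fun (_ : Fin d → ℝ) (_ : ℝ) => c) = fun _ _ => (0 : F) := by
      funext x t; simp [dX]
    rw [this]; exact ih 0

lemma CX.add (hO : IsOpen O) {g g' : (Fin d → ℝ) → ℝ → F} (hg : CX h O k g)
    (hg' : CX h O k g') : CX h O k (fun x t => g x t + g' x t) := by
  induction k generalizing g g' with
  | zero =>
    refine ⟨hg.1.add hg'.1, fun a q hq => ?_⟩
    obtain ⟨U, hU, L, hL⟩ := hg.2 a q hq
    obtain ⟨U', hU', L', hL'⟩ := hg'.2 a q hq
    refine ⟨U ∩ U', inter_mem hU hU', L + L', fun x y t hx hy => ?_⟩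
    have h1 := hL x y t hx.1 hy.1
    have h2 := hL' x y t hx.2 hy.2
    calc _ = ‖(g x t - g y t) + (g' x t - g' y t)‖   := by rw [add_sub_add_comm]
      _ ≤ _ := (norm_add_le _ _).trans (by linarith)
  | succ k ih =>
    refine ⟨hg.1.add hg'.1, fun q hq => (hg.2.1 q hq).add (hg'.2.1 q hq), fun i => ?_⟩
    refine (ih (hg.2.2 i) (hg'.2.2 i)).congr hO fun x t hq => ?_
    simp only [dX]
    rw [fderiv_fun_add (hg.2.1 _ hq) (hg'.2.1 _ hq)]; rfl

lemma CX.clm (hO : IsOpen O) {g : (Fin d → ℝ) → ℝ → F} (hg : CX h O k g) (A : F →L[ℝ] G) :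
    CX h O k (fun x t => A (g x t)) := by
  induction k generalizing g with
  | zero =>
    refine ⟨A.continuous.comp_continuousOn hg.1, fun a q hq => ?_⟩
    obtain ⟨U, hU, L, hL⟩ := hg.2 a q hq
    refine ⟨U, hU, ‖A‖ * L, fun x y t hx hy => ?_⟩
    rw [← map_sub]
    refine (A.le_opNorm _).trans ?_
    rw [mul_assoc]
    exact mul_le_mul_of_nonneg_left (hL x y t hx hy) (norm_nonneg _)
  | succ k ih =>
    refine ⟨A.continuous.comp_continuousOn hg.1,
      fun q hq => A.differentiableAt.comp q.1 (hg.2.1 q hq), fun i => ?_⟩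
    refine (ih (hg.2.2 i)).congr hO fun x t hq => ?_
    simp only [dX]
    have := (A.hasFDerivAt.comp x (hg.2.1 _ hq).hasFDerivAt).fderiv
    simp only [Function.comp_def] at this
    rw [this]; rfl

lemma CX.neg (hO : IsOpen O) {g : (Fin d → ℝ) → ℝ → F} (hg : CX h O k g) :
    CX h O k (fun x t => - g x t) := hg.clm hO (-ContinuousLinearMap.id ℝ F)

lemma CX.sub (hO : IsOpen O) {g g' : (Fin d → ℝ) → ℝ → F} (hg : CX h O k g)
    (hg' : CX h O k g') : CX h O k (fun x t => g x t - g' x t) := by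
  simpa only [sub_eq_add_neg] using hg.add hO (hg'.neg hO)

lemma CX.sum (hO : IsOpen O) {ι : Type} (s : Finset ι) {g : ι → (Fin d → ℝ) → ℝ → F}
    (hg : ∀ j ∈ s, CX h O k (g j)) : CX h O k (fun x t => ∑ j ∈ s, g j x t) := by
  classical
  induction s using Finset.induction_on with
  | empty => simpa using CX.const (0 : F)
  | insert a s ha ih =>
    simp only [Finset.sum_insert ha]
    exact (hg a (by simp)).add hO (ih fun j hj => hg j (by simp [hj]))

lemma dX_bilin {g : (Fin d → ℝ) → ℝ → F} {g' : (Fin d → ℝ) → ℝ → G}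
    (B : F →L[ℝ] G →L[ℝ] H) {x : Fin d → ℝ} {t : ℝ}
    (h1 : DifferentiableAt ℝ (fun y => g y t) x) (h2 : DifferentiableAt ℝ (fun y => g' y t) x)
    (i : Fin d) :
    dX i (fun x t => B (g x t) (g' x t)) x t = B (g x t) (dX i g' x t) + B (dX i g x t) (g' x t) := by
  simp only [dX]
  have := (B.hasFDerivAt_of_bilinear h1.hasFDerivAt h2.hasFDerivAt).fderiv
  rw [this]; simp

lemma CX.bilin (hO : IsOpen O) {g : (Fin d → ℝ) → ℝ → F} {g' : (Fin d → ℝ) → ℝ → G}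
    (B : F →L[ℝ] G →L[ℝ] H) (hg : CX h O k g)
    (hg' : CX h O k g') : CX h O k (fun x t => B (g x t) (g' x t)) := by
  have hc : ContinuousOn (fun q : (Fin d → ℝ) × ℝ => B (g q.1 q.2) (g' q.1 q.2)) O :=
    (B.continuous.comp_continuousOn hg.cont).clm_apply hg'.cont
  induction k generalizing g g' with
  | zero =>
    refine ⟨hc, fun a q hq => ?_⟩
    obtain ⟨U, hU, L, hL⟩ := hg.2 a q hq
    obtain ⟨U', hU', L', hL'⟩ := hg'.2 a q hq
    have b1 : ∀ᶠ q' in 𝓝 q, ‖g q'.1 q'.2‖ < ‖g q.1 q.2‖ + 1 :=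
      (hg.1.continuousAt (hO.mem_nhds hq)).norm.eventually_lt continuousAt_const (by simp)
    have b2 : ∀ᶠ q' in 𝓝 q, ‖g' q'.1 q'.2‖ < ‖g' q.1 q.2‖ + 1 :=
      (hg'.1.continuousAt (hO.mem_nhds hq)).norm.eventually_lt continuousAt_const (by simp)
    refine ⟨U ∩ U' ∩ {q' | ‖g q'.1 q'.2‖ < ‖g q.1 q.2‖ + 1 ∧ ‖g' q'.1 q'.2‖ < ‖g' q.1 q.2‖ + 1},
      inter_mem (inter_mem hU hU') (b1.and b2),
      ‖B‖ * ((‖g q.1 q.2‖ + 1) * L' + L * (‖g' q.1 q.2‖ + 1)), fun x y t hx hy => ?_⟩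
    have h1 := hL x y t hx.1.1 hy.1.1
    have h2 := hL' x y t hx.1.2 hy.1.2
    have h3 : ‖g x t‖ < ‖g q.1 q.2‖ + 1 := hx.2.1
    have h4 : ‖g' y t‖ < ‖g' q.1 q.2‖ + 1 := hy.2.2
    calc ‖B (g x t) (g' x t) - B (g y t) (g' y t)‖
        = ‖B (g x t) (g' x t - g' y t) + B (g x t - g y t) (g' y t)‖ := by
          congr 1; simp only [map_sub, sub_apply]; abel
      _ ≤ ‖B‖ * ‖g x t‖ * ‖g' x t - g' y t‖ + ‖B‖ * ‖g x t - g y t‖ * ‖g' y t‖ :=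
          (norm_add_le _ _).trans (add_le_add (B.le_opNorm₂ _ _) (B.le_opNorm₂ _ _))
      _ ≤ ‖B‖ * (‖g q.1 q.2‖ + 1) * (L' * Real.sqrt ‖x - y‖)
          + ‖B‖ * (L * Real.sqrt ‖x - y‖) * (‖g' q.1 q.2‖ + 1) := by
          have : 0 ≤ L * Real.sqrt ‖x - y‖ := (norm_nonneg _).trans h1
          have : 0 ≤ L' * Real.sqrt ‖x - y‖ := (norm_nonneg _).trans h2
          gcongr
      _ = _ := by ring
  | succ k ih =>
    refine ⟨hc, fun q hq => ?_, fun i => ?_⟩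
    · exact (B.hasFDerivAt_of_bilinear (hg.2.1 q hq).hasFDerivAt
        (hg'.2.1 q hq).hasFDerivAt).differentiableAt
    · have c1 := ih (hg.pred hO) (hg'.2.2 i)
        ((B.continuous.comp_continuousOn hg.cont).clm_apply (hg'.2.2 i).cont)
      have c2 := ih (hg.2.2 i) (hg'.pred hO)
        ((B.continuous.comp_continuousOn (hg.2.2 i).cont).clm_apply hg'.cont)
      refine (c1.add hO c2).congr hO fun x t hq => ?_
      exact (dX_bilin B (hg.2.1 _ hq) (hg'.2.1 _ hq) i).symm

lemma CX.mul (hO : IsOpen O) {g g' : (Fin d → ℝ) → ℝ → ℝ} (hg : CX h O k g)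
    (hg' : CX h O k g') : CX h O k (fun x t => g x t * g' x t) :=
  CX.bilin hO (ContinuousLinearMap.mul ℝ ℝ) hg hg'

lemma dX_comp {S : Set X} (hS : IsOpen S) {f : X → F} (hf : ContDiffOn ℝ (⊤ : ℕ∞) f S)
    {φ : (Fin d → ℝ) → ℝ → X} {x : Fin d → ℝ} {t : ℝ}
    (h1 : DifferentiableAt ℝ (fun y => φ y t) x) (hs : φ x t ∈ S) (i : Fin d) :
    dX i (fun x t => f (φ x t)) x t = fderiv ℝ f (φ x t) (dX i φ x t) := by
  simp only [dX]
  have hfd : DifferentiableAt ℝ f (φ x t) :=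
    (hf.contDiffAt (hS.mem_nhds hs)).differentiableAt (by simp)
  have := (hfd.hasFDerivAt.comp x h1.hasFDerivAt).fderiv
  simp only [Function.comp_def] at this
  rw [this]; rfl

lemma CX.comp (hO : IsOpen O) {S : Set X} (hS : IsOpen S) {f : X → F}
    (hf : ContDiffOn ℝ (⊤ : ℕ∞) f S) {φ : (Fin d → ℝ) → ℝ → X} (hφ : CX h O k φ)
    (hm : ∀ x t, (x, t) ∈ O → φ x t ∈ S) : CX h O k (fun x t => f (φ x t)) := by
  induction k generalizing F with
  | zero =>
    refine ⟨hf.continuousOn.comp hφ.1 fun q hq => hm _ _ hq, fun a q hq => ?_⟩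
    have hfa : ContDiffAt ℝ 1 f (φ q.1 q.2) :=
      (hf.contDiffAt (hS.mem_nhds (hm q.1 q.2 hq))).of_le (by simp)
    obtain ⟨K, V, hV, hK⟩ := hfa.exists_lipschitzOnWith
    obtain ⟨U, hU, L, hL⟩ := hφ.2 a q hq
    have hV' := (hφ.1.continuousAt (hO.mem_nhds hq)).eventually_mem hV
    refine ⟨U ∩ _, inter_mem hU hV', K * L, fun x y t hx hy => ?_⟩
    have := hK.norm_sub_le hx.2 hy.2
    refine this.trans ?_
    rw [mul_assoc]
    exact mul_le_mul_of_nonneg_left (hL x y t hx.1 hy.1) K.2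
  | succ k ih =>
    refine ⟨hf.continuousOn.comp hφ.1 fun q hq => hm _ _ hq, fun q hq => ?_, fun i => ?_⟩
    · have hfd : DifferentiableAt ℝ f (φ q.1 q.2) :=
        (hf.contDiffAt (hS.mem_nhds (hm _ _ hq))).differentiableAt (by simp)
      exact hfd.comp q.1 (hφ.2.1 q hq)
    · have hf' : ContDiffOn ℝ (⊤ : ℕ∞) (fderiv ℝ f) S :=
        hf.fderiv_of_isOpen hS (by simp)
      have c1 := ih hf' (hφ.pred hO)
      refine (CX.bilin hO (ContinuousLinearMap.id ℝ (X →L[ℝ] F)) c1 (hφ.2.2 i)).congr hO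
        fun x t hq => ?_
      exact (dX_comp hS hf (hφ.2.1 _ hq) (hm _ _ hq) i).symm

lemma CX.idq : CX h O k (fun (x : Fin d → ℝ) (t : ℝ) => (x, t)) := by
  cases k with
  | zero =>
    refine ⟨by fun_prop, fun _ q _ => ⟨Metric.ball q (1/2), Metric.ball_mem_nhds _ (by norm_num), 1,
      fun x y t hx hy => ?_⟩⟩
    have hd1 : dist (x, t) (y, t) ≤ 1 := by
      have h1 := Metric.mem_ball.1 hx
      have h2 := Metric.mem_ball.1 hy
      have := dist_triangle_right (x, t) (y, t) q
      linarith
    have e : ‖(x, t) - (y, t)‖ = ‖x - y‖ := by simp [Prod.norm_def]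
    rw [dist_eq_norm, e] at hd1
    rw [e, one_mul]
    apply Real.le_sqrt_of_sq_le
    have := norm_nonneg (x - y)
    nlinarith
  | succ k =>
    refine ⟨by fun_prop, fun q _ => by fun_prop, fun i => ?_⟩
    have : dX i (fun (x : Fin d → ℝ) (t : ℝ) => (x, t)) =
        fun _ _ => ((Pi.single i 1 : Fin d → ℝ), (0 : ℝ)) := by
      funext x t
      simp only [dX]
      have : HasFDerivAt (fun y : Fin d → ℝ => (y, t))
        ((ContinuousLinearMap.id ℝ (Fin d → ℝ)).prod 0) x :=
        (hasFDerivAt_id x).prodMk (hasFDerivAt_const t x)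
      rw [this.fderiv]; rfl
    rw [this]
    exact CX.const _

lemma CX.smooth (hO : IsOpen O) {χ : (Fin d → ℝ) × ℝ → F} (hχ : ContDiff ℝ (⊤ : ℕ∞) χ) :
    CX h O k (fun x t => χ (x, t)) :=
  CX.comp hO isOpen_univ hχ.contDiffOn CX.idq (fun _ _ _ => mem_univ _)

/-- extension by zero after multiplication with a cutoff -/
lemma CX.cutoff (hO : IsOpen O) {χ : (Fin d → ℝ) × ℝ → ℝ} (hχ : ContDiff ℝ (⊤ : ℕ∞) χ)
    (hs : tsupport χ ⊆ O) {g : (Fin d → ℝ) → ℝ → ℝ} (hg : CX h O k g) :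
    CX h univ k (fun x t => χ (x, t) * g x t) := by
  refine CX.of_local fun q _ => ?_
  by_cases hq : q ∈ O
  · exact ⟨O, hq, hO, (CX.smooth hO hχ).mul hO hg⟩
  · refine ⟨(tsupport χ)ᶜ, fun hh => hq (hs hh), (isClosed_tsupport _).isOpen_compl, ?_⟩
    refine (CX.const (0 : ℝ)).congr (isClosed_tsupport _).isOpen_compl fun x t hx => ?_
    rw [image_eq_zero_of_notMem_tsupport hx]; simp

lemma fderiv_eq_sum_dX (g : (Fin d → ℝ) → ℝ → F) (x : Fin d → ℝ) (t : ℝ) :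
    fderiv ℝ (fun y => g y t) x =
      ∑ i, (ContinuousLinearMap.proj (R := ℝ) (φ := fun _ : Fin d => ℝ) i).smulRight (dX i g x t) := by
  ext v
  rw [clm_eq_sum]
  simp [dX]

lemma CX.contDiffOn (hO : IsOpen O) {g : (Fin d → ℝ) → ℝ → F} (hg : CX h O k g) (t : ℝ) :
    ContDiffOn ℝ k (fun y => g y t) {x | (x, t) ∈ O} := by
  have ho : IsOpen {x | (x, t) ∈ O} := hO.preimage (by fun_prop)
  induction k generalizing g with
  | zero =>
    simp only [Nat.cast_zero, contDiffOn_zero]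
    exact hg.1.comp (f := fun x => (x, t)) (by fun_prop) (fun x hx => hx)
  | succ k ih =>
    have : ((k + 1 : ℕ) : WithTop ℕ∞) = (k : WithTop ℕ∞) + 1 := by simp
    rw [this, contDiffOn_succ_iff_fderiv_of_isOpen ho]
    refine ⟨fun x hx => (hg.2.1 (x, t) hx).differentiableWithinAt, by simp, ?_⟩
    have e : fderiv ℝ (fun y => g y t) = fun x =>
      ∑ i, (ContinuousLinearMap.proj (R := ℝ) (φ := fun _ : Fin d => ℝ) i).smulRight
        (dX i g x t) := by
      funext x; exact fderiv_eq_sum_dX g x t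
    rw [e]
    refine ContDiffOn.sum fun i _ => ?_
    exact (ContinuousLinearMap.smulRightL ℝ (Fin d → ℝ) F
      (ContinuousLinearMap.proj (R := ℝ) (φ := fun _ : Fin d => ℝ) i)).contDiff.comp_contDiffOn
      (ih (hg.2.2 i))

lemma dX_comm (hO : IsOpen O) {g : (Fin d → ℝ) → ℝ → ℝ} (hg : CX h O 2 g) (i j : Fin d)
    {x : Fin d → ℝ} {t : ℝ} (hq : (x, t) ∈ O) : dX i (dX j g) x t = dX j (dX i g) x t := by
  have ho : IsOpen {x | (x, t) ∈ O} := hO.preimage (by fun_prop)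
  have hc := (hg.contDiffOn hO t).contDiffAt (ho.mem_nhds hq)
  have hsymm := hc.isSymmSndFDerivAt (by simp)
  have hd : DifferentiableAt ℝ (fderiv ℝ (fun y => g y t)) x :=
    (hc.fderiv_right (m := 1) (by norm_num)).differentiableAt (by simp)
  have key : ∀ a b : Fin d, dX a (dX b g) x t =
      fderiv ℝ (fderiv ℝ (fun y => g y t)) x (Pi.single a 1) (Pi.single b 1) := by
    intro a b
    simp only [dX]
    have := (hd.hasFDerivAt.clm_apply (hasFDerivAt_const (Pi.single b (1 : ℝ)) x)).fderiv
    rw [this]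
    simp
  rw [key, key]
  exact hsymm _ _

end CXcalc


open Set MeasureTheory Filter Topology

section Gauss

variable {d : ℕ}

/-- Euclidean norm squared. -/
noncomputable def nsq (y : Fin d → ℝ) : ℝ := ∑ i, y i ^ 2

lemma nsq_nonneg (y : Fin d → ℝ) : 0 ≤ nsq y := Finset.sum_nonneg fun _ _ => sq_nonneg _

lemma nsq_cont : Continuous (nsq (d := d)) := by unfold nsq; fun_prop

@[fun_prop]
lemma nsq_contDiff {n : WithTop ℕ∞} : ContDiff ℝ n (nsq (d := d)) := by unfold nsq; fun_prop

lemma sq_le_nsq (y : Fin d → ℝ) (i : Fin d) : y i ^ 2 ≤ nsq y :=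
  Finset.single_le_sum (f := fun i => y i ^ 2) (fun _ _ => sq_nonneg _) (Finset.mem_univ i)

lemma nsq_smul (r : ℝ) (y : Fin d → ℝ) : nsq (r • y) = r ^ 2 * nsq y := by
  simp [nsq, Finset.mul_sum, mul_pow]

lemma norm_sq_le_nsq (y : Fin d → ℝ) : ‖y‖ ^ 2 ≤ nsq y := by
  have h : ‖y‖ ≤ Real.sqrt (nsq y) := by
    refine (pi_norm_le_iff_of_nonneg (Real.sqrt_nonneg _)).2 fun i => ?_
    exact Real.abs_le_sqrt (sq_le_nsq y i)
  calc ‖y‖ ^ 2 ≤ (Real.sqrt (nsq y)) ^ 2 := by gcongr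
    _ = nsq y := Real.sq_sqrt (nsq_nonneg y)

lemma nsq_le (y : Fin d → ℝ) : nsq y ≤ d * ‖y‖ ^ 2 := by
  unfold nsq
  calc ∑ i, y i ^ 2 ≤ ∑ _i : Fin d, ‖y‖ ^ 2 := by
        refine Finset.sum_le_sum fun i _ => ?_
        rw [← sq_abs]
        have := norm_le_pi_norm y i
        rw [Real.norm_eq_abs] at this
        gcongr
    _ = _ := by simp

lemma nsq_add_ge (y h : Fin d → ℝ) : nsq y / 2 - nsq h ≤ nsq (y + h) := by
  unfold nsq
  rw [Finset.sum_div, ← Finset.sum_sub_distrib]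
  refine Finset.sum_le_sum fun i _ => ?_
  simp only [Pi.add_apply]
  nlinarith [sq_nonneg (y i + 2 * h i)]

/-- Gaussian weights. -/
noncomputable def gw (κ : ℝ) (y : Fin d → ℝ) (a : ℝ) : ℝ :=
  Real.exp (-(κ * nsq y / a) - d / 2 * Real.log a)

lemma gw_pos (κ : ℝ) (y : Fin d → ℝ) (a : ℝ) : 0 < gw κ y a := Real.exp_pos _

lemma gw_eq (κ : ℝ) (y : Fin d → ℝ) {a : ℝ} (ha : 0 < a) :
    gw κ y a = ((Real.sqrt a) ^ d)⁻¹ * ∏ i, Real.exp (-(κ / a) * y i ^ 2) := by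
  unfold gw nsq
  rw [sub_eq_add_neg, Real.exp_add, mul_comm, ← Real.exp_sum]
  congr 1
  · rw [Real.exp_neg]
    congr 1
    rw [← Real.exp_log (pow_pos (Real.sqrt_pos.2 ha) d), Real.log_pow, Real.log_sqrt ha.le]
    congr 1; ring
  · congr 1
    rw [Finset.mul_sum, Finset.sum_div, ← Finset.sum_neg_distrib]
    refine Finset.sum_congr rfl fun i _ => by ring

lemma gw_integrable {κ a : ℝ} (hκ : 0 < κ) (ha : 0 < a) :
    Integrable (fun y : Fin d → ℝ => gw κ y a) := by
  simp only [gw_eq κ _ ha]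
  refine Integrable.const_mul ?_ _
  exact Integrable.fintype_prod (f := fun (_ : Fin d) (x : ℝ) => Real.exp (-(κ / a) * x ^ 2))
    (fun i => integrable_exp_neg_mul_sq (by positivity))

lemma gw_integral {κ a : ℝ} (hκ : 0 < κ) (ha : 0 < a) :
    ∫ y : Fin d → ℝ, gw κ y a = (Real.sqrt (Real.pi / κ)) ^ d := by
  simp only [gw_eq κ _ ha]
  rw [integral_const_mul]
  have := integral_fintype_prod_volume_eq_prod
    (f := fun (_ : Fin d) (x : ℝ) => Real.exp (-(κ / a) * x ^ 2))
  rw [this]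
  simp only [integral_gaussian]
  have : Real.pi / (κ / a) = a * (Real.pi / κ) := by field_simp
  rw [this, Real.sqrt_mul ha.le]
  simp only [Finset.prod_const, Finset.card_univ, Fintype.card_fin, mul_pow]
  have : (Real.sqrt a) ^ d ≠ 0 := (pow_pos (Real.sqrt_pos.2 ha) d).ne'
  field_simp

lemma gw_integral_pos {κ a : ℝ} (hκ : 0 < κ) (ha : 0 < a) :
    0 < ∫ y : Fin d → ℝ, gw κ y a := by
  rw [gw_integral hκ ha]
  have := Real.pi_pos
  positivity

lemma gw_scale (κ : ℝ) (z : Fin d → ℝ) {a : ℝ} (ha : 0 < a) :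
    gw κ (Real.sqrt a • z) a = ((Real.sqrt a) ^ d)⁻¹ * gw κ z 1 := by
  rw [gw_eq _ _ ha, gw_eq _ _ one_pos]
  simp only [Pi.smul_apply, smul_eq_mul, mul_pow, Real.sq_sqrt ha.le, Real.sqrt_one, one_pow,
    inv_one, one_mul]
  congr 1
  refine Finset.prod_congr rfl fun i _ => ?_
  congr 1; field_simp

lemma gw_scale_integral (κ : ℝ) {a : ℝ} (ha : 0 < a) (F : (Fin d → ℝ) → ℝ) :
    ∫ y, gw κ y a * F y = ∫ z, gw κ z 1 * F (Real.sqrt a • z) := by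
  have h := Measure.integral_comp_smul (volume : Measure (Fin d → ℝ))
    (fun y => gw κ y a * F y) (Real.sqrt a)
  have hp : 0 < (Real.sqrt a) ^ d := pow_pos (Real.sqrt_pos.2 ha) d
  simp only [Module.finrank_fin_fun, gw_scale κ _ ha, smul_eq_mul, mul_assoc] at h
  rw [integral_const_mul, abs_of_pos (inv_pos.2 hp)] at h
  exact (mul_left_cancel₀ (inv_pos.2 hp).ne' h).symm

lemma gw_poly {κ : ℝ} (hκ : 0 < κ) (y : Fin d → ℝ) {a : ℝ} (ha : 0 < a) :
    (1 + nsq y / a) * gw κ y a ≤ (1 + 2 / κ) * gw (κ / 2) y a := by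
  unfold gw
  have hs : 0 ≤ nsq y / a := div_nonneg (nsq_nonneg y) ha.le
  set s := nsq y / a with hsd
  have e1 : -(κ * nsq y / a) - d / 2 * Real.log a = -(κ / 2 * s) + (-(κ / 2 * nsq y / a) - d / 2 * Real.log a) := by
    rw [hsd]; ring
  rw [e1, Real.exp_add, ← mul_assoc]
  refine mul_le_mul_of_nonneg_right ?_ (Real.exp_pos _).le
  have h1 : κ / 2 * s ≤ Real.exp (κ / 2 * s) := by linarith [Real.add_one_le_exp (κ / 2 * s)]
  have h2 : (1 : ℝ) ≤ Real.exp (κ / 2 * s) := Real.one_le_exp (by positivity)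
  rw [Real.exp_neg, ← div_eq_mul_inv, div_le_iff₀ (Real.exp_pos _)]
  have h3 : s ≤ 2 / κ * Real.exp (κ / 2 * s) := by
    calc s = 2 / κ * (κ / 2 * s) := by field_simp
      _ ≤ _ := by gcongr
  linarith

lemma gw_meas (κ : ℝ) : Measurable (fun q : (Fin d → ℝ) × ℝ => gw κ q.1 q.2) := by
  unfold gw
  have : Measurable (nsq (d := d)) := nsq_cont.measurable
  fun_prop

lemma gw_hasDerivAt (κ : ℝ) (y : Fin d → ℝ) {a : ℝ} (ha : 0 < a) :
    HasDerivAt (fun a => gw κ y a) ((κ * nsq y / a ^ 2 - d / (2 * a)) * gw κ y a) a := by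
  unfold gw
  have h1 : HasDerivAt (fun a : ℝ => κ * nsq y / a) (-(κ * nsq y) / a ^ 2) a := by
    have := (hasDerivAt_inv ha.ne').const_mul (κ * nsq y)
    refine this.congr_deriv ?_
    ring
  have h2 := (Real.hasDerivAt_log ha.ne').const_mul ((d : ℝ) / 2)
  have := (h1.neg.sub h2).exp
  convert this using 1
  simp only [Pi.sub_apply, Pi.neg_apply]
  rw [mul_comm]
  congr 1
  field_simp

lemma nsq_hasFDerivAt (y : Fin d → ℝ) :
    HasFDerivAt (nsq (d := d))
      (∑ i, (2 * y i) • (ContinuousLinearMap.proj (R := ℝ) (φ := fun _ : Fin d => ℝ) i)) y := by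
  unfold nsq
  refine HasFDerivAt.fun_sum fun i _ => ?_
  have := (hasFDerivAt_apply (𝕜 := ℝ) (F' := fun _ : Fin d => ℝ) i y).pow 2
  simpa using this

lemma gw_hasFDerivAt (κ : ℝ) (y : Fin d → ℝ) (a : ℝ) :
    HasFDerivAt (fun y => gw κ y a)
      ((-(κ / a) * gw κ y a) • ∑ i, (2 * y i) •
        (ContinuousLinearMap.proj (R := ℝ) (φ := fun _ : Fin d => ℝ) i)) y := by
  unfold gw
  have := (((nsq_hasFDerivAt y).const_mul (-(κ / a))).sub_const (d / 2 * Real.log a)).exp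
  have e : (fun y : Fin d → ℝ => Real.exp (-(κ * nsq y / a) - d / 2 * Real.log a)) =
      fun y => Real.exp (-(κ / a) * nsq y - d / 2 * Real.log a) := by
    funext z; congr 1; ring
  rw [e]
  refine this.congr_fderiv ?_
  rw [smul_smul, mul_comm]; congr 3; ring

lemma gw_contDiff (κ a : ℝ) {n : WithTop ℕ∞} : ContDiff ℝ n (fun y : Fin d → ℝ => gw κ y a) := by
  unfold gw
  fun_prop

/-- first spatial derivatives of the heat kernel -/
noncomputable def gi (i : Fin d) (y : Fin d → ℝ) (a : ℝ) : ℝ := -(y i / (2 * a)) * gw (1 / 4) y a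

/-- second spatial derivatives of the heat kernel -/
noncomputable def gij (i j : Fin d) (y : Fin d → ℝ) (a : ℝ) : ℝ :=
  (y i * y j / (4 * a ^ 2) - (if i = j then 1 else 0) / (2 * a)) * gw (1 / 4) y a

lemma gw_fderiv (i : Fin d) (y : Fin d → ℝ) (a : ℝ) :
    fderiv ℝ (fun y => gw (1 / 4) y a) y (Pi.single i 1) = gi i y a := by
  rw [(gw_hasFDerivAt _ y a).fderiv]
  simp [gi, Pi.single_apply]
  field_simp; ring

lemma gi_contDiff (i : Fin d) (a : ℝ) {n : WithTop ℕ∞} :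
    ContDiff ℝ n (fun y : Fin d → ℝ => gi i y a) := by
  unfold gi
  exact (by fun_prop : ContDiff ℝ n fun y : Fin d → ℝ => -(y i / (2 * a))).mul (gw_contDiff _ _)

lemma gi_fderiv (i j : Fin d) (y : Fin d → ℝ) (a : ℝ) :
    fderiv ℝ (fun y => gi i y a) y (Pi.single j 1) = gij i j y a := by
  have h1 := ((hasFDerivAt_apply (𝕜 := ℝ) (F' := fun _ : Fin d => ℝ) i y).const_mul
    (-(2 * a)⁻¹)).mul (gw_hasFDerivAt (1 / 4) y a)
  have e : (fun y : Fin d → ℝ => gi i y a) =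
    ((fun y : Fin d → ℝ => -(2 * a)⁻¹ * y i) * fun y => gw (1/4) y a) := by
    funext z; simp only [gi, Pi.mul_apply]; ring
  rw [e, h1.fderiv]
  simp [gij, Pi.single_apply]
  split_ifs <;> ring

lemma gi_meas (i : Fin d) : Measurable (fun q : (Fin d → ℝ) × ℝ => gi i q.1 q.2) := by
  unfold gi
  have := gw_meas (d := d) (1 / 4)
  fun_prop

lemma gij_meas (i j : Fin d) : Measurable (fun q : (Fin d → ℝ) × ℝ => gij i j q.1 q.2) := by
  unfold gij
  have := gw_meas (d := d) (1 / 4)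
  fun_prop

lemma gw_heat (y : Fin d → ℝ) {a : ℝ} (ha : 0 < a) :
    HasDerivAt (fun a => gw (1 / 4) y a) (∑ i, gij i i y a) a := by
  convert gw_hasDerivAt (1 / 4) y ha using 1
  simp only [gij, ← Finset.sum_mul, if_true]
  congr 1
  rw [Finset.sum_sub_distrib, ← Finset.sum_div]
  simp only [nsq, Finset.sum_const, Finset.card_univ, Fintype.card_fin, nsmul_eq_mul, ← pow_two]
  field_simp

lemma div_sqrt_le (y : Fin d → ℝ) {a : ℝ} (ha : 0 < a) : ‖y‖ ≤ Real.sqrt a * (1 + nsq y / a) := by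
  have hs := Real.sqrt_pos.2 ha
  have h2 := Real.sq_sqrt ha.le
  have h := norm_sq_le_nsq y
  have : ‖y‖ * Real.sqrt a ≤ a + nsq y := by nlinarith [sq_nonneg (‖y‖ - Real.sqrt a), norm_nonneg y]
  have e : Real.sqrt a * (1 + nsq y / a) = (a + nsq y) / Real.sqrt a := by
    rw [eq_div_iff hs.ne']
    calc _ = Real.sqrt a ^ 2 * (1 + nsq y / a) := by ring
      _ = _ := by rw [h2]; field_simp
  rw [e, le_div_iff₀ hs]; exact this

lemma gi_bound (i : Fin d) (y : Fin d → ℝ) {a : ℝ} (ha : 0 < a) :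
    |gi i y a| ≤ 9 * (a ^ (-(1 / 2) : ℝ) * gw (1 / 8) y a) := by
  have hs := Real.sqrt_pos.2 ha
  have h1 : a ^ (-(1 / 2) : ℝ) = (Real.sqrt a)⁻¹ := by
    rw [Real.rpow_neg ha.le, Real.sqrt_eq_rpow]
  have h2 : |y i| ≤ Real.sqrt a * (1 + nsq y / a) :=
    (norm_le_pi_norm y i).trans (div_sqrt_le y ha)
  have h3 := gw_poly (κ := 1 / 4) (by norm_num) y ha
  have g0 := gw_pos (1 / 4) y a
  have h2' := Real.sq_sqrt ha.le
  calc |gi i y a| = |y i| / (2 * a) * gw (1 / 4) y a := by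
        unfold gi
        rw [abs_mul, abs_neg, abs_div, abs_of_pos g0, abs_of_pos (by positivity : 0 < 2 * a)]
    _ ≤ (Real.sqrt a * (1 + nsq y / a)) / (2 * a) * gw (1 / 4) y a := by gcongr
    _ = (Real.sqrt a)⁻¹ / 2 * ((1 + nsq y / a) * gw (1 / 4) y a) := by
        have : Real.sqrt a / a = (Real.sqrt a)⁻¹ := by
          field_simp; rw [h2']
        rw [← this]; field_simp
    _ ≤ (Real.sqrt a)⁻¹ / 2 * ((1 + 2 / (1 / 4)) * gw (1 / 4 / 2) y a) := by gcongr
    _ = 9 / 2 * ((Real.sqrt a)⁻¹ * gw (1 / 8) y a) := by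
        rw [show (1 / 4 / 2 : ℝ) = 1 / 8 by norm_num]; ring
    _ ≤ _ := by
        rw [h1]
        have := gw_pos (1 / 8) y a
        have : 0 < (Real.sqrt a)⁻¹ * gw (1 / 8) y a := by positivity
        linarith

lemma gij_bound (i j : Fin d) (y : Fin d → ℝ) {a : ℝ} (ha : 0 < a) :
    |gij i j y a| ≤ 9 * (a⁻¹ * gw (1 / 8) y a) := by
  have h3 := gw_poly (κ := 1 / 4) (by norm_num) y ha
  have g0 := gw_pos (1 / 4) y a
  have hyy : |y i * y j| ≤ nsq y := by
    rw [abs_le]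
    have h1 := sq_le_nsq y i
    have h2 := sq_le_nsq y j
    constructor <;> nlinarith [sq_nonneg (y i + y j), sq_nonneg (y i - y j)]
  have hc : |y i * y j / (4 * a ^ 2) - (if i = j then 1 else 0) / (2 * a)| ≤ a⁻¹ * (1 + nsq y / a) := by
    refine (abs_sub _ _).trans ?_
    rw [abs_div, abs_div, abs_of_pos (by positivity : 0 < 2 * a),
      abs_of_pos (by positivity : 0 < 4 * a ^ 2)]
    have h1 : |(if i = j then 1 else 0 : ℝ)| ≤ 1 := by split_ifs <;> simp
    calc |y i * y j| / (4 * a ^ 2) + |(if i = j then 1 else 0 : ℝ)| / (2 * a)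
        ≤ nsq y / (1 * a ^ 2) + 1 / (1 * a) := by
          have := nsq_nonneg y
          gcongr <;> norm_num
      _ = _ := by field_simp; ring
  calc |gij i j y a| ≤ (a⁻¹ * (1 + nsq y / a)) * gw (1 / 4) y a := by
        unfold gij
        rw [abs_mul, abs_of_pos g0]
        gcongr
    _ = a⁻¹ * ((1 + nsq y / a) * gw (1 / 4) y a) := by ring
    _ ≤ a⁻¹ * ((1 + 2 / (1 / 4)) * gw (1 / 4 / 2) y a) := by gcongr
    _ = _ := by rw [show (1 / 4 / 2 : ℝ) = 1 / 8 by norm_num]; ring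

lemma sqrt_norm_le (y : Fin d → ℝ) {a : ℝ} (ha : 0 < a) :
    Real.sqrt ‖y‖ ≤ a ^ (1 / 4 : ℝ) * (1 + nsq y / a) := by
  have h := div_sqrt_le y ha
  have hn := nsq_nonneg y
  have h1 : 1 ≤ 1 + nsq y / a := by have : 0 ≤ nsq y / a := by positivity
                                    linarith
  have e : (a ^ (1 / 4 : ℝ)) ^ 2 = Real.sqrt a := by
    rw [← Real.rpow_natCast, ← Real.rpow_mul ha.le, Real.sqrt_eq_rpow]; norm_num
  refine Real.sqrt_le_iff.2 ⟨by positivity, h.trans ?_⟩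
  rw [mul_pow, e]
  have : 0 ≤ Real.sqrt a := Real.sqrt_nonneg a
  gcongr
  nlinarith

lemma gij_bound' (i j : Fin d) (y : Fin d → ℝ) {a : ℝ} (ha : 0 < a) :
    |gij i j y a| * Real.sqrt ‖y‖ ≤ 153 * (a ^ (-(3 / 4) : ℝ) * gw (1 / 16) y a) := by
  have h1 := gij_bound i j y ha
  have h2 := sqrt_norm_le y ha
  have h3 := gw_poly (κ := 1 / 8) (by norm_num) y ha
  have e : a⁻¹ * a ^ (1 / 4 : ℝ) = a ^ (-(3 / 4) : ℝ) := by
    rw [← Real.rpow_neg_one, ← Real.rpow_add ha]; norm_num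
  have := gw_pos (1 / 8) y a
  have hn := nsq_nonneg y
  calc _ ≤ 9 * (a⁻¹ * gw (1 / 8) y a) * (a ^ (1 / 4 : ℝ) * (1 + nsq y / a)) := by gcongr
    _ = 9 * (a⁻¹ * a ^ (1 / 4 : ℝ)) * ((1 + nsq y / a) * gw (1 / 8) y a) := by ring
    _ ≤ 9 * (a⁻¹ * a ^ (1 / 4 : ℝ)) * ((1 + 2 / (1 / 8)) * gw (1 / 8 / 2) y a) := by gcongr
    _ = _ := by rw [e, show (1 / 8 / 2 : ℝ) = 1 / 16 by norm_num]; ring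

/-- time-singular gaussian on a bounded time interval -/
noncomputable def gP (s κ T : ℝ) (q : (Fin d → ℝ) × ℝ) : ℝ :=
  if q.2 ∈ Ioo 0 T then q.2 ^ (-s) * gw κ q.1 q.2 else 0

lemma gP_nonneg (s κ T : ℝ) (q : (Fin d → ℝ) × ℝ) : 0 ≤ gP s κ T q := by
  unfold gP
  split_ifs with h
  · exact mul_nonneg (Real.rpow_nonneg h.1.le _) (gw_pos _ _ _).le
  · exact le_rfl

lemma gP_meas (s κ T : ℝ) : Measurable (gP (d := d) s κ T) := by
  unfold gP
  refine Measurable.ite (measurable_snd measurableSet_Ioo) ?_ measurable_const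
  have := gw_meas (d := d) κ
  fun_prop

lemma gP_integrable {s κ T : ℝ} (hs : s < 1) (hκ : 0 < κ) : Integrable (gP (d := d) s κ T) := by
  have hm := (gP_meas (d := d) s κ T).aestronglyMeasurable (μ := volume)
  rw [Measure.volume_eq_prod] at hm ⊢
  rw [integrable_prod_iff' hm]
  constructor
  · refine Eventually.of_forall fun τ => ?_
    by_cases h : τ ∈ Ioo 0 T
    · simp only [gP, h, if_true]
      exact (gw_integrable hκ h.1).const_mul _
    · simp [gP, h]
  · have e : (fun τ : ℝ => ∫ y : Fin d → ℝ, ‖gP s κ T (y, τ)‖) =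
        (Ioo 0 T).indicator (fun τ => τ ^ (-s) * (Real.sqrt (Real.pi / κ)) ^ d) := by
      funext τ
      by_cases h : τ ∈ Ioo 0 T
      · simp only [gP, h, if_true, indicator_of_mem, Real.norm_eq_abs]
        rw [← gw_integral hκ h.1, ← integral_const_mul]
        refine integral_congr_ae (Eventually.of_forall fun y => ?_)
        simp only
        rw [abs_of_nonneg (mul_nonneg (Real.rpow_nonneg h.1.le _) (gw_pos _ _ _).le)]
      · simp [gP, h]
    rw [e, integrable_indicator_iff measurableSet_Ioo]
    refine IntegrableOn.mono_set (t := Ioc 0 T) ?_ Ioo_subset_Ioc_self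
    refine Integrable.mul_const ?_ _
    rcases le_or_gt 0 T with hT | hT
    · exact (intervalIntegrable_iff_integrableOn_Ioc_of_le hT).1
        (intervalIntegral.intervalIntegrable_rpow' (by linarith))
    · simp [Ioc_eq_empty (not_lt.2 hT.le)]

end Gauss


open Set MeasureTheory Filter Topology

section MaxP

variable {d : ℕ}

lemma hasDerivAt_line {F : Type} [NormedAddCommGroup F] [NormedSpace ℝ F]
    {ψ : (Fin d → ℝ) → F} {x e : Fin d → ℝ} {r : ℝ}
    (h : DifferentiableAt ℝ ψ (x + r • e)) :
    HasDerivAt (fun r : ℝ => ψ (x + r • e)) (fderiv ℝ ψ (x + r • e) e) r := by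
  have h1 : HasDerivAt (fun r : ℝ => x + r • e) e r := by
    simpa using ((hasDerivAt_id r).smul_const e).const_add x
  exact h.hasFDerivAt.comp_hasDerivAt r h1

lemma second_deriv_nonpos {ψ : (Fin d → ℝ) → ℝ} (hψ : ContDiff ℝ 2 ψ) {x : Fin d → ℝ}
    (hm : ∀ y, ψ y ≤ ψ x) (i : Fin d) : pd i (pd i ψ) x ≤ 0 := by
  by_contra! hpos
  set e : Fin d → ℝ := Pi.single i 1 with he
  set g : ℝ → ℝ := fun r => ψ (x + r • e) with hg
  have hd1 : ∀ r, HasDerivAt g (pd i ψ (x + r • e)) r := fun r =>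
    hasDerivAt_line (hψ.differentiable (by norm_num) _)
  have hpd : ContDiff ℝ 1 (pd i ψ) :=
    (hψ.fderiv_right (m := 1) (by norm_num)).clm_apply contDiff_const
  have hd2 : ∀ r, HasDerivAt (fun r => pd i ψ (x + r • e)) (pd i (pd i ψ) (x + r • e)) r := fun r =>
    hasDerivAt_line (hpd.differentiable (by norm_num) _)
  have e1 : deriv g = fun r => pd i ψ (x + r • e) := funext fun r => (hd1 r).deriv
  have e2 : deriv (deriv g) 0 = pd i (pd i ψ) x := by rw [e1, (hd2 0).deriv]; simp
  have hmax : IsLocalMax g 0 := Eventually.of_forall fun r => by simpa [hg] using hm (x + r • e)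
  have hmin := isLocalMin_of_deriv_deriv_pos (by rw [e2]; exact hpos) hmax.deriv_eq_zero
    (hd1 0).continuousAt
  have hconst : g =ᶠ[𝓝 0] fun _ => g 0 := by
    filter_upwards [hmax, hmin] with r h1 h2 using le_antisymm h1 h2
  have h3 : deriv (deriv g) 0 = 0 := by
    have := hconst.deriv.deriv_eq
    rw [this]; simp
  rw [e2] at h3
  exact hpos.ne' h3

/-- compactly supported function, `C²` in space, differentiable in time -/
structure Tst (v : (Fin d → ℝ) → ℝ → ℝ) : Prop where
  cont : Continuous (fun q : (Fin d → ℝ) × ℝ => v q.1 q.2)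
  x2 : ∀ t, ContDiff ℝ 2 (fun x => v x t)
  t1 : ∀ x, Differentiable ℝ (v x)
  supp : HasCompactSupport (fun q : (Fin d → ℝ) × ℝ => v q.1 q.2)

/-- the heat operator -/
noncomputable def heat (v : (Fin d → ℝ) → ℝ → ℝ) (x : Fin d → ℝ) (t : ℝ) : ℝ :=
  deriv (v x) t - ∑ i, dX i (dX i v) x t

lemma Tst.space {v : (Fin d → ℝ) → ℝ → ℝ} (hv : Tst v) :
    ∃ B : Set (Fin d → ℝ), IsCompact B ∧ ∀ x, x ∉ B → ∀ t, v x t = 0 := by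
  refine ⟨_, hv.supp.isCompact.image continuous_fst, fun x hx t => ?_⟩
  by_contra hne
  exact hx ⟨(x, t), subset_tsupport _ hne, rfl⟩

lemma Tst.bdd {v : (Fin d → ℝ) → ℝ → ℝ} (hv : Tst v) :
    ∃ M : ℝ, ∀ x t, |v x t| ≤ M := by
  obtain ⟨C, hC⟩ := hv.cont.bounded_above_of_compact_support hv.supp
  exact ⟨C, fun x t => hC (x, t)⟩

lemma Tst.neg {v : (Fin d → ℝ) → ℝ → ℝ} (hv : Tst v) : Tst (fun x t => - v x t) :=
  ⟨hv.cont.neg, fun t => (hv.x2 t).neg, fun x => (hv.t1 x).neg, hv.supp.comp_left (g := fun r => -r) (by simp)⟩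

lemma dX_neg' (v : (Fin d → ℝ) → ℝ → ℝ) (i : Fin d) :
    dX i (fun x t => - v x t) = fun x t => - dX i v x t := by
  funext x t
  simp only [dX]
  rw [fderiv_fun_neg]; rfl

lemma heat_neg (v : (Fin d → ℝ) → ℝ → ℝ) (x : Fin d → ℝ) (t : ℝ) :
    heat (fun x t => - v x t) x t = - heat v x t := by
  simp only [heat, dX_neg']
  rw [show (fun t => - v x t) = -(v x) from rfl, deriv.neg, Finset.sum_neg_distrib]
  ring

lemma Tst.slice_cs {v : (Fin d → ℝ) → ℝ → ℝ} (hv : Tst v) (t : ℝ) :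
    HasCompactSupport (fun x => v x t) := by
  obtain ⟨B, hB, hz⟩ := hv.space
  exact HasCompactSupport.intro hB fun x hx => hz x hx t

lemma Tst.dX1 {v : (Fin d → ℝ) → ℝ → ℝ} (hv : Tst v) (i : Fin d) (t : ℝ) :
    ContDiff ℝ 1 (fun x => dX i v x t) :=
  ((hv.x2 t).fderiv_right (m := 1) (by norm_num)).clm_apply contDiff_const

lemma Tst.dX1_cs {v : (Fin d → ℝ) → ℝ → ℝ} (hv : Tst v) (i : Fin d) (t : ℝ) :
    HasCompactSupport (fun x => dX i v x t) :=
  (hv.slice_cs t).fderiv_apply (𝕜 := ℝ) _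

lemma Tst.dX2 {v : (Fin d → ℝ) → ℝ → ℝ} (hv : Tst v) (i j : Fin d) (t : ℝ) :
    Continuous (fun x => dX j (dX i v) x t) :=
  ((hv.dX1 i t).continuous_fderiv (by norm_num)).clm_apply continuous_const

lemma Tst.dX2_cs {v : (Fin d → ℝ) → ℝ → ℝ} (hv : Tst v) (i j : Fin d) (t : ℝ) :
    HasCompactSupport (fun x => dX j (dX i v) x t) :=
  (hv.dX1_cs i t).fderiv_apply (𝕜 := ℝ) _

lemma Tst.upper {v : (Fin d → ℝ) → ℝ → ℝ} (hv : Tst v) {M : ℝ}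
    (hM : ∀ x t, |heat v x t| ≤ M) (s : ℝ) :
    ∃ C : ℝ, 0 ≤ C ∧ ∀ δ, 0 ≤ δ → ∀ y, v y (s + δ) - v y s ≤ C * δ := by
  obtain ⟨B, hB, hz⟩ := hv.space
  have hlc : Continuous (fun x => ∑ i, dX i (dX i v) x s) :=
    continuous_finsetSum _ fun i _ => hv.dX2 i i s
  have hls : HasCompactSupport (fun x => ∑ i, dX i (dX i v) x s) := by
    refine HasCompactSupport.intro hB fun x hx => ?_
    refine Finset.sum_eq_zero fun i _ => ?_
    have hzero : ∀ x, x ∉ B → ∀ᶠ y in 𝓝 x, (fun y => v y s) y = 0 := fun x hx =>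
      Filter.eventually_of_mem (hB.isClosed.isOpen_compl.mem_nhds hx) fun y hy => hz y hy s
    have h1 : ∀ᶠ y in 𝓝 x, dX i v y s = 0 := by
      filter_upwards [(hzero x hx).eventually_nhds] with y hy
      have : (fun y => v y s) =ᶠ[𝓝 y] fun _ => (0:ℝ) := hy
      simp [dX, this.fderiv_eq]
    have : (fun y => dX i v y s) =ᶠ[𝓝 x] fun _ => (0:ℝ) := h1
    simp only [dX] at this ⊢
    simp [this.fderiv_eq]
  obtain ⟨L, hL⟩ := hlc.bounded_above_of_compact_support hls
  have hM0 : 0 ≤ M := (abs_nonneg _).trans (hM 0 0)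
  have hL0 : 0 ≤ L := (norm_nonneg _).trans (hL 0)
  refine ⟨L + M + 1, by positivity, fun δ₁ hδ₁ y₁ => ?_⟩
  set C := L + M + 1 with hC
  by_contra! hcon
  set φ : (Fin d → ℝ) × ℝ → ℝ := fun q => v q.1 (s + q.2) - v q.1 s - C * q.2 with hφ
  have hφc : Continuous φ := by
    have h1 : Continuous (fun q : (Fin d → ℝ) × ℝ => v q.1 (s + q.2)) :=
      hv.cont.comp (by fun_prop : Continuous fun q : (Fin d → ℝ) × ℝ => (q.1, s + q.2))
    have h2 : Continuous (fun q : (Fin d → ℝ) × ℝ => v q.1 s) :=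
      hv.cont.comp (by fun_prop : Continuous fun q : (Fin d → ℝ) × ℝ => (q.1, s))
    exact (h1.sub h2).sub (by fun_prop)
  have hy₁ : y₁ ∈ B := by
    by_contra hn
    rw [hz _ hn, hz _ hn] at hcon
    have : 0 ≤ C * δ₁ := by positivity
    linarith
  obtain ⟨⟨y₀, δ₀⟩, hmem, hmax⟩ := (hB.prod (isCompact_Icc (a := 0) (b := δ₁))).exists_isMaxOn
    ⟨(y₁, δ₁), ⟨hy₁, ⟨hδ₁, le_rfl⟩⟩⟩ hφc.continuousOn
  have hpos : 0 < φ (y₀, δ₀) := by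
    have := hmax (show (y₁, δ₁) ∈ B ×ˢ Icc 0 δ₁ from ⟨hy₁, ⟨hδ₁, le_rfl⟩⟩)
    have h2 : 0 < φ (y₁, δ₁) := by simp only [hφ]; linarith
    exact h2.trans_le this
  have hδpos : 0 < δ₀ := by
    rcases hmem.2.1.lt_or_eq with h | h
    · exact h
    · exfalso
      simp only at h
      rw [← h] at hpos; simp [hφ] at hpos
  -- spatial maximum
  have hxm : ∀ y, (fun y => v y (s + δ₀) - v y s) y ≤ (fun y => v y (s + δ₀) - v y s) y₀ := by
    intro y
    simp only [hφ] at hpos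
    by_cases hy : y ∈ B
    · have := hmax (show (y, δ₀) ∈ B ×ˢ Icc 0 δ₁ from ⟨hy, hmem.2⟩)
      simp only [hφ, mem_ofPred_eq] at this
      simp only; linarith
    · simp only
      rw [hz _ hy, hz _ hy]
      have : 0 ≤ C * δ₀ := by positivity
      linarith
  have hlap : ∑ i, dX i (dX i v) y₀ (s + δ₀) ≤ ∑ i, dX i (dX i v) y₀ s := by
    refine Finset.sum_le_sum fun i _ => ?_
    have h1 := second_deriv_nonpos ((hv.x2 (s + δ₀)).sub (hv.x2 s)) hxm i
    have e1 : pd i (fun y => v y (s + δ₀) - v y s) = fun y => dX i v y (s + δ₀) - dX i v y s := by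
      funext y
      simp only [pd, dX]
      rw [fderiv_fun_sub ((hv.x2 _).differentiable (by norm_num) _)
        ((hv.x2 _).differentiable (by norm_num) _)]; rfl
    rw [e1] at h1
    simp only [pd] at h1
    rw [fderiv_fun_sub ((hv.dX1 i _).differentiable (by norm_num) _)
        ((hv.dX1 i _).differentiable (by norm_num) _)] at h1
    have h2 : dX i (dX i v) y₀ (s + δ₀) - dX i (dX i v) y₀ s ≤ 0 := h1
    linarith
  -- time derivative
  have ht : C ≤ deriv (v y₀) (s + δ₀) := by
    have hd : HasDerivAt (fun δ => φ (y₀, δ)) (deriv (v y₀) (s + δ₀) - C) δ₀ := by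
      have h1 : HasDerivAt (fun δ => v y₀ (s + δ)) (deriv (v y₀) (s + δ₀)) δ₀ :=
        HasDerivAt.comp_const_add s δ₀ (hv.t1 y₀ (s + δ₀)).hasDerivAt
      have h2 := ((h1.sub_const (v y₀ s)).sub ((hasDerivAt_id δ₀).const_mul C))
      refine HasDerivAt.congr_deriv (f' := deriv (v y₀) (s + δ₀) - C * 1) ?_ (by ring)
      exact h2
    by_contra! hlt
    have hneg : deriv (v y₀) (s + δ₀) - C < 0 := by linarith
    have hsl := hasDerivAt_iff_tendsto_slope.1 hd
    have hsl' := hsl.mono_left (nhdsWithin_mono (t := {δ₀}ᶜ) (s := Iio δ₀) δ₀ (fun z hz => ne_of_lt hz))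
    have hev := hsl'.eventually (gt_mem_nhds hneg)
    have hev2 : ∀ᶠ z in 𝓝[<] δ₀, z ∈ Ioo 0 δ₀ := Ioo_mem_nhdsLT hδpos
    obtain ⟨z, hz1, hz2⟩ := (hev.and hev2).exists
    have := hmax (show (y₀, z) ∈ B ×ˢ Icc 0 δ₁ from ⟨hmem.1, ⟨hz2.1.le, hz2.2.le.trans hmem.2.2⟩⟩)
    simp only [mem_ofPred_eq] at this
    rw [slope_def_field] at hz1
    have h3 : 0 ≤ (φ (y₀, z) - φ (y₀, δ₀)) / (z - δ₀) :=
      div_nonneg_of_nonpos (by linarith) (by linarith [hz2.2])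
    linarith
  have hh := (abs_le.1 (hM y₀ (s + δ₀))).2
  have hl := (abs_le.1 (hL y₀)).2
  simp only [heat] at hh
  linarith

lemma Tst.lip {v : (Fin d → ℝ) → ℝ → ℝ} (hv : Tst v) {M : ℝ}
    (hM : ∀ x t, |heat v x t| ≤ M) (s : ℝ) :
    ∃ C : ℝ, 0 ≤ C ∧ ∀ δ, 0 ≤ δ → ∀ y, |v y (s + δ) - v y s| ≤ C * δ := by
  obtain ⟨C1, h1, k1⟩ := hv.upper hM s
  obtain ⟨C2, h2, k2⟩ := hv.neg.upper (M := M) (fun x t => by rw [heat_neg, abs_neg]; exact hM x t) s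
  refine ⟨C1 + C2, by positivity, fun δ hδ y => ?_⟩
  have a1 := k1 δ hδ y
  have a2 := k2 δ hδ y
  have b1 : 0 ≤ C1 * δ := by positivity
  have b2 : 0 ≤ C2 * δ := by positivity
  rw [abs_le]
  constructor <;> nlinarith

lemma Tst.heat_meas {v : (Fin d → ℝ) → ℝ → ℝ} (hv : Tst v) :
    Measurable (fun q : (Fin d → ℝ) × ℝ => heat v q.1 q.2) := by
  have m1 : Measurable (fun q : (Fin d → ℝ) × ℝ => deriv (v q.1) q.2) :=
    measurable_deriv_with_param hv.cont
  have m2 : ∀ i, Measurable (fun q : (Fin d → ℝ) × ℝ => dX i v q.1 q.2) := by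
    intro i
    have hc : Continuous (Function.uncurry (fun (t : ℝ) (y : Fin d → ℝ) => v y t)) :=
      hv.cont.comp continuous_swap
    exact (measurable_fderiv_apply_const_with_param ℝ hc (Pi.single i (1:ℝ))).comp measurable_swap
  have m3 : ∀ i, Measurable (fun q : (Fin d → ℝ) × ℝ => dX i (dX i v) q.1 q.2) := by
    intro i
    refine measurable_of_tendsto_metrizable (f := fun (n : ℕ) (q : (Fin d → ℝ) × ℝ) =>
      (1 / ((n : ℝ) + 1))⁻¹ * (dX i v (q.1 + (1 / ((n : ℝ) + 1)) • Pi.single i 1) q.2 - dX i v q.1 q.2))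
      (fun n => ?_) ?_
    · have : Measurable (fun q : (Fin d → ℝ) × ℝ => (q.1 + (1 / ((n : ℝ) + 1)) • Pi.single i 1, q.2)) := by
        fun_prop
      exact (((m2 i).comp this).sub (m2 i)).const_mul _
    · rw [tendsto_pi_nhds]
      intro q
      have hd := hasDerivAt_line (ψ := fun y => dX i v y q.2) (x := q.1) (e := Pi.single i 1) (r := 0)
        ((hv.dX1 i q.2).differentiable (by norm_num) _)
      rw [hasDerivAt_iff_tendsto_slope_zero] at hd
      have hn : Tendsto (fun n : ℕ => 1 / ((n : ℝ) + 1)) atTop (𝓝[≠] 0) := by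
        refine tendsto_nhdsWithin_iff.2 ⟨tendsto_one_div_add_atTop_nhds_zero_nat,
          Eventually.of_forall fun n => ?_⟩
        have : (0:ℝ) < 1 / ((n : ℝ) + 1) := by positivity
        exact this.ne'
      have := hd.comp hn
      simp only [Function.comp_def, zero_add, zero_smul, add_zero, smul_eq_mul] at this
      exact this
  unfold heat
  exact m1.sub (Finset.measurable_fun_sum _ fun i _ => m3 i)

lemma ibp0 {φ : (Fin d → ℝ) → ℝ} (h1 : ContDiff ℝ 1 φ) (hs : HasCompactSupport φ) (e : Fin d → ℝ) :
    ∫ y, fderiv ℝ φ y e = 0 := by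
  have hc : Continuous (fun y => fderiv ℝ φ y e) :=
    (h1.continuous_fderiv (by norm_num)).clm_apply continuous_const
  have hi : Integrable (fun y => fderiv ℝ φ y e) :=
    hc.integrable_of_hasCompactSupport (hs.fderiv_apply (𝕜 := ℝ) _)
  have := integral_mul_fderiv_eq_neg_fderiv_mul_of_integrable (μ := (volume : Measure (Fin d → ℝ)))
    (f := fun _ => (1 : ℝ)) (g := φ) (v := e)
    (by simp) (by simpa using hi)
    (by simpa using h1.continuous.integrable_of_hasCompactSupport hs)
    (fun x _ => by fun_prop) (fun x _ => h1.differentiable (by norm_num) _)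
  simpa using this

end MaxP


open Set MeasureTheory Filter Topology

section Duhamel

variable {d : ℕ}

lemma gw_le (κ : ℝ) (hκ : 0 ≤ κ) (y : Fin d → ℝ) {a : ℝ} (ha : 0 < a) :
    gw κ y a ≤ ((Real.sqrt a) ^ d)⁻¹ := by
  rw [gw_eq κ y ha]
  have h1 : ∏ i, Real.exp (-(κ / a) * y i ^ 2) ≤ 1 := by
    refine Finset.prod_le_one (fun i _ => (Real.exp_pos _).le) fun i _ => ?_
    rw [Real.exp_le_one_iff]
    have : 0 ≤ κ / a * y i ^ 2 := by positivity
    linarith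
  have h0 : 0 ≤ ((Real.sqrt a) ^ d)⁻¹ := by positivity
  nlinarith

lemma gw_time_lip (z : Fin d → ℝ) {a b : ℝ} (hb : 0 < b) (hba : b ≤ a) :
    |gw (1 / 4) z b - gw (1 / 4) z a| ≤
      d * (9 * (b⁻¹ * ((Real.sqrt b) ^ d)⁻¹)) * (a - b) := by
  have hbd : ∀ r ∈ Icc b a, ‖∑ i, gij i i z r‖ ≤ d * (9 * (b⁻¹ * ((Real.sqrt b) ^ d)⁻¹)) := by
    intro r hr
    have hr0 : 0 < r := hb.trans_le hr.1
    refine (norm_sum_le _ _).trans ?_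
    calc ∑ i, ‖gij i i z r‖ ≤ ∑ _i : Fin d, 9 * (b⁻¹ * ((Real.sqrt b) ^ d)⁻¹) := by
          refine Finset.sum_le_sum fun i _ => ?_
          refine (gij_bound i i z hr0).trans ?_
          have h1 := gw_le (1 / 8) (by norm_num) z hr0
          have h2 : ((Real.sqrt r) ^ d)⁻¹ ≤ ((Real.sqrt b) ^ d)⁻¹ := by
            have : 0 < Real.sqrt b := Real.sqrt_pos.2 hb
            have := Real.sqrt_le_sqrt hr.1
            gcongr
          have h3 := h1.trans h2
          have h4 := gw_pos (1 / 8) z r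
          have h5 : r⁻¹ ≤ b⁻¹ := by gcongr; exact hr.1
          have : 0 < r⁻¹ := by positivity
          gcongr
      _ = _ := by simp
  have := Convex.norm_image_sub_le_of_norm_hasDerivWithin_le (𝕜 := ℝ)
    (f := fun r => gw (1 / 4) z r) (f' := fun r => ∑ i, gij i i z r) (s := Icc b a)
    (x := a) (y := b) (C := d * (9 * (b⁻¹ * ((Real.sqrt b) ^ d)⁻¹)))
    (fun r hr => (gw_heat z (hb.trans_le hr.1)).hasDerivWithinAt) hbd (convex_Icc _ _)
    ⟨hba, le_rfl⟩ ⟨le_rfl, hba⟩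
  rw [Real.norm_eq_abs, Real.norm_eq_abs, abs_of_nonpos (by linarith : b - a ≤ 0)] at this
  simpa using this

lemma gw_slice_cont (κ : ℝ) (a : ℝ) : Continuous (fun y : Fin d → ℝ => gw κ y a) :=
  (gw_contDiff κ a (n := 0)).continuous

lemma Tst.slice_cont {v : (Fin d → ℝ) → ℝ → ℝ} (hv : Tst v) (s : ℝ) :
    Continuous (fun y => v y s) := hv.cont.comp (by fun_prop : Continuous fun y : Fin d → ℝ => (y, s))

lemma Tst.J_int {v : (Fin d → ℝ) → ℝ → ℝ} (hv : Tst v) (x : Fin d → ℝ) (a s : ℝ) :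
    Integrable (fun y => gw (1 / 4) (x - y) a * v y s) := by
  refine Continuous.integrable_of_hasCompactSupport ?_ ((hv.slice_cs s).mul_left)
  exact ((gw_slice_cont _ _).comp (by fun_prop)).mul (hv.slice_cont s)

lemma Tst.J_deriv {v : (Fin d → ℝ) → ℝ → ℝ} (hv : Tst v) {M : ℝ}
    (hM : ∀ x t, |heat v x t| ≤ M) (x : Fin d → ℝ) {s t : ℝ} (hst : s < t) :
    HasDerivWithinAt (fun s' => ∫ y, gw (1 / 4) (x - y) (t - s') * v y s')
      (∫ y, (gw (1 / 4) (x - y) (t - s) * deriv (v y) s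
        - (∑ i, gij i i (x - y) (t - s)) * v y s)) (Ioi s) s := by
  obtain ⟨B, hB, hz⟩ := hv.space
  obtain ⟨Mv, hMv⟩ := hv.bdd
  obtain ⟨C, hC0, hC⟩ := hv.lip hM s
  have hMv0 : 0 ≤ Mv := (abs_nonneg _).trans (hMv 0 0)
  rw [hasDerivWithinAt_iff_tendsto_slope' (by simp)]
  set b := (t - s) / 2 with hb
  have hb0 : 0 < b := by rw [hb]; linarith
  set C1 := d * (9 * (b⁻¹ * ((Real.sqrt b) ^ d)⁻¹)) with hC1
  have hC10 : 0 ≤ C1 := by positivity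
  set C2 := ((Real.sqrt (t - s)) ^ d)⁻¹ with hC2
  have hC20 : 0 ≤ C2 := by positivity
  have hev : ∀ᶠ s' in 𝓝[>] s, s' ∈ Ioo s (s + b) := Ioo_mem_nhdsGT (by linarith)
  have heq : (fun s' => ∫ y, (s' - s)⁻¹ * (gw (1 / 4) (x - y) (t - s') * v y s'
      - gw (1 / 4) (x - y) (t - s) * v y s)) = slope
      (fun s' => ∫ y, gw (1 / 4) (x - y) (t - s') * v y s') s := by
    funext s'
    rw [slope_def_module, integral_const_mul, integral_sub (hv.J_int _ _ _) (hv.J_int _ _ _)]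
    rfl
  rw [← heq]
  refine tendsto_integral_filter_of_dominated_convergence
    (B.indicator fun _ => C1 * Mv + C2 * C) ?_ ?_ ?_ ?_
  · refine Eventually.of_forall fun s' => ?_
    exact (((hv.J_int x (t - s') s').sub (hv.J_int x (t - s) s)).const_mul _).aestronglyMeasurable
  · filter_upwards [hev] with s' hs'
    refine Eventually.of_forall fun y => ?_
    by_cases hy : y ∈ B
    · rw [indicator_of_mem hy, norm_mul, norm_inv, Real.norm_eq_abs, Real.norm_eq_abs,
        abs_of_pos (by linarith [hs'.1] : 0 < s' - s)]
      rw [inv_mul_le_iff₀ (by linarith [hs'.1])]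
      have h1 : |gw (1 / 4) (x - y) (t - s') - gw (1 / 4) (x - y) (t - s)| ≤ C1 * (s' - s) := by
        have hle : b ≤ t - s' := by rw [hb] at hs' ⊢; linarith [hs'.2]
        have hb' : 0 < t - s' := hb0.trans_le hle
        refine (gw_time_lip (x - y) hb' (by linarith [hs'.1])).trans ?_
        rw [show t - s - (t - s') = s' - s by ring]
        have : 0 ≤ s' - s := by linarith [hs'.1]
        have hsq := Real.sqrt_pos.2 hb0
        have hsq' := Real.sqrt_le_sqrt hle
        rw [hC1]
        gcongr
      have h2 : |v y s' - v y s| ≤ C * (s' - s) := by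
        have := hC (s' - s) (by linarith [hs'.1]) y
        simpa using this
      have h3 : gw (1 / 4) (x - y) (t - s) ≤ C2 := gw_le _ (by norm_num) _ (by linarith)
      have h4 := gw_pos (1 / 4) (x - y) (t - s)
      calc |gw (1 / 4) (x - y) (t - s') * v y s' - gw (1 / 4) (x - y) (t - s) * v y s|
          = |(gw (1 / 4) (x - y) (t - s') - gw (1 / 4) (x - y) (t - s)) * v y s'
              + gw (1 / 4) (x - y) (t - s) * (v y s' - v y s)| := by congr 1; ring
        _ ≤ (C1 * (s' - s)) * Mv + C2 * (C * (s' - s)) := by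
            refine (abs_add_le _ _).trans ?_
            rw [abs_mul, abs_mul, abs_of_pos h4]
            have := hMv y s'
            have hss : 0 ≤ s' - s := by linarith [hs'.1]
            have := mul_nonneg hC10 hss
            gcongr
        _ = _ := by ring
    · rw [indicator_of_notMem hy, hz _ hy, hz _ hy]; simp
  · rw [integrable_indicator_iff hB.measurableSet]
    exact integrableOn_const hB.measure_lt_top.ne
  · refine Eventually.of_forall fun y => ?_
    have h1 : HasDerivAt (fun s' => gw (1 / 4) (x - y) (t - s'))
        (-(∑ i, gij i i (x - y) (t - s))) s := by
      have hg := gw_heat (x - y) (a := t - s) (by linarith)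
      have := HasDerivAt.comp_const_sub t s hg
      simpa using this
    have h2 := h1.mul (hv.t1 y s).hasDerivAt
    have h3 := (hasDerivAt_iff_tendsto_slope.1 h2).mono_left
      (nhdsWithin_mono (s := Ioi s) (t := {s}ᶜ) s (fun z hz => ne_of_gt hz))
    have e1 : -(∑ i, gij i i (x - y) (t - s)) * v y s + gw (1 / 4) (x - y) (t - s) * deriv (v y) s =
        gw (1 / 4) (x - y) (t - s) * deriv (v y) s - (∑ i, gij i i (x - y) (t - s)) * v y s := by
      ring
    rw [e1] at h3
    refine h3.congr fun s' => ?_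
    rw [slope_def_module]; rfl

lemma Tst.heat_slice_int {v : (Fin d → ℝ) → ℝ → ℝ} (hv : Tst v) {M : ℝ}
    (hM : ∀ x t, |heat v x t| ≤ M) (x : Fin d → ℝ) {a : ℝ} (ha : 0 < a) (s : ℝ) :
    Integrable (fun y => gw (1 / 4) (x - y) a * heat v y s) := by
  refine Integrable.mul_bdd (c := M) ((gw_integrable (by norm_num) ha).comp_sub_left x) ?_ ?_
  · exact (hv.heat_meas.comp (by fun_prop : Measurable fun y : Fin d → ℝ => (y, s))).aestronglyMeasurable
  · exact Eventually.of_forall fun y => hM y s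

lemma Tst.J_ibp {v : (Fin d → ℝ) → ℝ → ℝ} (hv : Tst v) {M : ℝ}
    (hM : ∀ x t, |heat v x t| ≤ M) (x : Fin d → ℝ) {a : ℝ} (ha : 0 < a) (s : ℝ) :
    ∫ y, (gw (1 / 4) (x - y) a * deriv (v y) s - (∑ i, gij i i (x - y) a) * v y s) =
      ∫ y, gw (1 / 4) (x - y) a * heat v y s := by
  set ψ : Fin d → (Fin d → ℝ) → ℝ := fun i y =>
    gw (1 / 4) (x - y) a * dX i v y s + gi i (x - y) a * v y s with hψ
  have hsub : ContDiff ℝ 1 (fun y : Fin d → ℝ => x - y) := by fun_prop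
  have hψ1 : ∀ i, ContDiff ℝ 1 (ψ i) := fun i =>
    (((gw_contDiff _ a).comp hsub).mul (hv.dX1 i s)).add
      (((gi_contDiff i a).comp hsub).mul ((hv.x2 s).of_le (by norm_num)))
  have hψc : ∀ i, HasCompactSupport (ψ i) := fun i =>
    ((hv.dX1_cs i s).mul_left).add ((hv.slice_cs s).mul_left)
  have hsubd : ∀ y, HasFDerivAt (fun y : Fin d → ℝ => x - y) (-ContinuousLinearMap.id ℝ _) y :=
    fun y => (hasFDerivAt_id y).const_sub x
  have hd : ∀ i y, fderiv ℝ (ψ i) y (Pi.single i 1) =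
      gw (1 / 4) (x - y) a * dX i (dX i v) y s - gij i i (x - y) a * v y s := by
    intro i y
    have d1 : HasFDerivAt (fun y => gw (1 / 4) (x - y) a) _ y :=
      HasFDerivAt.comp (g := fun y => gw (1 / 4) y a) y ((gw_contDiff (1 / 4) a (n := 1)).differentiable (by norm_num) (x - y)).hasFDerivAt (hsubd y)
    have d2 : HasFDerivAt (fun y => gi i (x - y) a) _ y :=
      HasFDerivAt.comp (g := fun y => gi i y a) y ((gi_contDiff i a (n := 1)).differentiable (by norm_num) (x - y)).hasFDerivAt (hsubd y)
    have d3 := ((hv.dX1 i s).differentiable (by norm_num) y).hasFDerivAt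
    have d4 := ((hv.x2 s).differentiable (by norm_num) y).hasFDerivAt
    have := ((d1.mul d3).add (d2.mul d4)).fderiv
    rw [show ψ i = ((fun y => gw (1 / 4) (x - y) a) * fun y => dX i v y s) +
      ((fun y => gi i (x - y) a) * fun y => v y s) from rfl, this]
    simp only [ContinuousLinearMap.add_apply, ContinuousLinearMap.smul_apply,
      ContinuousLinearMap.comp_apply, ContinuousLinearMap.neg_apply, ContinuousLinearMap.id_apply,
      map_neg, gw_fderiv, gi_fderiv, smul_eq_mul]
    simp only [dX]
    ring
  have hsum : ∀ y, gw (1 / 4) (x - y) a * deriv (v y) s - (∑ i, gij i i (x - y) a) * v y s =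
      gw (1 / 4) (x - y) a * heat v y s + ∑ i, fderiv ℝ (ψ i) y (Pi.single i 1) := by
    intro y
    simp only [hd, heat, Finset.sum_sub_distrib, ← Finset.mul_sum, ← Finset.sum_mul]
    ring
  have hi : ∀ i, Integrable (fun y => fderiv ℝ (ψ i) y (Pi.single i 1)) := fun i =>
    (((hψ1 i).continuous_fderiv (by norm_num)).clm_apply continuous_const).integrable_of_hasCompactSupport
      ((hψc i).fderiv_apply (𝕜 := ℝ) _)
  simp only [hsum]
  rw [integral_add (hv.heat_slice_int hM x ha s) (integrable_finsetSum _ fun i _ => hi i),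
    integral_finsetSum _ fun i _ => hi i]
  simp [ibp0 (hψ1 _) (hψc _)]

/-- space time convolution -/
noncomputable def cv (K : (Fin d → ℝ) × ℝ → ℝ) (G : (Fin d → ℝ) → ℝ → ℝ) (x : Fin d → ℝ) (t : ℝ) : ℝ :=
  ∫ q : (Fin d → ℝ) × ℝ, K q * G (x - q.1) (t - q.2)

/-- truncated heat kernel -/
noncomputable def k0 (T : ℝ) (q : (Fin d → ℝ) × ℝ) : ℝ :=
  if q.2 ∈ Ioo 0 T then gw (1 / 4) q.1 q.2 else 0

lemma k0_eq (T : ℝ) : k0 (d := d) T = gP 0 (1 / 4) T := by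
  funext q; simp [k0, gP]

lemma k0_int (T : ℝ) : Integrable (k0 (d := d) T) := by
  rw [k0_eq]; exact gP_integrable (by norm_num) (by norm_num)

lemma cv_int {K : (Fin d → ℝ) × ℝ → ℝ} (hK : Integrable K) {G : (Fin d → ℝ) → ℝ → ℝ}
    (hG : Measurable (fun q : (Fin d → ℝ) × ℝ => G q.1 q.2)) {M : ℝ} (hM : ∀ x t, |G x t| ≤ M)
    (x : Fin d → ℝ) (t : ℝ) :
    Integrable (fun q : (Fin d → ℝ) × ℝ => K q * G (x - q.1) (t - q.2)) := by
  refine Integrable.mul_bdd (c := M) hK ?_ ?_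
  · exact (hG.comp (by fun_prop : Measurable fun q : (Fin d → ℝ) × ℝ =>
      (x - q.1, t - q.2))).aestronglyMeasurable
  · exact Eventually.of_forall fun y => hM _ _

lemma Tst.duhamel {v : (Fin d → ℝ) → ℝ → ℝ} (hv : Tst v) {M : ℝ}
    (hM : ∀ x t, |heat v x t| ≤ M) (x : Fin d → ℝ) {t T : ℝ} (hT : 0 < T)
    (h0 : ∀ y, v y (t - T) = 0) :
    cv (k0 T) (heat v) x t = (∫ y : Fin d → ℝ, gw (1 / 4) y 1) * v x t := by
  obtain ⟨Mv, hMv⟩ := hv.bdd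
  set Jt : ℝ → ℝ := fun a => ∫ z : Fin d → ℝ, gw (1 / 4) z 1 * v (x - Real.sqrt a • z) (t - a) with hJt
  have hJc : Continuous Jt := by
    refine continuous_of_dominated (bound := fun z => gw (1 / 4) z 1 * Mv) ?_ ?_ ?_ ?_
    · intro a
      refine (((gw_slice_cont _ _)).mul (hv.cont.comp
        (by fun_prop : Continuous fun z : Fin d → ℝ => (x - Real.sqrt a • z, t - a)))).aestronglyMeasurable
    · intro a
      refine Eventually.of_forall fun z => ?_
      rw [norm_mul, Real.norm_eq_abs, Real.norm_eq_abs, abs_of_pos (gw_pos _ _ _)]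
      exact mul_le_mul_of_nonneg_left (hMv _ _) (gw_pos _ _ _).le
    · exact (gw_integrable (by norm_num) one_pos).mul_const _
    · refine Eventually.of_forall fun z => ?_
      exact continuous_const.mul (hv.cont.comp
        (by fun_prop : Continuous fun a : ℝ => (x - Real.sqrt a • z, t - a)))
  have hJ : ∀ s, s < t → (∫ y, gw (1 / 4) (x - y) (t - s) * v y s) = Jt (t - s) := by
    intro s hs
    rw [hJt]
    simp only
    rw [← gw_scale_integral (1 / 4) (by linarith : 0 < t - s) (fun y => v (x - y) (t - (t - s)))]
    rw [← integral_sub_left_eq_self _ _ x]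
    simp
  set f' : ℝ → ℝ := fun s => ∫ y, gw (1 / 4) (x - y) (t - s) * heat v y s with hf'
  have hder : ∀ s ∈ Ioo (t - T) t, HasDerivWithinAt (fun s => Jt (t - s)) (f' s) (Ioi s) s := by
    intro s hs
    have h1 := hv.J_deriv hM x hs.2
    rw [hv.J_ibp hM x (by linarith [hs.2])] at h1
    refine h1.congr_of_eventuallyEq ?_ (hJ s hs.2).symm
    filter_upwards [Ioo_mem_nhdsGT hs.2] with s' hs' using (hJ s' hs'.2).symm
  have h_intg := cv_int (k0_int T) hv.heat_meas hM x t
  rw [Measure.volume_eq_prod] at h_intg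
  have hmarg := h_intg.integral_prod_right
  have hmeq : ∀ τ, (∫ y, k0 T (y, τ) * heat v (x - y) (t - τ)) =
      (Ioo 0 T).indicator (fun τ => f' (t - τ)) τ := by
    intro τ
    by_cases h : τ ∈ Ioo 0 T
    · rw [indicator_of_mem h, hf']
      simp only [k0, h, if_true]
      rw [← integral_sub_left_eq_self _ _ x]
      simp
    · rw [indicator_of_notMem h]
      simp [k0, h]
  have hfi : IntervalIntegrable (fun τ => f' (t - τ)) volume 0 T := by
    rw [intervalIntegrable_iff_integrableOn_Ioo_of_le hT.le, ← integrable_indicator_iff measurableSet_Ioo]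
    refine hmarg.congr (Eventually.of_forall fun τ => ?_)
    exact hmeq τ
  have hfi' : IntervalIntegrable f' volume (t - T) t := by
    have := hfi.comp_sub_left t
    simpa using this.symm
  have hftc := intervalIntegral.integral_eq_sub_of_hasDeriv_right (a := t - T) (b := t)
    (f := fun s => Jt (t - s)) (f' := f') (by fun_prop)
    (by rw [min_eq_left (by linarith), max_eq_right (by linarith)]; exact hder) hfi'
  have hJ0 : Jt 0 = (∫ y : Fin d → ℝ, gw (1 / 4) y 1) * v x t := by
    rw [hJt]; simp [integral_mul_const]
  have hJT : Jt T = 0 := by rw [hJt]; simp [h0]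
  simp only [sub_self, sub_sub_cancel, hJ0, hJT, sub_zero] at hftc
  rw [← hftc]
  unfold cv
  rw [Measure.volume_eq_prod, integral_prod_symm _ h_intg]
  calc ∫ τ, ∫ y, k0 T (y, τ) * heat v (x - y) (t - τ)
      = ∫ τ, (Ioo 0 T).indicator (fun τ => f' (t - τ)) τ := integral_congr_ae (Eventually.of_forall hmeq)
    _ = ∫ τ in (0:ℝ)..T, f' (t - τ) := by
        rw [integral_indicator measurableSet_Ioo, intervalIntegral.integral_of_le hT.le,
          integral_Ioc_eq_integral_Ioo]
    _ = ∫ s in (t - T)..t, f' s := by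
        rw [intervalIntegral.integral_comp_sub_left f' t]; simp

end Duhamel


open Set MeasureTheory Filter Topology

section Conv

variable {d : ℕ}

instance vol_haar : (volume : Measure ((Fin d → ℝ) × ℝ)).IsAddHaarMeasure :=
  Measure.prod.instIsAddHaarMeasure (volume : Measure (Fin d → ℝ)) (volume : Measure ℝ)

instance vol_neg : (volume : Measure ((Fin d → ℝ) × ℝ)).IsNegInvariant :=
  Measure.IsAddHaarMeasure.isNegInvariant_of_regular _

lemma cv_eq (K : (Fin d → ℝ) × ℝ → ℝ) (G : (Fin d → ℝ) → ℝ → ℝ) (x : Fin d → ℝ) (t : ℝ) :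
    cv K G x t = ∫ q : (Fin d → ℝ) × ℝ, K ((x, t) - q) * G q.1 q.2 := by
  unfold cv
  rw [← integral_sub_left_eq_self (fun q : (Fin d → ℝ) × ℝ => K q * G (x - q.1) (t - q.2)) volume (x, t)]
  simp

lemma cv_sub_le {K K' : (Fin d → ℝ) × ℝ → ℝ} (hK : Integrable K) (hK' : Integrable K')
    {G : (Fin d → ℝ) → ℝ → ℝ}
    (hG : Measurable (fun q : (Fin d → ℝ) × ℝ => G q.1 q.2)) {M : ℝ} (hM : ∀ x t, |G x t| ≤ M)
    (x : Fin d → ℝ) (t : ℝ) :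
    |cv K G x t - cv K' G x t| ≤ (∫ q, ‖K q - K' q‖) * M := by
  unfold cv
  rw [← integral_sub (cv_int hK hG hM x t) (cv_int hK' hG hM x t), ← Real.norm_eq_abs,
    ← integral_mul_const]
  refine norm_integral_le_of_norm_le ((hK.sub hK').norm.mul_const _) (Eventually.of_forall fun q => ?_)
  rw [← sub_mul, norm_mul]
  exact mul_le_mul_of_nonneg_left (hM _ _) (norm_nonneg _)

lemma cv_cont {K : (Fin d → ℝ) × ℝ → ℝ} (hK : Integrable K)
    {G : (Fin d → ℝ) → ℝ → ℝ}
    (hG : Measurable (fun q : (Fin d → ℝ) × ℝ => G q.1 q.2)) {M : ℝ} (hM : ∀ x t, |G x t| ≤ M) :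
    Continuous (fun q : (Fin d → ℝ) × ℝ => cv K G q.1 q.2) := by
  have hM0 : 0 ≤ M := (abs_nonneg _).trans (hM 0 0)
  refine continuous_of_uniform_approx_of_continuous fun s hs => ?_
  obtain ⟨ε, hε, hεs⟩ := Metric.mem_uniformity_dist.1 hs
  obtain ⟨g, hgc, hg1, hg2, hg3⟩ := hK.exists_hasCompactSupport_integral_sub_le
    (ε := ε / (2 * (M + 1))) (by positivity)
  refine ⟨fun q => cv g G q.1 q.2, ?_, fun q => hεs ?_⟩
  · have hl : LocallyIntegrable (fun q : (Fin d → ℝ) × ℝ => G q.1 q.2) volume := by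
      refine (locallyIntegrable_const M).mono hG.aestronglyMeasurable (Eventually.of_forall fun q => ?_)
      exact (hM _ _).trans (le_abs_self M)
    have := hgc.continuous_convolution_left (ContinuousLinearMap.mul ℝ ℝ) hg2 hl
    exact this
  · rw [Real.dist_eq]
    have := cv_sub_le hK hg3 hG hM q.1 q.2
    refine this.trans_lt ?_
    calc _ ≤ ε / (2 * (M + 1)) * M := by gcongr
      _ < ε := by
        rw [div_mul_eq_mul_div, div_lt_iff₀ (by positivity)]
        nlinarith

lemma cv_line {K K' : (Fin d → ℝ) × ℝ → ℝ} (hK : Integrable K) (hK' : Integrable K')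
    (hKm : Measurable K') (e : Fin d → ℝ)
    (hd : ∀ (y : Fin d → ℝ) (τ r : ℝ), HasDerivAt (fun r : ℝ => K (y + r • e, τ)) (K' (y + r • e, τ)) r)
    (hc : ∀ (y : Fin d → ℝ) (τ : ℝ), Continuous (fun r : ℝ => K' (y + r • e, τ)))
    {G : (Fin d → ℝ) → ℝ → ℝ}
    (hG : Measurable (fun q : (Fin d → ℝ) × ℝ => G q.1 q.2)) {M : ℝ} (hM : ∀ x t, |G x t| ≤ M)
    (x : Fin d → ℝ) (t r : ℝ) :
    HasDerivAt (fun r : ℝ => cv K G (x + r • e) t) (cv K' G (x + r • e) t) r := by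
  have hcc : Continuous (fun r : ℝ => cv K' G (x + r • e) t) :=
    (cv_cont hK' hG hM).comp (by fun_prop : Continuous fun r : ℝ => (x + r • e, t))
  have key : ∀ r : ℝ, cv K G (x + r • e) t = cv K G x t + ∫ s in (0:ℝ)..r, cv K' G (x + s • e) t := by
    intro r
    have hFub : Integrable (Function.uncurry fun (s : ℝ) (q : (Fin d → ℝ) × ℝ) =>
        K' ((x + s • e, t) - q) * G q.1 q.2) ((volume.restrict (uIoc 0 r)).prod volume) := by
      refine Integrable.mul_bdd (c := M) ?_ ?_ ?_
      · have hm : Measurable (fun p : ℝ × ((Fin d → ℝ) × ℝ) => K' ((x + p.1 • e, t) - p.2)) :=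
          hKm.comp (by fun_prop)
        rw [integrable_prod_iff hm.aestronglyMeasurable]
        constructor
        · exact Eventually.of_forall fun s => hK'.comp_sub_left (x + s • e, t)
        · have : (fun s : ℝ => ∫ q : (Fin d → ℝ) × ℝ, ‖K' ((x + s • e, t) - q)‖) =
              fun s => ∫ q, ‖K' q‖ := by
            funext s
            exact integral_sub_left_eq_self (fun q => ‖K' q‖) volume (x + s • e, t)
          simp only [this]
          have : IsFiniteMeasure (volume.restrict (uIoc 0 r)) := by
            rw [uIoc]; infer_instance
          exact integrable_const _
      · exact (hG.comp measurable_snd).aestronglyMeasurable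
      · exact Eventually.of_forall fun y => hM _ _
    have := intervalIntegral_integral_swap (a := 0) (b := r) hFub
    simp only [cv_eq]
    rw [this, ← integral_add]
    · refine integral_congr_ae (Eventually.of_forall fun q => ?_)
      simp only
      have h1 : ∫ s in (0:ℝ)..r, K' ((x + s • e, t) - q) = K ((x + r • e, t) - q) - K ((x, t) - q) := by
        have := intervalIntegral.integral_eq_sub_of_hasDerivAt (a := 0) (b := r)
          (fun s _ => hd (x - q.1) (t - q.2) s) ((hc (x - q.1) (t - q.2)).intervalIntegrable _ _)
        convert this using 2 <;> try simp
        · funext s; congr 1; ext <;> simp; ring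
        · congr 1; ext <;> simp; ring
        · rfl
      rw [intervalIntegral.integral_mul_const, h1]; ring
    · simpa using (cv_int hK hG hM x t).comp_sub_left (x, t)
    · have h2 := (hFub.integral_prod_right).const_mul (if 0 ≤ r then 1 else -1)
      refine h2.congr (Eventually.of_forall fun q => ?_)
      simp only [intervalIntegral.intervalIntegral_eq_integral_uIoc]
      rfl
  have : (fun r : ℝ => cv K G (x + r • e) t) = fun r =>
      cv K G x t + ∫ s in (0:ℝ)..r, cv K' G (x + s • e) t := funext key
  rw [this]
  exact (intervalIntegral.integral_hasDerivAt_right (hcc.intervalIntegrable _ _)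
    (hcc.stronglyMeasurableAtFilter _ _) hcc.continuousAt).const_add _

/-- kernel truncated in time -/
noncomputable def tr (a b : ℝ) (g : (Fin d → ℝ) → ℝ → ℝ) (q : (Fin d → ℝ) × ℝ) : ℝ :=
  if q.2 ∈ Ioo a b then g q.1 q.2 else 0

lemma tr_meas (a b : ℝ) {g : (Fin d → ℝ) → ℝ → ℝ}
    (hg : Measurable fun q : (Fin d → ℝ) × ℝ => g q.1 q.2) : Measurable (tr a b g) :=
  Measurable.ite (measurable_snd measurableSet_Ioo) hg measurable_const

lemma k0_tr (T : ℝ) : k0 (d := d) T = tr 0 T (gw (1 / 4)) := rfl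

lemma tr_gi_le (i : Fin d) {a T : ℝ} (ha : 0 ≤ a) (q : (Fin d → ℝ) × ℝ) :
    ‖tr a T (gi i) q‖ ≤ 9 * gP (1 / 2) (1 / 8) T q := by
  unfold tr
  split_ifs with h
  · have h' : q.2 ∈ Ioo 0 T := ⟨ha.trans_lt h.1, h.2⟩
    unfold gP
    rw [if_pos h']
    exact gi_bound i q.1 h'.1
  · simpa using gP_nonneg _ _ _ q

lemma tr_gi_int (i : Fin d) {a T : ℝ} (ha : 0 ≤ a) : Integrable (tr a T (gi i)) :=
  ((gP_integrable (s := 1 / 2) (κ := 1 / 8) (T := T) (by norm_num) (by norm_num)).const_mul 9).mono'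
    (tr_meas a T (gi_meas i)).aestronglyMeasurable
    (Eventually.of_forall fun q => tr_gi_le i ha q)

lemma tr_gij_int (i j : Fin d) {a T : ℝ} (ha : 0 < a) : Integrable (tr a T (gij i j)) := by
  refine ((gP_integrable (s := 0) (κ := 1 / 8) (T := T) (by norm_num) (by norm_num)).const_mul
    (9 * a⁻¹)).mono' (tr_meas a T (gij_meas i j)).aestronglyMeasurable
    (Eventually.of_forall fun q => ?_)
  unfold tr
  split_ifs with h
  · have h' : q.2 ∈ Ioo 0 T := ⟨ha.trans h.1, h.2⟩
    unfold gP
    rw [if_pos h']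
    refine (gij_bound i j q.1 h'.1).trans ?_
    have h1 : q.2⁻¹ ≤ a⁻¹ := by
      have := h.1
      gcongr
    have := gw_pos (1 / 8) q.1 q.2
    simp only [neg_zero, Real.rpow_zero]
    nlinarith
  · have := gP_nonneg 0 (1 / 8) T q
    simp only [norm_zero]
    positivity

lemma tr_line (a b : ℝ) {g : (Fin d → ℝ) → ℝ → ℝ} {g' : Fin d → (Fin d → ℝ) → ℝ → ℝ}
    (hg : ∀ τ, ContDiff ℝ 1 (fun y => g y τ))
    (hg' : ∀ j y τ, fderiv ℝ (fun y => g y τ) y (Pi.single j 1) = g' j y τ) (e y : Fin d → ℝ) (τ r : ℝ) :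
    HasDerivAt (fun r : ℝ => tr a b g (y + r • e, τ)) (∑ j, e j * tr a b (g' j) (y + r • e, τ)) r := by
  by_cases h : τ ∈ Ioo a b
  · simp only [tr, if_pos h]
    have := hasDerivAt_line (((hg τ).differentiable (by simp)) (y + r • e))
    refine this.congr_deriv ?_
    rw [clm_eq_sum]
    simp [hg']
  · simp only [tr, if_neg h]
    simpa using hasDerivAt_const r (0 : ℝ)

lemma cv_sum {K : Fin d → (Fin d → ℝ) × ℝ → ℝ} (hK : ∀ j, Integrable (K j)) (c : Fin d → ℝ)
    {G : (Fin d → ℝ) → ℝ → ℝ}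
    (hG : Measurable (fun q : (Fin d → ℝ) × ℝ => G q.1 q.2)) {M : ℝ} (hM : ∀ x t, |G x t| ≤ M)
    (x : Fin d → ℝ) (t : ℝ) :
    cv (fun q => ∑ j, c j * K j q) G x t = ∑ j, c j * cv (K j) G x t := by
  unfold cv
  simp only [Finset.sum_mul, mul_assoc]
  rw [integral_finsetSum _ fun j _ => (cv_int (hK j) hG hM x t).const_mul _]
  simp [integral_const_mul]

lemma cv_tr_line (a b : ℝ) {g : (Fin d → ℝ) → ℝ → ℝ} {g' : Fin d → (Fin d → ℝ) → ℝ → ℝ}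
    (hg : ∀ τ, ContDiff ℝ 1 (fun y => g y τ))
    (hg' : ∀ j y τ, fderiv ℝ (fun y => g y τ) y (Pi.single j 1) = g' j y τ)
    (hm : ∀ j, Measurable fun q : (Fin d → ℝ) × ℝ => g' j q.1 q.2)
    (hi : Integrable (tr a b g)) (hi' : ∀ j, Integrable (tr a b (g' j)))
    {G : (Fin d → ℝ) → ℝ → ℝ}
    (hG : Measurable (fun q : (Fin d → ℝ) × ℝ => G q.1 q.2)) {M : ℝ} (hM : ∀ x t, |G x t| ≤ M)
    (e x : Fin d → ℝ) (t r : ℝ) :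
    HasDerivAt (fun r : ℝ => cv (tr a b g) G (x + r • e) t)
      (∑ j, e j * cv (tr a b (g' j)) G (x + r • e) t) r := by
  have := cv_line (K := tr a b g) (K' := fun q => ∑ j, e j * tr a b (g' j) q) hi
    (integrable_finsetSum _ fun j _ => (hi' j).const_mul _)
    (Finset.measurable_sum _ fun j _ => (tr_meas a b (hm j)).const_mul _) e
    (fun y τ r => tr_line a b hg hg' e y τ r) ?_ hG hM x t r
  · rwa [cv_sum hi' e hG hM] at this
  · intro y τ
    refine continuous_finsetSum _ fun j _ => continuous_const.mul ?_
    by_cases h : τ ∈ Ioo a b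
    · simp only [tr, if_pos h, ← hg']
      have h1 := ((hg τ).continuous_fderiv (by simp)).clm_apply (continuous_const (y := Pi.single j (1:ℝ)))
      exact h1.comp (by fun_prop : Continuous fun r : ℝ => y + r • e)
    · simp only [tr, if_neg h]
      exact continuous_const

lemma Tst.dX_eq {v : (Fin d → ℝ) → ℝ → ℝ} (hv : Tst v) {M : ℝ}
    (hM : ∀ x t, |heat v x t| ≤ M) (i : Fin d) (x : Fin d → ℝ) {t T : ℝ} (hT : 0 < T)
    (h0 : ∀ y, v y (t - T) = 0) :
    cv (tr 0 T (gi i)) (heat v) x t = (∫ y : Fin d → ℝ, gw (1 / 4) y 1) * dX i v x t := by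
  have h1 := cv_tr_line 0 T (g := gw (1 / 4)) (g' := gi) (fun τ => gw_contDiff _ τ)
    (fun j y τ => gw_fderiv j y τ) gi_meas (by rw [← k0_tr]; exact k0_int T)
    (fun j => tr_gi_int j le_rfl) hv.heat_meas hM (Pi.single i 1) x t 0
  rw [← k0_tr] at h1
  simp only [hv.duhamel hM _ hT h0] at h1
  have h2 := (hasDerivAt_line (((hv.x2 t).differentiable (by simp)) (x + (0:ℝ) • Pi.single i (1:ℝ)))).const_mul
    (∫ y : Fin d → ℝ, gw (1 / 4) y 1)
  have h3 := h1.unique h2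
  simp only [zero_smul, add_zero] at h3
  simp only [dX]
  rw [← h3]
  simp [Pi.single_apply]

lemma hasFDeriv_of_lines {g : (Fin d → ℝ) → ℝ} {D : Fin d → (Fin d → ℝ) → ℝ} {x : Fin d → ℝ}
    (hl : ∀ (e : Fin d → ℝ) (r : ℝ), HasDerivAt (fun r : ℝ => g (x + r • e)) (∑ j, e j * D j (x + r • e)) r)
    (hc : ∀ j, ContinuousAt (D j) x) :
    HasFDerivAt g (∑ j, (D j x) • (ContinuousLinearMap.proj (R := ℝ) (φ := fun _ : Fin d => ℝ) j)) x := by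
  rw [hasFDerivAt_iff_isLittleO_nhds_zero, Asymptotics.isLittleO_iff]
  intro c hcp
  have hev : ∀ᶠ h in 𝓝 (0 : Fin d → ℝ), ∀ j, |D j (x + h) - D j x| ≤ c / (d + 1) := by
    rw [eventually_all]
    intro j
    have h1 : Tendsto (fun h => D j (x + h)) (𝓝 0) (𝓝 (D j x)) := by
      have : ContinuousAt (fun h => D j (x + h)) 0 := by
        refine ContinuousAt.comp (g := D j) (f := fun h => x + h) ?_ (by fun_prop)
        simpa using hc j
      simpa [ContinuousAt] using this
    have := (Metric.tendsto_nhds.1 h1) (c / (d + 1)) (by positivity)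
    filter_upwards [this] with h hh using hh.le
  obtain ⟨ρ, hρ, hb⟩ := Metric.eventually_nhds_iff_ball.1 hev
  filter_upwards [Metric.ball_mem_nhds (0 : Fin d → ℝ) hρ] with h hh
  have hmv := Convex.norm_image_sub_le_of_norm_hasDerivWithin_le (𝕜 := ℝ) (s := Icc (0:ℝ) 1)
    (f := fun r : ℝ => g (x + r • h) - r * ∑ j, h j * D j x)
    (f' := fun r => (∑ j, h j * D j (x + r • h)) - 1 * ∑ j, h j * D j x) (x := 0) (y := 1) (C := c * ‖h‖)
    (fun r _ => ((hl h r).sub ((hasDerivAt_id r).mul_const _)).hasDerivWithinAt) ?_ (convex_Icc _ _)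
    (by simp) (by simp)
  · simp only [one_smul, one_mul, zero_smul, add_zero, zero_mul, sub_zero, norm_one, mul_one] at hmv
    convert hmv using 2
    simp [mul_comm]
    ring
  · intro r hr
    rw [one_mul, ← Finset.sum_sub_distrib]
    refine (norm_sum_le _ _).trans ?_
    have hrh : r • h ∈ Metric.ball (0 : Fin d → ℝ) ρ := by
      rw [mem_ball_zero_iff] at hh ⊢
      rw [norm_smul, Real.norm_eq_abs, abs_of_nonneg hr.1]
      nlinarith [norm_nonneg h, hr.2]
    calc ∑ j, ‖h j * D j (x + r • h) - h j * D j x‖ ≤ ∑ _j : Fin d, ‖h‖ * (c / (d + 1)) := by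
          refine Finset.sum_le_sum fun j _ => ?_
          rw [← mul_sub, norm_mul]
          exact mul_le_mul (norm_le_pi_norm h j) (hb _ hrh j) (norm_nonneg _) (norm_nonneg _)
      _ = ‖h‖ * c * (d / (d + 1)) := by simp; ring
      _ ≤ ‖h‖ * c * 1 := by
        gcongr
        rw [div_le_one (by positivity)]; linarith
      _ = c * ‖h‖ := by ring

end Conv


open Set MeasureTheory Filter Topology

section Conv2

variable {d : ℕ}

lemma gi_holder (i : Fin d) (y h : Fin d → ℝ) {a : ℝ} (ha : 0 < a) :
    |gi i (y + h) a - gi i y a| ≤ (9 + 9 * d * Real.exp (d / 8)) * Real.sqrt ‖h‖ *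
      (a ^ (-(3 / 4) : ℝ) * gw (1 / 16) (y + h) a + a ^ (-(3 / 4) : ℝ) * gw (1 / 16) y a) := by
  have hmono : ∀ z : Fin d → ℝ, gw (1 / 8) z a ≤ gw (1 / 16) z a := by
    intro z
    unfold gw
    have : 0 ≤ nsq z / a := div_nonneg (nsq_nonneg z) ha.le
    rw [Real.exp_le_exp, mul_div_assoc, mul_div_assoc]
    linarith
  have hp : 0 < a ^ (-(3 / 4) : ℝ) := Real.rpow_pos_of_pos ha _
  have hq : 0 < a ^ (1 / 4 : ℝ) := Real.rpow_pos_of_pos ha _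
  have g1 := gw_pos (1 / 16) y a
  have g2 := gw_pos (1 / 16) (y + h) a
  have hn := norm_nonneg h
  have hE : 0 ≤ 9 * (d : ℝ) * Real.exp (d / 8) := by positivity
  have hsh := Real.sqrt_nonneg ‖h‖
  have e4 : a ^ (1 / 4 : ℝ) = Real.sqrt (Real.sqrt a) := by
    rw [Real.sqrt_eq_rpow, Real.sqrt_eq_rpow, ← Real.rpow_mul ha.le]; norm_num
  rcases le_total a (‖h‖ ^ 2) with hc | hc
  · have h1 : a ^ (1 / 4 : ℝ) ≤ Real.sqrt ‖h‖ := by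
      rw [e4]
      refine Real.sqrt_le_sqrt ?_
      rw [← Real.sqrt_sq hn]
      exact Real.sqrt_le_sqrt hc
    have h2 : a ^ (-(1 / 2) : ℝ) = a ^ (-(3 / 4) : ℝ) * a ^ (1 / 4 : ℝ) := by
      rw [← Real.rpow_add ha]; norm_num
    have h3 : ∀ z : Fin d → ℝ, |gi i z a| ≤ 9 * Real.sqrt ‖h‖ * (a ^ (-(3 / 4) : ℝ) * gw (1 / 16) z a) := by
      intro z
      refine (gi_bound i z ha).trans ?_
      rw [h2]
      have := gw_pos (1 / 8) z a
      have := gw_pos (1 / 16) z a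
      calc 9 * (a ^ (-(3 / 4) : ℝ) * a ^ (1 / 4 : ℝ) * gw (1 / 8) z a)
          ≤ 9 * (a ^ (-(3 / 4) : ℝ) * Real.sqrt ‖h‖ * gw (1 / 16) z a) := by
            gcongr; exact hmono z
        _ = _ := by ring
    refine (abs_sub _ _).trans ?_
    have k1 := h3 (y + h)
    have k2 := h3 y
    have k3 : 0 ≤ 9 * (d : ℝ) * Real.exp (d / 8) * Real.sqrt ‖h‖ *
      (a ^ (-(3 / 4) : ℝ) * gw (1 / 16) (y + h) a + a ^ (-(3 / 4) : ℝ) * gw (1 / 16) y a) := by positivity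
    linarith
  · have hb : ∀ r ∈ Icc (0:ℝ) 1, ‖fderiv ℝ (fun y => gi i y a) (y + r • h) h‖ ≤
        9 * d * Real.exp (d / 8) * (‖h‖ * a⁻¹) * gw (1 / 16) y a := by
      intro r hr
      rw [clm_eq_sum]
      simp only [gi_fderiv]
      refine (norm_sum_le _ _).trans ?_
      have hk : gw (1 / 8) (y + r • h) a ≤ Real.exp (d / 8) * gw (1 / 16) y a := by
        unfold gw
        rw [← Real.exp_add, Real.exp_le_exp]
        have h1 := nsq_add_ge y (r • h)
        have h2 : nsq (r • h) ≤ d * a := by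
          refine (nsq_le _).trans ?_
          have : ‖r • h‖ ^ 2 ≤ a := by
            rw [norm_smul, mul_pow, Real.norm_eq_abs, sq_abs]
            have : r ^ 2 ≤ 1 := by nlinarith [hr.1, hr.2]
            nlinarith [sq_nonneg ‖h‖]
          gcongr
        have h3 : nsq y / 2 / a - d ≤ nsq (y + r • h) / a := by
          rw [div_sub' ha.ne', div_le_div_iff_of_pos_right ha]; linarith
        have : 1 / 8 * nsq (y + r • h) / a = 1 / 8 * (nsq (y + r • h) / a) := by ring
        have : 1 / 16 * nsq y / a = 1 / 8 * (nsq y / 2 / a) := by ring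
        linarith
      calc ∑ j, ‖h j • gij i j (y + r • h) a‖
          ≤ ∑ _j : Fin d, ‖h‖ * (9 * (a⁻¹ * (Real.exp (d / 8) * gw (1 / 16) y a))) := by
            refine Finset.sum_le_sum fun j _ => ?_
            rw [norm_smul]
            refine mul_le_mul (norm_le_pi_norm h j) ?_ (norm_nonneg _) hn
            refine (gij_bound i j _ ha).trans ?_
            gcongr
        _ = _ := by simp; ring
    have hmv := Convex.norm_image_sub_le_of_norm_hasDerivWithin_le (𝕜 := ℝ) (s := Icc (0:ℝ) 1)
      (f := fun r : ℝ => gi i (y + r • h) a) (x := 0) (y := 1)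
      (fun r _ => (hasDerivAt_line (((gi_contDiff i a (n := 1)).differentiable (by simp))
        (y + r • h))).hasDerivWithinAt) hb (convex_Icc _ _) (by simp) (by simp)
    simp only [one_smul, zero_smul, add_zero, sub_zero, norm_one, mul_one] at hmv
    rw [Real.norm_eq_abs] at hmv
    refine hmv.trans ?_
    have h1 : Real.sqrt ‖h‖ ≤ a ^ (1 / 4 : ℝ) := by
      rw [e4]
      refine Real.sqrt_le_sqrt ?_
      exact Real.le_sqrt_of_sq_le hc
    have h2 : a ^ (-(3 / 4) : ℝ) = a ^ (1 / 4 : ℝ) * a⁻¹ := by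
      rw [← Real.rpow_neg_one, ← Real.rpow_add ha]; norm_num
    have h3 : ‖h‖ * a⁻¹ ≤ Real.sqrt ‖h‖ * a ^ (-(3 / 4) : ℝ) := by
      rw [h2, ← mul_assoc]
      have : ‖h‖ = Real.sqrt ‖h‖ * Real.sqrt ‖h‖ := (Real.mul_self_sqrt hn).symm
      have h4 : ‖h‖ ≤ Real.sqrt ‖h‖ * a ^ (1 / 4 : ℝ) := by
        conv_lhs => rw [this]
        gcongr
      gcongr
    have k1 : 9 * d * Real.exp (d / 8) * (‖h‖ * a⁻¹) * gw (1 / 16) y a ≤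
       9 * d * Real.exp (d / 8) * (Real.sqrt ‖h‖ * a ^ (-(3 / 4) : ℝ)) * gw (1 / 16) y a := by gcongr
    have k2 : 0 ≤ 9 * Real.sqrt ‖h‖ *
      (a ^ (-(3 / 4) : ℝ) * gw (1 / 16) (y + h) a + a ^ (-(3 / 4) : ℝ) * gw (1 / 16) y a) := by positivity
    have k3 : 0 ≤ 9 * (d : ℝ) * Real.exp (d / 8) * Real.sqrt ‖h‖ *
      (a ^ (-(3 / 4) : ℝ) * gw (1 / 16) (y + h) a) := by positivity
    linarith

lemma cv_hol (i : Fin d) (T : ℝ) {G : (Fin d → ℝ) → ℝ → ℝ}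
    (hG : Measurable (fun q : (Fin d → ℝ) × ℝ => G q.1 q.2)) {M : ℝ} (hM : ∀ x t, |G x t| ≤ M) :
    ∃ L, ∀ x x' t, |cv (tr 0 T (gi i)) G x t - cv (tr 0 T (gi i)) G x' t| ≤ L * Real.sqrt ‖x - x'‖ := by
  have hM0 : 0 ≤ M := (abs_nonneg _).trans (hM 0 0)
  set C := (9 + 9 * d * Real.exp (d / 8)) with hC
  have hgP := gP_integrable (d := d) (s := 3 / 4) (κ := 1 / 16) (T := T) (by norm_num) (by norm_num)
  refine ⟨C * (2 * ∫ q : (Fin d → ℝ) × ℝ, gP (3 / 4) (1 / 16) T q) * M, fun x x' t => ?_⟩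
  have hi := tr_gi_int (T := T) i le_rfl
  have ii : ∀ z : Fin d → ℝ, Integrable fun q : (Fin d → ℝ) × ℝ =>
      tr 0 T (gi i) ((z, t) - q) * G q.1 q.2 := fun z => by
    simpa using (cv_int hi hG hM z t).comp_sub_left (z, t)
  rw [cv_eq, cv_eq, ← integral_sub (ii x) (ii x'), ← Real.norm_eq_abs]
  have hb : ∀ q : (Fin d → ℝ) × ℝ, ‖tr 0 T (gi i) ((x, t) - q) * G q.1 q.2 -
      tr 0 T (gi i) ((x', t) - q) * G q.1 q.2‖ ≤
      (C * Real.sqrt ‖x - x'‖ * M) * (gP (3 / 4) (1 / 16) T ((x, t) - q) + gP (3 / 4) (1 / 16) T ((x', t) - q)) := by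
    intro q
    rw [← sub_mul, norm_mul]
    have h1 : ‖tr 0 T (gi i) ((x, t) - q) - tr 0 T (gi i) ((x', t) - q)‖ ≤ C * Real.sqrt ‖x - x'‖ *
        (gP (3 / 4) (1 / 16) T ((x, t) - q) + gP (3 / 4) (1 / 16) T ((x', t) - q)) := by
      unfold tr gP
      simp only [Prod.snd_sub, Prod.fst_sub]
      split_ifs with h
      · have := gi_holder i (x' - q.1) (x - x') h.1
        have e : x' - q.1 + (x - x') = x - q.1 := by abel
        rw [e] at this
        exact this
      · simp
    calc _ ≤ (C * Real.sqrt ‖x - x'‖ *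
        (gP (3 / 4) (1 / 16) T ((x, t) - q) + gP (3 / 4) (1 / 16) T ((x', t) - q))) * M := by
          refine mul_le_mul h1 (hM _ _) (norm_nonneg _) ?_
          exact (norm_nonneg _).trans h1
      _ = _ := by ring
  have ig : ∀ z : Fin d → ℝ, Integrable fun q : (Fin d → ℝ) × ℝ => gP (3 / 4) (1 / 16) T ((z, t) - q) :=
    fun z => hgP.comp_sub_left (z, t)
  refine (norm_integral_le_of_norm_le (((ig x).add (ig x')).const_mul _) (Eventually.of_forall hb)).trans ?_
  have e1 : ∀ z : Fin d → ℝ, ∫ q : (Fin d → ℝ) × ℝ, gP (3 / 4) (1 / 16) T ((z, t) - q) =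
      ∫ q : (Fin d → ℝ) × ℝ, gP (3 / 4) (1 / 16) T q := fun z =>
    integral_sub_left_eq_self (fun q => gP (3 / 4) (1 / 16) T q) volume (z, t)
  rw [integral_const_mul]
  have e2 := integral_add (ig x) (ig x')
  simp only [Pi.add_apply]
  rw [e2, e1, e1]
  exact le_of_eq (by ring)

lemma dX_supp {G : (Fin d → ℝ) → ℝ → ℝ} (hs : HasCompactSupport (fun q : (Fin d → ℝ) × ℝ => G q.1 q.2))
    (j : Fin d) : HasCompactSupport (fun q : (Fin d → ℝ) × ℝ => dX j G q.1 q.2) := by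
  refine HasCompactSupport.intro hs.isCompact fun q hq => ?_
  have := dX_congr (O := (tsupport (fun q : (Fin d → ℝ) × ℝ => G q.1 q.2))ᶜ) (g := G)
    (g' := fun _ _ => (0:ℝ)) (isClosed_tsupport _).isOpen_compl
    (fun x t h => image_eq_zero_of_notMem_tsupport
      (f := fun q : (Fin d → ℝ) × ℝ => G q.1 q.2) (x := (x, t)) h) j q.1 q.2 hq
  rw [this]; simp [dX]

lemma cpt_bdd {G : (Fin d → ℝ) → ℝ → ℝ} (hc : Continuous (fun q : (Fin d → ℝ) × ℝ => G q.1 q.2))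
    (hs : HasCompactSupport (fun q : (Fin d → ℝ) × ℝ => G q.1 q.2)) :
    ∃ M, ∀ x t, |G x t| ≤ M := by
  obtain ⟨M, hM⟩ := hs.exists_bound_of_continuous hc
  exact ⟨M, fun x t => hM (x, t)⟩

lemma cv_fderiv {K : (Fin d → ℝ) × ℝ → ℝ} (hK : Integrable K) {G : (Fin d → ℝ) → ℝ → ℝ} {h : Prop}
    (hG : CX h univ 1 G) (hs : HasCompactSupport (fun q : (Fin d → ℝ) × ℝ => G q.1 q.2))
    (x : Fin d → ℝ) (t : ℝ) :
    DifferentiableAt ℝ (fun y => cv K G y t) x ∧ ∀ j, dX j (cv K G) x t = cv K (dX j G) x t := by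
  have hGc : Continuous (fun q : (Fin d → ℝ) × ℝ => G q.1 q.2) := continuousOn_univ.1 hG.cont
  obtain ⟨M, hM⟩ := cpt_bdd hGc hs
  have hGdc : ∀ j, Continuous (fun q : (Fin d → ℝ) × ℝ => dX j G q.1 q.2) :=
    fun j => continuousOn_univ.1 (hG.2.2 j).cont
  choose M' hM' using fun j => cpt_bdd (hGdc j) (dX_supp hs j)
  have hlin : ∀ (z e : Fin d → ℝ) (r : ℝ), HasDerivAt (fun r : ℝ => cv K G (z + r • e) t)
      (∑ j, e j * cv K (dX j G) (z + r • e) t) r := by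
    intro z e r
    have hd : ∀ (q : (Fin d → ℝ) × ℝ) (r : ℝ), HasDerivAt (fun r : ℝ => K q * G (z + r • e - q.1) (t - q.2))
      (∑ j, e j * (K q * dX j G (z + r • e - q.1) (t - q.2))) r := by
      intro q r
      have h1 := (hasDerivAt_line (ψ := fun y => G y (t - q.2)) (x := z - q.1) (e := e) (r := r)
        (hG.2.1 (_, t - q.2) (mem_univ _))).const_mul (K q)
      have e1 : ∀ r : ℝ, z - q.1 + r • e = z + r • e - q.1 := fun r => by abel
      simp only [e1] at h1
      refine h1.congr_deriv ?_
      rw [clm_eq_sum, Finset.mul_sum]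
      refine Finset.sum_congr rfl fun j _ => ?_
      simp only [dX, smul_eq_mul]; ring
    have := (hasDerivAt_integral_of_dominated_loc_of_deriv_le (μ := volume) (s := univ)
      (F := fun r q => K q * G (z + r • e - q.1) (t - q.2))
      (F' := fun r q => ∑ j, e j * (K q * dX j G (z + r • e - q.1) (t - q.2)))
      (x₀ := r) (bound := fun q => ∑ j, |e j| * (‖K q‖ * M' j)) univ_mem
      (Eventually.of_forall fun r => (cv_int hK hGc.measurable hM _ t).aestronglyMeasurable)
      (cv_int hK hGc.measurable hM _ t)
      (integrable_finsetSum _ fun j _ =>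
        ((cv_int hK (hGdc j).measurable (hM' j) _ t).const_mul _)).aestronglyMeasurable
      (Eventually.of_forall fun q r _ => ?_)
      (integrable_finsetSum _ fun j _ => (hK.norm.mul_const _).const_mul _)
      (Eventually.of_forall fun q r _ => hd q r)).2
    · refine this.congr_deriv ?_
      rw [integral_finsetSum _ fun j _ =>
        ((cv_int hK (hGdc j).measurable (hM' j) _ t).const_mul _)]
      simp only [integral_const_mul, cv]
    · refine (norm_sum_le _ _).trans (Finset.sum_le_sum fun j _ => ?_)
      rw [norm_mul, norm_mul, Real.norm_eq_abs (e j)]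
      gcongr
      exact hM' j _ _
  have hF := hasFDeriv_of_lines (g := fun y => cv K G y t) (D := fun j y => cv K (dX j G) y t) (x := x)
    (hlin x) (fun j => ((cv_cont hK (hGdc j).measurable (hM' j)).comp
      (by fun_prop : Continuous fun y : Fin d → ℝ => (y, t))).continuousAt)
  refine ⟨hF.differentiableAt, fun j => ?_⟩
  simp only [dX]
  rw [hF.fderiv]
  simp [Pi.single_apply]

end Conv2


open Set MeasureTheory Filter Topology

section Conv3

variable {d : ℕ}

lemma global_hol {G : (Fin d → ℝ) → ℝ → ℝ} (hG : CX True univ 0 G)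
    (hs : HasCompactSupport (fun q : (Fin d → ℝ) × ℝ => G q.1 q.2)) :
    ∃ L, 0 ≤ L ∧ ∀ x y t, |G x t - G y t| ≤ L * Real.sqrt ‖x - y‖ := by
  have hGc : Continuous (fun q : (Fin d → ℝ) × ℝ => G q.1 q.2) := continuousOn_univ.1 hG.cont
  obtain ⟨M, hM⟩ := cpt_bdd hGc hs
  have hM0 : 0 ≤ M := (abs_nonneg _).trans (hM 0 0)
  have key : ∃ L ≥ (0:ℝ), ∃ δ > (0:ℝ), ∀ q ∈ tsupport (fun q : (Fin d → ℝ) × ℝ => G q.1 q.2), ∀ y,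
      ‖q.1 - y‖ < δ → |G q.1 q.2 - G y q.2| ≤ L * Real.sqrt ‖q.1 - y‖ := by
    refine hs.isCompact.induction_on (p := fun S => ∃ L ≥ (0:ℝ), ∃ δ > (0:ℝ), ∀ q ∈ S, ∀ y,
      ‖q.1 - y‖ < δ → |G q.1 q.2 - G y q.2| ≤ L * Real.sqrt ‖q.1 - y‖) ?_ ?_ ?_ ?_
    · exact ⟨0, le_rfl, 1, one_pos, by simp⟩
    · rintro S S' hSS ⟨L, hL, δ, hδ, H⟩
      exact ⟨L, hL, δ, hδ, fun q hq => H q (hSS hq)⟩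
    · rintro S S' ⟨L, hL, δ, hδ, H⟩ ⟨L', hL', δ', hδ', H'⟩
      refine ⟨max L L', le_max_of_le_left hL, min δ δ', lt_min hδ hδ', ?_⟩
      rintro q (hq | hq) y hy
      · exact (H q hq y (hy.trans_le (min_le_left _ _))).trans (by gcongr; exact le_max_left _ _)
      · exact (H' q hq y (hy.trans_le (min_le_right _ _))).trans (by gcongr; exact le_max_right _ _)
    · intro q _
      obtain ⟨U, hU, L, hL⟩ := hG.2 trivial q (mem_univ _)
      obtain ⟨δ, hδ, hb⟩ := Metric.mem_nhds_iff.1 hU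
      refine ⟨Metric.ball q (δ / 2), mem_nhdsWithin_of_mem_nhds (Metric.ball_mem_nhds _ (by positivity)),
        |L|, abs_nonneg _, δ / 2, by positivity, fun q' hq' y hy => ?_⟩
      have h1 : (q'.1, q'.2) ∈ U := hb (Metric.ball_subset_ball (by linarith) hq')
      have h2 : (y, q'.2) ∈ U := by
        apply hb
        have : dist (y, q'.2) q' < δ / 2 := by
          rw [Prod.dist_eq]; simp [dist_eq_norm, norm_sub_rev y, hy]
        have h3 := Metric.mem_ball.1 hq'
        rw [Metric.mem_ball]
        linarith [dist_triangle (y, q'.2) q' q]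
      refine (hL _ _ _ h1 h2).trans ?_
      gcongr
      exact le_abs_self L
  obtain ⟨L, hL, δ, hδ, H⟩ := key
  have hz : ∀ x t, (x, t) ∉ tsupport (fun q : (Fin d → ℝ) × ℝ => G q.1 q.2) → G x t = 0 := fun x t h =>
    image_eq_zero_of_notMem_tsupport (f := fun q : (Fin d → ℝ) × ℝ => G q.1 q.2) (x := (x, t)) h
  have hsδ := Real.sqrt_pos.2 hδ
  refine ⟨L + 2 * M / Real.sqrt δ, by positivity, fun x y t => ?_⟩
  have hsq := Real.sqrt_nonneg ‖x - y‖
  have e0 : 0 ≤ 2 * M / Real.sqrt δ * Real.sqrt ‖x - y‖ := by positivity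
  rcases lt_or_ge ‖x - y‖ δ with hlt | hge
  · have : |G x t - G y t| ≤ L * Real.sqrt ‖x - y‖ := by
      by_cases hx : (x, t) ∈ tsupport (fun q : (Fin d → ℝ) × ℝ => G q.1 q.2)
      · exact H _ hx y hlt
      · by_cases hy : (y, t) ∈ tsupport (fun q : (Fin d → ℝ) × ℝ => G q.1 q.2)
        · rw [abs_sub_comm, norm_sub_rev]
          rw [norm_sub_rev] at hlt
          exact H _ hy x hlt
        · rw [hz _ _ hx, hz _ _ hy]; simp; positivity
    linarith
  · have h1 : 1 ≤ Real.sqrt ‖x - y‖ / Real.sqrt δ := by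
      rw [one_le_div hsδ]; exact Real.sqrt_le_sqrt hge
    have h2 : |G x t - G y t| ≤ 2 * M := (abs_sub _ _).trans (by linarith [hM x t, hM y t])
    have h3 : 2 * M / Real.sqrt δ * Real.sqrt ‖x - y‖ = 2 * M * (Real.sqrt ‖x - y‖ / Real.sqrt δ) := by ring
    have h4 : 0 ≤ L * Real.sqrt ‖x - y‖ := by positivity
    nlinarith

/-- tail kernels -/
noncomputable def gE (s κ T : ℝ) (n : ℕ) (q : (Fin d → ℝ) × ℝ) : ℝ :=
  if q.2 ≤ 1 / ((n : ℝ) + 1) then gP s κ T q else 0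

lemma gE_int {s κ T : ℝ} (hs : s < 1) (hκ : 0 < κ) (n : ℕ) : Integrable (gE (d := d) s κ T n) := by
  refine (gP_integrable (T := T) hs hκ).mono' ?_ (Eventually.of_forall fun q => ?_)
  · refine (Measurable.ite (measurable_snd measurableSet_Iic) (gP_meas s κ T)
      measurable_const).aestronglyMeasurable
  · unfold gE
    have := gP_nonneg s κ T q
    split_ifs
    · rw [Real.norm_eq_abs, abs_of_nonneg this]
    · simpa

lemma gE_lim {s κ T : ℝ} (hs : s < 1) (hκ : 0 < κ) :
    Tendsto (fun n => ∫ q : (Fin d → ℝ) × ℝ, gE s κ T n q) atTop (𝓝 0) := by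
  have := tendsto_integral_of_dominated_convergence (μ := volume) (F := fun n => gE (d := d) s κ T n)
    (f := fun _ => 0) (fun q => gP s κ T q) (fun n => (gE_int hs hκ n).aestronglyMeasurable)
    (gP_integrable (T := T) hs hκ)
    (fun n => Eventually.of_forall fun q => ?_) (Eventually.of_forall fun q => ?_)
  · simpa using this
  · unfold gE
    have := gP_nonneg s κ T q
    split_ifs
    · rw [Real.norm_eq_abs, abs_of_nonneg this]
    · simpa
  · refine tendsto_const_nhds.congr' ?_
    rcases le_or_gt q.2 0 with h | h
    · refine Eventually.of_forall fun n => ?_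
      simp [gE, gP, not_lt.2 h]
    · have := (tendsto_one_div_add_atTop_nhds_zero_nat (𝕜 := ℝ)).eventually (gt_mem_nhds h)
      filter_upwards [this] with n hn
      simp [gE]
      intro h2
      simp at hn
      linarith

lemma gij_int {a : ℝ} (ha : 0 < a) (i j : Fin d) : Integrable (fun y : Fin d → ℝ => gij i j y a) := by
  refine ((gw_integrable (κ := 1 / 8) (by norm_num) ha).const_mul (9 * a⁻¹)).mono' ?_
    (Eventually.of_forall fun y => ?_)
  · exact ((gij_meas i j).comp (by fun_prop : Measurable fun y : Fin d → ℝ => (y, a))).aestronglyMeasurable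
  · exact (gij_bound i j y ha).trans (le_of_eq (by ring))

lemma gi_int {a : ℝ} (ha : 0 < a) (i : Fin d) : Integrable (fun y : Fin d → ℝ => gi i y a) := by
  refine ((gw_integrable (κ := 1 / 8) (by norm_num) ha).const_mul (9 * a ^ (-(1 / 2) : ℝ))).mono' ?_
    (Eventually.of_forall fun y => ?_)
  · exact ((gi_meas i).comp (by fun_prop : Measurable fun y : Fin d → ℝ => (y, a))).aestronglyMeasurable
  · exact (gi_bound i y ha).trans (le_of_eq (by ring))

lemma gij_mean {a : ℝ} (ha : 0 < a) (i j : Fin d) : ∫ y : Fin d → ℝ, gij i j y a = 0 := by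
  have := integral_mul_fderiv_eq_neg_fderiv_mul_of_integrable (μ := volume)
    (f := fun _ : Fin d → ℝ => (1:ℝ)) (g := fun y : Fin d → ℝ => gi i y a) (v := Pi.single j 1)
    (by simp) (by simpa [gi_fderiv] using gij_int ha i j) (by simpa using gi_int ha i)
    (fun _ _ => differentiableAt_const _)
    (fun y _ => (gi_contDiff i a (n := 1)).differentiable (by simp) y)
  simpa [gi_fderiv] using this

lemma cv_gij {a : ℝ} (ha : 0 < a) (T : ℝ) (i j : Fin d) {G : (Fin d → ℝ) → ℝ → ℝ}
    (hG : Measurable (fun q : (Fin d → ℝ) × ℝ => G q.1 q.2)) {M : ℝ} (hM : ∀ x t, |G x t| ≤ M)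
    (x : Fin d → ℝ) (t : ℝ) :
    Integrable (fun q : (Fin d → ℝ) × ℝ => tr a T (gij i j) q * (G (x - q.1) (t - q.2) - G x (t - q.2))) ∧
    cv (tr a T (gij i j)) G x t =
      ∫ q : (Fin d → ℝ) × ℝ, tr a T (gij i j) q * (G (x - q.1) (t - q.2) - G x (t - q.2)) := by
  have hi := tr_gij_int (T := T) i j ha
  have h1 := cv_int hi hG hM x t
  have h2 : Integrable (fun q : (Fin d → ℝ) × ℝ => tr a T (gij i j) q * G x (t - q.2)) := by
    refine Integrable.mul_bdd (c := M) hi ?_ ?_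
    · exact (hG.comp (by fun_prop : Measurable fun q : (Fin d → ℝ) × ℝ =>
        (x, t - q.2))).aestronglyMeasurable
    · exact Eventually.of_forall fun y => hM _ _
  simp only [mul_sub]
  refine ⟨h1.sub h2, ?_⟩
  rw [integral_sub h1 h2]
  have : ∫ q : (Fin d → ℝ) × ℝ, tr a T (gij i j) q * G x (t - q.2) = 0 := by
    rw [Measure.volume_eq_prod] at h2 ⊢
    rw [integral_prod_symm _ h2]
    refine integral_eq_zero_of_ae (Eventually.of_forall fun τ => ?_)
    simp only [tr, Pi.zero_apply]
    split_ifs with h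
    · rw [integral_mul_const, gij_mean (ha.trans h.1), zero_mul]
    · simp
  rw [this, sub_zero]; rfl

/-- the singular integral -/
noncomputable def sg (T : ℝ) (i j : Fin d) (G : (Fin d → ℝ) → ℝ → ℝ) (x : Fin d → ℝ) (t : ℝ) : ℝ :=
  ∫ q : (Fin d → ℝ) × ℝ, tr 0 T (gij i j) q * (G (x - q.1) (t - q.2) - G x (t - q.2))

lemma sg_approx (T : ℝ) (i j : Fin d) {G : (Fin d → ℝ) → ℝ → ℝ}
    (hG : Measurable (fun q : (Fin d → ℝ) × ℝ => G q.1 q.2)) {M : ℝ} (hM : ∀ x t, |G x t| ≤ M)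
    {L : ℝ} (hL : 0 ≤ L) (hH : ∀ x y t, |G x t - G y t| ≤ L * Real.sqrt ‖x - y‖) (n : ℕ)
    (x : Fin d → ℝ) (t : ℝ) :
    |cv (tr (1 / ((n : ℝ) + 1)) T (gij i j)) G x t - sg T i j G x t| ≤
      153 * L * ∫ q : (Fin d → ℝ) × ℝ, gE (3 / 4) (1 / 16) T n q := by
  have ha : (0:ℝ) < 1 / ((n : ℝ) + 1) := by positivity
  obtain ⟨h1, h2⟩ := cv_gij ha T i j hG hM x t
  have hb : ∀ q : (Fin d → ℝ) × ℝ, ∀ τ, 0 < τ →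
      |gij i j q.1 τ * (G (x - q.1) (t - τ) - G x (t - τ))| ≤
        153 * L * (τ ^ (-(3 / 4) : ℝ) * gw (1 / 16) q.1 τ) := by
    intro q τ hτ
    rw [abs_mul]
    have k1 := gij_bound' i j q.1 hτ
    have k2 := hH (x - q.1) x (t - τ)
    have e : ‖x - q.1 - x‖ = ‖q.1‖ := by simp
    rw [e] at k2
    calc _ ≤ |gij i j q.1 τ| * (L * Real.sqrt ‖q.1‖) := by gcongr
      _ = L * (|gij i j q.1 τ| * Real.sqrt ‖q.1‖) := by ring
      _ ≤ L * (153 * (τ ^ (-(3 / 4) : ℝ) * gw (1 / 16) q.1 τ)) := by gcongr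
      _ = _ := by ring
  have h3 : Integrable (fun q : (Fin d → ℝ) × ℝ =>
      tr 0 T (gij i j) q * (G (x - q.1) (t - q.2) - G x (t - q.2))) := by
    refine ((gP_integrable (s := 3 / 4) (κ := 1 / 16) (T := T) (by norm_num) (by norm_num)).const_mul
      (153 * L)).mono' ?_ (Eventually.of_forall fun q => ?_)
    · refine ((tr_meas 0 T (gij_meas i j)).mul ?_).aestronglyMeasurable
      exact (hG.comp (by fun_prop : Measurable fun q : (Fin d → ℝ) × ℝ => (x - q.1, t - q.2))).sub
        (hG.comp (by fun_prop : Measurable fun q : (Fin d → ℝ) × ℝ => (x, t - q.2)))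
    · unfold tr gP
      split_ifs with h
      · exact hb q q.2 h.1
      · simp
  rw [h2]
  unfold sg
  rw [← integral_sub h1 h3, ← Real.norm_eq_abs, ← integral_const_mul]
  refine norm_integral_le_of_norm_le ((gE_int (by norm_num) (by norm_num) n).const_mul _)
    (Eventually.of_forall fun q => ?_)
  unfold tr gE gP
  by_cases h : q.2 ∈ Ioo 0 T
  · by_cases h' : q.2 ≤ 1 / ((n : ℝ) + 1)
    · rw [if_neg (fun hh => absurd hh.1 (not_lt.2 h')), if_pos h, if_pos h', if_pos h]
      rw [zero_mul, zero_sub, norm_neg]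
      exact hb q q.2 h.1
    · rw [if_pos ⟨not_le.1 h', h.2⟩, if_pos h, if_neg h']
      simp
  · rw [if_neg (fun hh => h ⟨ha.trans hh.1, hh.2⟩), if_neg h, if_neg h]
    simp

lemma cv_sing (T : ℝ) (i : Fin d) {G : (Fin d → ℝ) → ℝ → ℝ} (hGx : CX True univ 0 G)
    (hs : HasCompactSupport (fun q : (Fin d → ℝ) × ℝ => G q.1 q.2)) :
    CX False univ 1 (cv (tr 0 T (gi i)) G) := by
  have hGc : Continuous (fun q : (Fin d → ℝ) × ℝ => G q.1 q.2) := continuousOn_univ.1 hGx.cont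
  obtain ⟨M, hM⟩ := cpt_bdd hGc hs
  obtain ⟨L, hL, hH⟩ := global_hol hGx hs
  have hG := hGc.measurable
  have hlim := ((gE_lim (d := d) (s := 3 / 4) (κ := 1 / 16) (T := T) (by norm_num) (by norm_num)).const_mul (153 * L))
  rw [mul_zero] at hlim
  have hSc : ∀ j, Continuous (fun q : (Fin d → ℝ) × ℝ => sg T i j G q.1 q.2) := by
    intro j
    have hu : TendstoUniformly (fun (n : ℕ) (q : (Fin d → ℝ) × ℝ) =>
        cv (tr (1 / ((n : ℝ) + 1)) T (gij i j)) G q.1 q.2) (fun q => sg T i j G q.1 q.2) atTop := by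
      rw [Metric.tendstoUniformly_iff]
      intro ε hε
      filter_upwards [hlim.eventually (gt_mem_nhds hε)] with n hn q
      rw [dist_comm, Real.dist_eq]
      exact (sg_approx T i j hG hM hL hH n q.1 q.2).trans_lt hn
    exact hu.continuous (Frequently.of_forall fun n =>
      cv_cont (tr_gij_int i j (by positivity)) hG hM)
  have hlin : ∀ (t : ℝ) (z e : Fin d → ℝ) (r : ℝ), HasDerivAt (fun r : ℝ => cv (tr 0 T (gi i)) G (z + r • e) t)
      (∑ j, e j * sg T i j G (z + r • e) t) r := by
    intro t z e
    refine hasDerivAt_of_tendstoUniformly (l := atTop)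
      (f := fun (n : ℕ) (r : ℝ) => cv (tr (1 / ((n : ℝ) + 1)) T (gi i)) G (z + r • e) t)
      (f' := fun (n : ℕ) (r : ℝ) => ∑ j, e j * cv (tr (1 / ((n : ℝ) + 1)) T (gij i j)) G (z + r • e) t)
      ?_ ?_ ?_
    · rw [Metric.tendstoUniformly_iff]
      intro ε hε
      have h2 := hlim.const_mul (∑ j, |e j|)
      rw [mul_zero] at h2
      filter_upwards [h2.eventually (gt_mem_nhds hε)] with n hn r
      rw [dist_comm, Real.dist_eq, ← Finset.sum_sub_distrib]
      refine lt_of_le_of_lt ?_ hn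
      refine (Finset.abs_sum_le_sum_abs _ _).trans ?_
      rw [Finset.sum_mul]
      refine Finset.sum_le_sum fun j _ => ?_
      rw [← mul_sub, abs_mul]
      gcongr
      exact sg_approx T i j hG hM hL hH n _ _
    · refine Eventually.of_forall fun n r => ?_
      have ha : (0:ℝ) < 1 / ((n : ℝ) + 1) := by positivity
      exact cv_tr_line _ T (fun τ => gi_contDiff i τ) (fun j y τ => gi_fderiv i j y τ)
        (fun j => gij_meas i j) (tr_gi_int i ha.le) (fun j => tr_gij_int i j ha) hG hM e z t r
    · intro r
      have h9 := ((gE_lim (d := d) (s := 1 / 2) (κ := 1 / 8) (T := T) (by norm_num)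
        (by norm_num)).const_mul 9).mul_const M
      rw [mul_zero, zero_mul] at h9
      rw [tendsto_iff_dist_tendsto_zero]
      refine squeeze_zero (fun _ => dist_nonneg) (fun n => ?_) h9
      have ha : (0:ℝ) < 1 / ((n : ℝ) + 1) := by positivity
      rw [Real.dist_eq]
      refine (cv_sub_le (tr_gi_int i ha.le) (tr_gi_int i le_rfl) hG hM _ _).trans ?_
      refine mul_le_mul_of_nonneg_right ?_ ((abs_nonneg _).trans (hM 0 0))
      rw [← integral_const_mul]
      refine integral_mono ((tr_gi_int i ha.le).sub (tr_gi_int i le_rfl)).norm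
        ((gE_int (by norm_num) (by norm_num) n).const_mul _) fun q => ?_
      simp only
      by_cases h' : q.2 ≤ 1 / ((n : ℝ) + 1)
      · have e1 : tr (1 / ((n : ℝ) + 1)) T (gi i) q = 0 := if_neg (fun hh => absurd hh.1 (not_lt.2 h'))
        rw [e1, zero_sub, norm_neg]
        unfold gE
        rw [if_pos h']
        exact tr_gi_le i le_rfl q
      · have e1 : tr (1 / ((n : ℝ) + 1)) T (gi i) q = tr 0 T (gi i) q := by
          unfold tr
          have : q.2 ∈ Ioo (1 / ((n : ℝ) + 1)) T ↔ q.2 ∈ Ioo 0 T :=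
            ⟨fun hh => ⟨ha.trans hh.1, hh.2⟩, fun hh => ⟨not_le.1 h', hh.2⟩⟩
          simp only [this]
        unfold gE
        rw [e1, if_neg h']
        simp
  have hF : ∀ (x : Fin d → ℝ) (t : ℝ), HasFDerivAt (fun y => cv (tr 0 T (gi i)) G y t) _ x := fun x t =>
    hasFDeriv_of_lines (D := fun j y => sg T i j G y t) (hlin t x)
    (fun j => ((hSc j).comp (by fun_prop : Continuous fun y : Fin d → ℝ => (y, t))).continuousAt)
  refine ⟨(cv_cont (tr_gi_int i le_rfl) hG hM).continuousOn, fun q _ => (hF q.1 q.2).differentiableAt,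
    fun j => ⟨?_, fun h => h.elim⟩⟩
  have : (dX j (cv (tr 0 T (gi i)) G)) = sg T i j G := by
    funext x t
    simp only [dX]
    rw [(hF x t).fderiv]
    simp [Pi.single_apply]
  rw [this]
  exact (hSc j).continuousOn

lemma cv_gain_hol (T : ℝ) (i : Fin d) (k : ℕ) {G : (Fin d → ℝ) → ℝ → ℝ} (hG : CX False univ k G)
    (hs : HasCompactSupport (fun q : (Fin d → ℝ) × ℝ => G q.1 q.2)) :
    CX True univ k (cv (tr 0 T (gi i)) G) := by
  induction k generalizing G with
  | zero =>
    have hGc : Continuous (fun q : (Fin d → ℝ) × ℝ => G q.1 q.2) := continuousOn_univ.1 hG.cont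
    obtain ⟨M, hM⟩ := cpt_bdd hGc hs
    obtain ⟨L, hL⟩ := cv_hol i T hGc.measurable hM
    exact ⟨(cv_cont (tr_gi_int i le_rfl) hGc.measurable hM).continuousOn,
      fun _ q _ => ⟨univ, univ_mem, L, fun x y t _ _ => hL x y t⟩⟩
  | succ k ih =>
    have hGc : Continuous (fun q : (Fin d → ℝ) × ℝ => G q.1 q.2) := continuousOn_univ.1 hG.cont
    obtain ⟨M, hM⟩ := cpt_bdd hGc hs
    have h1 : CX False univ 1 G := by
      refine ⟨hG.1, hG.2.1, fun j => ⟨(hG.2.2 j).cont, fun h => h.elim⟩⟩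
    have h2 := cv_fderiv (tr_gi_int (T := T) i le_rfl) h1 hs
    refine ⟨(cv_cont (tr_gi_int i le_rfl) hGc.measurable hM).continuousOn, fun q _ => (h2 q.1 q.2).1,
      fun j => ?_⟩
    have e : dX j (cv (tr 0 T (gi i)) G) = cv (tr 0 T (gi i)) (dX j G) := by
      funext x t; exact (h2 x t).2 j
    rw [e]
    exact ih (hG.2.2 j) (dX_supp hs j)

lemma cv_gain_one (T : ℝ) (i : Fin d) (k : ℕ) {G : (Fin d → ℝ) → ℝ → ℝ} (hG : CX True univ k G)
    (hs : HasCompactSupport (fun q : (Fin d → ℝ) × ℝ => G q.1 q.2)) :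
    CX False univ (k + 1) (cv (tr 0 T (gi i)) G) := by
  induction k generalizing G with
  | zero => exact cv_sing T i hG hs
  | succ k ih =>
    have hGc : Continuous (fun q : (Fin d → ℝ) × ℝ => G q.1 q.2) := continuousOn_univ.1 hG.cont
    obtain ⟨M, hM⟩ := cpt_bdd hGc hs
    have h1 : CX False univ 1 G := by
      refine ⟨hG.1, hG.2.1, fun j => ⟨(hG.2.2 j).cont, fun h => h.elim⟩⟩
    have h2 := cv_fderiv (tr_gi_int (T := T) i le_rfl) h1 hs
    refine ⟨(cv_cont (tr_gi_int i le_rfl) hGc.measurable hM).continuousOn, fun q _ => (h2 q.1 q.2).1,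
      fun j => ?_⟩
    have e : dX j (cv (tr 0 T (gi i)) G) = cv (tr 0 T (gi i)) (dX j G) := by
      funext x t; exact (h2 x t).2 j
    rw [e]
    exact ih (hG.2.2 j) (dX_supp hs j)

end Conv3


open Set MeasureTheory Filter Topology

section Boot

variable {d : ℕ}

/-- basic facts on classical solutions -/
structure Sol (Ω : Set (Fin d → ℝ)) (f : ((Fin d → ℝ) × ℝ × (Fin d → ℝ)) → ℝ)
    (u : (Fin d → ℝ) → ℝ → ℝ) : Prop where
  cont : ContinuousOn (fun q : (Fin d → ℝ) × ℝ => u q.1 q.2) (Ω ×ˢ univ)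
  x2 : ∀ t, ContDiffOn ℝ 2 (fun x => u x t) Ω
  t1 : ∀ x ∈ Ω, Differentiable ℝ (u x)
  eq : ∀ x ∈ Ω, ∀ t, deriv (u x) t = (∑ i, dX i (dX i u) x t) + f (x, u x t, fun i => dX i u x t)
  bnd : ∃ R : ℝ, ∀ x ∈ Ω, ∀ t, |u x t| ≤ R ∧ ∀ i, |dX i u x t| ≤ R

lemma heat_supp {v : (Fin d → ℝ) → ℝ → ℝ}
    (hs : HasCompactSupport (fun q : (Fin d → ℝ) × ℝ => v q.1 q.2)) :
    HasCompactSupport (fun q : (Fin d → ℝ) × ℝ => heat v q.1 q.2) := by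
  refine HasCompactSupport.intro hs.isCompact fun q hq => ?_
  have ho : IsOpen ((tsupport (fun q : (Fin d → ℝ) × ℝ => v q.1 q.2))ᶜ) :=
    (isClosed_tsupport _).isOpen_compl
  have hz : ∀ x t, (x, t) ∈ (tsupport (fun q : (Fin d → ℝ) × ℝ => v q.1 q.2))ᶜ → v x t = 0 := fun x t h =>
    image_eq_zero_of_notMem_tsupport (f := fun q : (Fin d → ℝ) × ℝ => v q.1 q.2) (x := (x, t)) h
  unfold heat
  have h1 : deriv (v q.1) q.2 = 0 := by
    have : v q.1 =ᶠ[𝓝 q.2] fun _ => 0 := by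
      have hc : Continuous (fun s : ℝ => (q.1, s)) := by fun_prop
      filter_upwards [hc.continuousAt.eventually_mem (ho.mem_nhds hq)] with s hs using hz _ _ hs
    rw [this.deriv_eq]; simp
  have h2 : ∀ i, dX i (dX i v) q.1 q.2 = 0 := by
    intro i
    have := dX_congr ho (g := dX i v) (g' := dX i (fun _ _ => (0:ℝ)))
      (dX_congr ho (g := v) (g' := fun _ _ => (0:ℝ)) hz i) i q.1 q.2 hq
    rw [this]; simp [dX]
  simp [h1, h2]

variable {Ω : Set (Fin d → ℝ)} {f : ((Fin d → ℝ) × ℝ × (Fin d → ℝ)) → ℝ} {u : (Fin d → ℝ) → ℝ → ℝ}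

lemma heat_cutoff (hΩ : IsOpen Ω) (hu : Sol Ω f u) {χ : (Fin d → ℝ) × ℝ → ℝ} (hχ : ContDiff ℝ (⊤ : ℕ∞) χ)
    {x : Fin d → ℝ} (hx : x ∈ Ω) (t : ℝ) :
    heat (fun x t => χ (x, t) * u x t) x t =
      χ (x, t) * f (x, u x t, fun i => dX i u x t)
      + (fderiv ℝ χ (x, t) (0, 1)
        - ∑ i, fderiv ℝ (fun q => fderiv ℝ χ q (Pi.single i 1, 0)) (x, t) (Pi.single i 1, 0)) * u x t
      + ∑ i, (-2 * fderiv ℝ χ (x, t) (Pi.single i 1, 0)) * dX i u x t := by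
  have hO : IsOpen (Ω ×ˢ (univ : Set ℝ)) := hΩ.prod isOpen_univ
  have hdx : ∀ (ψ : (Fin d → ℝ) × ℝ → ℝ), ContDiff ℝ (⊤ : ℕ∞) ψ → ∀ (i : Fin d) (y : Fin d → ℝ) (s : ℝ),
      DifferentiableAt ℝ (fun y => ψ (y, s)) y ∧
      dX i (fun x t => ψ (x, t)) y s = fderiv ℝ ψ (y, s) (Pi.single i 1, 0) := by
    intro ψ hψ i y s
    have h1 : HasFDerivAt (fun y : Fin d → ℝ => (y, s)) (ContinuousLinearMap.inl ℝ (Fin d → ℝ) ℝ) y :=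
      hasFDerivAt_prodMk_left y s
    have h2 := (hψ.differentiable (by simp) (y, s)).hasFDerivAt.comp y h1
    refine ⟨h2.differentiableAt, ?_⟩
    have := h2.fderiv
    simp only [dX]
    rw [show (fun y => ψ (y, s)) = ψ ∘ fun y => (y, s) from rfl, this]
    simp
  have hχ1 : ∀ i, ContDiff ℝ (⊤ : ℕ∞) (fun q => fderiv ℝ χ q (Pi.single i 1, 0)) := fun i =>
    (hχ.fderiv_right (m := (⊤ : ℕ∞)) (by simp)).clm_apply contDiff_const
  have hud : ∀ y ∈ Ω, ∀ s, DifferentiableAt ℝ (fun y => u y s) y := fun y hy s =>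
    ((hu.x2 s).contDiffAt (hΩ.mem_nhds hy)).differentiableAt (by simp)
  have hud1 : ∀ i, ∀ y ∈ Ω, ∀ s, DifferentiableAt ℝ (fun y => dX i u y s) y := fun i y hy s =>
    ((((hu.x2 s).contDiffAt (hΩ.mem_nhds hy)).fderiv_right (m := 1) (by norm_num)).differentiableAt
      (by simp)).clm_apply (differentiableAt_const _)
  have hone : ∀ i y s, (y, s) ∈ Ω ×ˢ (univ : Set ℝ) → dX i (fun x t => χ (x, t) * u x t) y s =
      χ (y, s) * dX i u y s + fderiv ℝ χ (y, s) (Pi.single i 1, 0) * u y s := by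
    intro i y s hy
    have := dX_bilin (ContinuousLinearMap.mul ℝ ℝ) (g := fun x t => χ (x, t)) (g' := u)
      (hdx χ hχ i y s).1 (hud y hy.1 s) i
    rw [(hdx χ hχ i y s).2] at this
    exact this
  have htwo : ∀ i, dX i (dX i (fun x t => χ (x, t) * u x t)) x t =
      χ (x, t) * dX i (dX i u) x t + 2 * fderiv ℝ χ (x, t) (Pi.single i 1, 0) * dX i u x t
       + fderiv ℝ (fun q => fderiv ℝ χ q (Pi.single i 1, 0)) (x, t) (Pi.single i 1, 0) * u x t := by
    intro i
    rw [dX_congr hO (hone i) i x t ⟨hx, mem_univ _⟩]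
    have e1 := dX_bilin (ContinuousLinearMap.mul ℝ ℝ) (g := fun x t => χ (x, t)) (g' := dX i u)
      (hdx χ hχ i x t).1 (hud1 i x hx t) i
    have e2 := dX_bilin (ContinuousLinearMap.mul ℝ ℝ)
      (g := fun x t => (fun q => fderiv ℝ χ q (Pi.single i 1, 0)) (x, t)) (g' := u)
      (hdx _ (hχ1 i) i x t).1 (hud x hx t) i
    rw [(hdx χ hχ i x t).2] at e1
    rw [(hdx _ (hχ1 i) i x t).2] at e2
    simp only [ContinuousLinearMap.mul_apply'] at e1 e2
    have e3 : dX i (fun y s => χ (y, s) * dX i u y s + fderiv ℝ χ (y, s) (Pi.single i 1, 0) * u y s) x t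
      = dX i (fun y s => χ (y, s) * dX i u y s) x t +
        dX i (fun y s => fderiv ℝ χ (y, s) (Pi.single i 1, 0) * u y s) x t := by
      simp only [dX]
      have a1 : DifferentiableAt ℝ (fun y => χ (y, t) * dX i u y t) x :=
        (hdx χ hχ i x t).1.mul (hud1 i x hx t)
      have a2 : DifferentiableAt ℝ (fun y => fderiv ℝ χ (y, t) (Pi.single i 1, 0) * u y t) x :=
        (hdx _ (hχ1 i) i x t).1.mul (hud x hx t)
      have := (a1.hasFDerivAt.add a2.hasFDerivAt).fderiv
      have a3 := congrArg (fun A => A (Pi.single i 1)) this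
      exact a3
    rw [e3, e1, e2]; ring
  have ht : deriv (fun s => χ (x, s) * u x s) t = fderiv ℝ χ (x, t) (0, 1) * u x t + χ (x, t) * deriv (u x) t := by
    have h1 : HasDerivAt (fun s : ℝ => (x, s)) ((0 : Fin d → ℝ), (1:ℝ)) t :=
      (hasDerivAt_const t x).prodMk (hasDerivAt_id t)
    have h2 := (hχ.differentiable (by simp) (x, t)).hasFDerivAt.comp_hasDerivAt t h1
    exact (h2.mul (hu.t1 x hx t).hasDerivAt).deriv
  unfold heat
  simp only [htwo]
  rw [ht, hu.eq x hx t]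
  simp only [Finset.sum_add_distrib, ← Finset.mul_sum, ← Finset.sum_mul, mul_assoc]
  ring

lemma tst_cutoff (hΩ : IsOpen Ω) (hu : Sol Ω f u) {χ : (Fin d → ℝ) × ℝ → ℝ} (hχ : ContDiff ℝ (⊤ : ℕ∞) χ)
    (hs : HasCompactSupport χ) (hsub : tsupport χ ⊆ Ω ×ˢ (univ : Set ℝ)) :
    Tst (fun x t => χ (x, t) * u x t) := by
  have hO : IsOpen (Ω ×ˢ (univ : Set ℝ)) := hΩ.prod isOpen_univ
  refine ⟨?_, ?_, ?_, ?_⟩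
  · have : CX False (Ω ×ˢ (univ : Set ℝ)) 0 u := ⟨hu.cont, fun h => h.elim⟩
    exact continuousOn_univ.1 (CX.cutoff hO hχ hsub this).cont
  · intro t
    rw [contDiff_iff_contDiffAt]
    intro x
    by_cases hx : x ∈ Ω
    · refine ContDiffAt.mul ?_ ((hu.x2 t).contDiffAt (hΩ.mem_nhds hx))
      exact ((contDiff_infty.1 hχ 2).comp
        (by fun_prop : ContDiff ℝ 2 fun y : Fin d → ℝ => (y, t))).contDiffAt
    · have hq : (x, t) ∈ (tsupport χ)ᶜ := fun h => hx (hsub h).1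
      have : (fun y => χ (y, t) * u y t) =ᶠ[𝓝 x] fun _ => 0 := by
        filter_upwards [slice_nhds (isClosed_tsupport χ).isOpen_compl hq] with y hy
        rw [image_eq_zero_of_notMem_tsupport hy, zero_mul]
      exact contDiffAt_const.congr_of_eventuallyEq this
  · intro x t
    by_cases hx : x ∈ Ω
    · refine DifferentiableAt.mul ?_ (hu.t1 x hx t)
      exact (hχ.differentiable (by simp)).comp
        (by fun_prop : Differentiable ℝ fun s : ℝ => (x, s)) t
    · have : (fun s => χ (x, s) * u x s) = fun _ => 0 := by
        funext s
        rw [image_eq_zero_of_notMem_tsupport (fun h => hx (hsub h).1), zero_mul]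
      rw [this]; exact differentiableAt_const _
  · exact hs.mul_right

lemma exists_cut (hΩ : IsOpen Ω) {q0 : (Fin d → ℝ) × ℝ} (hq : q0.1 ∈ Ω) :
    ∃ χ : (Fin d → ℝ) × ℝ → ℝ, ContDiff ℝ (⊤ : ℕ∞) χ ∧ HasCompactSupport χ ∧
      tsupport χ ⊆ Ω ×ˢ Ioo (q0.2 - 1) (q0.2 + 1) ∧
      ∃ O' : Set ((Fin d → ℝ) × ℝ), IsOpen O' ∧ q0 ∈ O' ∧ O' ⊆ Ω ×ˢ Ioo (q0.2 - 1) (q0.2 + 1) ∧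
        ∀ q ∈ O', χ q = 1 := by
  have hO : IsOpen (Ω ×ˢ Ioo (q0.2 - 1) (q0.2 + 1)) := hΩ.prod isOpen_Ioo
  have hm : q0 ∈ Ω ×ˢ Ioo (q0.2 - 1) (q0.2 + 1) := ⟨hq, by constructor <;> linarith⟩
  obtain ⟨ε, hε, hb⟩ := Metric.isOpen_iff.1 hO q0 hm
  let c : ContDiffBump q0 := ⟨ε / 4, ε / 2, by positivity, by linarith⟩
  have hts : tsupport c ⊆ Ω ×ˢ Ioo (q0.2 - 1) (q0.2 + 1) := by
    rw [c.tsupport_eq]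
    exact (Metric.closedBall_subset_ball (by change ε / 2 < ε; linarith)).trans hb
  refine ⟨c, c.contDiff, c.hasCompactSupport, hts, Metric.ball q0 (ε / 4), Metric.isOpen_ball,
    Metric.mem_ball_self (by positivity), ?_, fun q hq => ?_⟩
  · exact (Metric.ball_subset_ball (by linarith)).trans hb
  · exact c.one_of_mem_closedBall (Metric.ball_subset_closedBall hq)

lemma loc_repr (hΩ : IsOpen Ω) (hu : Sol Ω f u) {χ : (Fin d → ℝ) × ℝ → ℝ} (hχ : ContDiff ℝ (⊤ : ℕ∞) χ)
    (hs : HasCompactSupport χ) {t0 : ℝ} (hsub : tsupport χ ⊆ Ω ×ˢ Ioo (t0 - 1) (t0 + 1))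
    {O' : Set ((Fin d → ℝ) × ℝ)} (hO' : IsOpen O') (hOs : O' ⊆ Ω ×ˢ Ioo (t0 - 1) (t0 + 1))
    (h1 : ∀ q ∈ O', χ q = 1) {M : ℝ} (hM : ∀ x t, |heat (fun x t => χ (x, t) * u x t) x t| ≤ M)
    (i : Fin d) (x : Fin d → ℝ) (t : ℝ) (hq : (x, t) ∈ O') :
    (∫ y : Fin d → ℝ, gw (1 / 4) y 1)⁻¹ * cv (tr 0 3 (gi i)) (heat (fun x t => χ (x, t) * u x t)) x t
      = dX i u x t := by
  have hT := tst_cutoff hΩ hu hχ hs (hsub.trans (prod_mono le_rfl (subset_univ _)))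
  have := hT.dX_eq hM i x (t := t) (T := 3) (by norm_num) (fun y => by
    rw [image_eq_zero_of_notMem_tsupport (f := χ), zero_mul]
    intro h
    have a := (hsub h).2
    have b := (hOs hq).2
    simp only [mem_Ioo] at a b
    linarith)
  rw [this, inv_mul_cancel_left₀ (gw_integral_pos (by norm_num) one_pos).ne']
  exact dX_congr hO' (fun x t h => by rw [h1 _ h, one_mul]) i x t hq

lemma cx_of_grad {h : Prop} {k : ℕ} (hΩ : IsOpen Ω) (hu : Sol Ω f u)
    (hd : ∀ i, CX h (Ω ×ˢ (univ : Set ℝ)) k (dX i u)) : CX h (Ω ×ˢ (univ : Set ℝ)) (k + 1) u :=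
  ⟨hu.cont, fun q hq => ((hu.x2 q.2).contDiffAt (hΩ.mem_nhds hq.1)).differentiableAt (by simp), hd⟩

lemma cx_phi {h : Prop} {k : ℕ} {O : Set ((Fin d → ℝ) × ℝ)} (hO : IsOpen O)
    (hu : CX h O k u) (hd : ∀ i, CX h O k (dX i u)) :
    CX h O k (fun x t => (x, u x t, fun i => dX i u x t)) := by
  have h1 : CX h O k (fun (x : Fin d → ℝ) (t : ℝ) =>
      (ContinuousLinearMap.inl ℝ (Fin d → ℝ) (ℝ × (Fin d → ℝ))) x) :=
    (CX.idq.clm hO (ContinuousLinearMap.fst ℝ (Fin d → ℝ) ℝ)).clm hO _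
  have h2 := hu.clm hO ((ContinuousLinearMap.inr ℝ (Fin d → ℝ) (ℝ × (Fin d → ℝ))).comp
    (ContinuousLinearMap.inl ℝ ℝ (Fin d → ℝ)))
  have h3 := CX.sum hO Finset.univ (fun i _ => (hd i).clm hO
    ((ContinuousLinearMap.inr ℝ (Fin d → ℝ) (ℝ × (Fin d → ℝ))).comp
    ((ContinuousLinearMap.inr ℝ ℝ (Fin d → ℝ)).comp
      (ContinuousLinearMap.single ℝ (fun _ : Fin d => ℝ) i))))
  refine ((h1.add hO h2).add hO h3).congr hO fun x t _ => ?_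
  refine Prod.ext ?_ (Prod.ext ?_ ?_)
  · simp [Prod.fst_sum]
  · simp [Prod.fst_sum, Prod.snd_sum]
  · simp only [Prod.snd_add, Prod.snd_sum]
    ext j
    simp [Finset.sum_apply, Pi.single_apply]

lemma heat_cx (hΩ : IsOpen Ω) (hu : Sol Ω f u)
    (hf : ContDiffOn ℝ (⊤ : ℕ∞) f (Ω ×ˢ ((univ : Set ℝ) ×ˢ (univ : Set (Fin d → ℝ)))))
    {χ : (Fin d → ℝ) × ℝ → ℝ} (hχ : ContDiff ℝ (⊤ : ℕ∞) χ)
    (hsub : tsupport χ ⊆ Ω ×ˢ (univ : Set ℝ))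
    {h : Prop} {k : ℕ} (hd : ∀ i, CX h (Ω ×ˢ (univ : Set ℝ)) k (dX i u)) :
    CX h univ k (heat (fun x t => χ (x, t) * u x t)) := by
  have hO : IsOpen (Ω ×ˢ (univ : Set ℝ)) := hΩ.prod isOpen_univ
  have hu0 : CX h (Ω ×ˢ (univ : Set ℝ)) k u := (cx_of_grad hΩ hu hd).pred hO
  have hfφ := CX.comp hO (hΩ.prod (isOpen_univ.prod isOpen_univ)) hf (cx_phi hO hu0 hd)
    (fun x t hq => ⟨hq.1, mem_univ _, mem_univ _⟩)
  have hχ1 : ∀ v, ContDiff ℝ (⊤ : ℕ∞) (fun q => fderiv ℝ χ q v) := fun v =>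
    (hχ.fderiv_right (m := (⊤ : ℕ∞)) (by simp)).clm_apply contDiff_const
  have hχ2 : ∀ v w, ContDiff ℝ (⊤ : ℕ∞) (fun q => fderiv ℝ (fun q => fderiv ℝ χ q v) q w) := fun v w =>
    ((hχ1 v).fderiv_right (m := (⊤ : ℕ∞)) (by simp)).clm_apply contDiff_const
  have hs1 : ∀ v, tsupport (fun q => fderiv ℝ χ q v) ⊆ tsupport χ := fun v =>
    tsupport_fderiv_apply_subset ℝ v
  have hs2 : ∀ v w, tsupport (fun q => fderiv ℝ (fun q => fderiv ℝ χ q v) q w) ⊆ tsupport χ := fun v w =>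
    (tsupport_fderiv_apply_subset ℝ w).trans (hs1 v)
  have hG := ((CX.cutoff hO hχ hsub hfφ).add isOpen_univ (((CX.cutoff hO (hχ1 (0, 1)) ((hs1 _).trans hsub) hu0)).sub
    isOpen_univ (CX.sum isOpen_univ Finset.univ fun i _ =>
      CX.cutoff hO (hχ2 (Pi.single i 1, 0) (Pi.single i 1, 0)) ((hs2 _ _).trans hsub) hu0))).add isOpen_univ
    (CX.sum isOpen_univ Finset.univ fun i _ =>
      (CX.cutoff hO (hχ1 (Pi.single i 1, 0)) ((hs1 _).trans hsub) (hd i)).clm isOpen_univ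
        ((-2 : ℝ) • ContinuousLinearMap.id ℝ ℝ))
  refine hG.congr isOpen_univ fun x t _ => ?_
  by_cases hx : x ∈ Ω
  · rw [heat_cutoff hΩ hu hχ hx t]
    simp only [smul_apply, ContinuousLinearMap.id_apply, smul_eq_mul, sub_mul,
      Finset.sum_mul, mul_assoc]
  · have hq : (x, t) ∉ tsupport χ := fun h => hx (hsub h).1
    have z0 : ∀ {ψ : (Fin d → ℝ) × ℝ → ℝ}, tsupport ψ ⊆ tsupport χ → ψ (x, t) = 0 := fun hψ =>
      image_eq_zero_of_notMem_tsupport fun h => hq (hψ h)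
    have z1 := fun v => z0 (hs1 v)
    have z2 := fun v w => z0 (hs2 v w)
    have z3 := z0 (ψ := χ) le_rfl
    have hz : heat (fun x t => χ (x, t) * u x t) x t = 0 := by
      unfold heat
      have ho := (isClosed_tsupport χ).isOpen_compl
      have hv : ∀ x t, (x, t) ∈ (tsupport χ)ᶜ → χ (x, t) * u x t = 0 := fun x t h => by
        rw [image_eq_zero_of_notMem_tsupport h, zero_mul]
      have e1 : (fun s => χ (x, s) * u x s) = fun _ => 0 := by
        funext s
        rw [image_eq_zero_of_notMem_tsupport (fun h => hx (hsub h).1), zero_mul]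
      have h2 : ∀ i, dX i (dX i (fun x t => χ (x, t) * u x t)) x t = 0 := by
        intro i
        have := dX_congr ho (g' := dX i (fun _ _ => (0:ℝ)))
          (dX_congr ho (g' := fun _ _ => (0:ℝ)) hv i) i x t hq
        rw [this]; simp [dX]
      have e2 : ((fun x t => χ (x, t) * u x t) x) = fun _ => 0 := e1
      rw [e2]; simp [h2]
    rw [hz]
    simp [z1, z2, z3]

lemma heat_bdd (hΩ : IsOpen Ω) (hu : Sol Ω f u)
    (hf : ContDiffOn ℝ (⊤ : ℕ∞) f (Ω ×ˢ ((univ : Set ℝ) ×ˢ (univ : Set (Fin d → ℝ)))))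
    {χ : (Fin d → ℝ) × ℝ → ℝ} (hχ : ContDiff ℝ (⊤ : ℕ∞) χ) (hs : HasCompactSupport χ)
    (hsub : tsupport χ ⊆ Ω ×ˢ (univ : Set ℝ)) :
    ∃ M, ∀ x t, |heat (fun x t => χ (x, t) * u x t) x t| ≤ M := by
  obtain ⟨R, hR⟩ := hu.bnd
  have hK : IsCompact ((tsupport χ) ×ˢ (Icc (-R) R ×ˢ (Metric.closedBall (0 : Fin d → ℝ) |R|))) :=
    hs.isCompact.prod (isCompact_Icc.prod (isCompact_closedBall _ _))
  have hχ1 : ∀ v, ContDiff ℝ (⊤ : ℕ∞) (fun q => fderiv ℝ χ q v) := fun v =>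
    (hχ.fderiv_right (m := (⊤ : ℕ∞)) (by simp)).clm_apply contDiff_const
  have hχ2 : ∀ v w, ContDiff ℝ (⊤ : ℕ∞) (fun q => fderiv ℝ (fun q => fderiv ℝ χ q v) q w) := fun v w =>
    ((hχ1 v).fderiv_right (m := (⊤ : ℕ∞)) (by simp)).clm_apply contDiff_const
  let Φ : ((Fin d → ℝ) × ℝ) × (ℝ × (Fin d → ℝ)) → ℝ := fun z =>
      χ z.1 * f (z.1.1, z.2.1, z.2.2)
      + (fderiv ℝ χ z.1 (0, 1)
        - ∑ i, fderiv ℝ (fun q => fderiv ℝ χ q (Pi.single i 1, 0)) z.1 (Pi.single i 1, 0)) * z.2.1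
      + ∑ i, (-2 * fderiv ℝ χ z.1 (Pi.single i 1, 0)) * z.2.2 i
  have hΦ : ContinuousOn Φ ((tsupport χ) ×ˢ (Icc (-R) R ×ˢ (Metric.closedBall (0 : Fin d → ℝ) |R|))) := by
    have c0 := hχ.continuous
    have c1 := fun v => (hχ1 v).continuous
    have c2 := fun v w => (hχ2 v w).continuous
    refine ContinuousOn.add (ContinuousOn.add ?_ ?_) ?_
    · refine (c0.comp continuous_fst).continuousOn.mul ?_
      refine hf.continuousOn.comp (by fun_prop) fun z hz => ⟨(hsub hz.1).1, mem_univ _, mem_univ _⟩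
    · refine Continuous.continuousOn ?_
      refine Continuous.mul (Continuous.sub ((c1 _).comp continuous_fst) ?_) (by fun_prop)
      exact continuous_finsetSum _ fun i _ => (c2 _ _).comp continuous_fst
    · refine Continuous.continuousOn ?_
      exact continuous_finsetSum _ fun i _ =>
        (continuous_const.mul ((c1 _).comp continuous_fst)).mul (by fun_prop)
  obtain ⟨M, hM⟩ := hK.exists_bound_of_continuousOn hΦ
  refine ⟨max M 0, fun x t => ?_⟩
  by_cases hq : (x, t) ∈ tsupport χ
  · have hx := (hsub hq).1
    rw [heat_cutoff hΩ hu hχ hx t]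
    have h1 := hM ((x, t), (u x t, fun i => dX i u x t)) ⟨hq, abs_le.1 (hR x hx t).1, by
      rw [mem_closedBall_zero_iff, pi_norm_le_iff_of_nonneg (abs_nonneg _)]
      exact fun i => ((hR x hx t).2 i).trans (le_abs_self _)⟩
    exact h1.trans (le_max_left _ _)
  · have hv : ∀ x t, (x, t) ∈ (tsupport χ)ᶜ → χ (x, t) * u x t = 0 := fun x t h => by
      rw [image_eq_zero_of_notMem_tsupport h, zero_mul]
    have : heat (fun x t => χ (x, t) * u x t) x t = 0 := by
      have ho := (isClosed_tsupport χ).isOpen_compl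
      unfold heat
      have e1 : (fun s => χ (x, s) * u x s) =ᶠ[𝓝 t] fun _ => 0 := by
        have hc : Continuous (fun s : ℝ => (x, s)) := by fun_prop
        filter_upwards [hc.continuousAt.eventually_mem (ho.mem_nhds hq)] with s hs using hv _ _ hs
      have h2 : ∀ i, dX i (dX i (fun x t => χ (x, t) * u x t)) x t = 0 := by
        intro i
        have := dX_congr ho (g' := dX i (fun _ _ => (0:ℝ)))
          (dX_congr ho (g' := fun _ _ => (0:ℝ)) hv i) i x t hq
        rw [this]; simp [dX]
      have e2 : deriv ((fun x t => χ (x, t) * u x t) x) t = 0 := by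
        have := e1.deriv_eq
        simpa using this
      rw [e2]; simp [h2]
    rw [this]; simp

lemma boot (hΩ : IsOpen Ω) (hu : Sol Ω f u)
    (hf : ContDiffOn ℝ (⊤ : ℕ∞) f (Ω ×ˢ ((univ : Set ℝ) ×ˢ (univ : Set (Fin d → ℝ))))) (k : ℕ) :
    ∀ i, CX True (Ω ×ˢ (univ : Set ℝ)) k (dX i u) := by
  have hO : IsOpen (Ω ×ˢ (univ : Set ℝ)) := hΩ.prod isOpen_univ
  have gen : ∀ (h : Prop) (k : ℕ), (∀ (χ : (Fin d → ℝ) × ℝ → ℝ), ContDiff ℝ (⊤ : ℕ∞) χ →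
      HasCompactSupport χ → tsupport χ ⊆ Ω ×ˢ (univ : Set ℝ) →
      ∀ i, CX h univ k (cv (tr 0 3 (gi i)) (heat (fun x t => χ (x, t) * u x t)))) →
      ∀ i, CX h (Ω ×ˢ (univ : Set ℝ)) k (dX i u) := by
    intro h k H i
    refine CX.of_local fun q hq => ?_
    obtain ⟨χ, h1, h2, h3, O', h4, h5, h6, h7⟩ := exists_cut hΩ hq.1
    have hsub := h3.trans (prod_mono le_rfl (subset_univ (Ioo (q.2 - 1) (q.2 + 1))))
    obtain ⟨M, hM⟩ := heat_bdd hΩ hu hf h1 h2 hsub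
    refine ⟨O', h5, h4, ?_⟩
    have := ((H χ h1 h2 hsub i).mono (subset_univ O')).clm h4
      ((∫ y : Fin d → ℝ, gw (1 / 4) y 1)⁻¹ • ContinuousLinearMap.id ℝ ℝ)
    refine this.congr h4 fun x t hxt => ?_
    exact loc_repr hΩ hu h1 h2 h3 h4 h6 h7 hM i x t hxt
  induction k with
  | zero =>
    refine gen True 0 fun χ h1 h2 h3 i => ?_
    obtain ⟨M, hM⟩ := heat_bdd hΩ hu hf h1 h2 h3
    have hm := (tst_cutoff hΩ hu h1 h2 h3).heat_meas
    obtain ⟨L, hL⟩ := cv_hol i 3 hm hM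
    exact ⟨(cv_cont (tr_gi_int i le_rfl) hm hM).continuousOn,
      fun _ q _ => ⟨univ, univ_mem, L, fun x y t _ _ => hL x y t⟩⟩
  | succ k ih =>
    have s1 : ∀ i, CX False (Ω ×ˢ (univ : Set ℝ)) (k + 1) (dX i u) :=
      gen False (k + 1) fun χ h1 h2 h3 i => cv_gain_one 3 i k (heat_cx hΩ hu hf h1 h3 ih)
        (heat_supp (v := fun x t => χ (x, t) * u x t) (tst_cutoff hΩ hu h1 h2 h3).supp)
    exact gen True (k + 1) fun χ h1 h2 h3 i => cv_gain_hol 3 i (k + 1) (heat_cx hΩ hu hf h1 h3 s1)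
        (heat_supp (v := fun x t => χ (x, t) * u x t) (tst_cutoff hΩ hu h1 h2 h3).supp)

/-- interior smoothness in space of classical solutions -/
lemma Sol.smooth (hΩ : IsOpen Ω) (hu : Sol Ω f u)
    (hf : ContDiffOn ℝ (⊤ : ℕ∞) f (Ω ×ˢ ((univ : Set ℝ) ×ˢ (univ : Set (Fin d → ℝ))))) (k : ℕ) :
    CX False (Ω ×ˢ (univ : Set ℝ)) k u :=
  (cx_of_grad hΩ hu (boot hΩ hu hf k)).pred (hΩ.prod isOpen_univ)

end Boot


open Set MeasureTheory Filter Topology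

section Joint

variable {d : ℕ} {Ω : Set (Fin d → ℝ)}

lemma time_dx (hΩ : IsOpen Ω) {g q : (Fin d → ℝ) → ℝ → ℝ}
    (hg : CX False (Ω ×ˢ (univ : Set ℝ)) 1 g) (hq : CX False (Ω ×ˢ (univ : Set ℝ)) 1 q)
    (hd : ∀ x ∈ Ω, ∀ t, HasDerivAt (g x) (q x t) t) (i : Fin d) {x : Fin d → ℝ} (hx : x ∈ Ω) (t : ℝ) :
    HasDerivAt (dX i g x) (dX i q x t) t := by
  have cq : ∀ {w : (Fin d → ℝ) → ℝ → ℝ}, ContinuousOn (fun q : (Fin d → ℝ) × ℝ => w q.1 q.2)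
      (Ω ×ˢ (univ : Set ℝ)) → ∀ y ∈ Ω, Continuous (w y) := fun {w} hw y hy => by
    rw [← continuousOn_univ]
    exact hw.comp (f := fun s : ℝ => (y, s)) (by fun_prop) fun s _ => ⟨hy, mem_univ _⟩
  have key : ∀ s, dX i g x s = dX i g x t + ∫ r in t..s, dX i q x r := by
    intro s
    set e : Fin d → ℝ := Pi.single i 1 with he
    obtain ⟨ε, ε0, hε⟩ := Metric.isOpen_iff.1 hΩ x hx
    have hcl : ∀ r : ℝ, r ∈ Metric.ball (0:ℝ) (ε / 2) → x + r • e ∈ Metric.closedBall x (ε / 2) := by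
      intro r hr
      rw [mem_ball_zero_iff] at hr
      rw [mem_closedBall_iff_norm, add_sub_cancel_left, norm_smul, he, Pi.norm_single]
      simpa using hr.le
    have hcO : Metric.closedBall x (ε / 2) ⊆ Ω :=
      (Metric.closedBall_subset_ball (by linarith)).trans hε
    have hK : IsCompact (Metric.closedBall x (ε / 2) ×ˢ uIcc t s) :=
      (isCompact_closedBall _ _).prod isCompact_uIcc
    obtain ⟨M, hM⟩ := hK.exists_bound_of_continuousOn
      ((hq.2.2 i).cont.mono (prod_mono hcO (subset_univ _)))
    have hs : Metric.ball (0:ℝ) (ε / 2) ∈ 𝓝 (0:ℝ) := Metric.ball_mem_nhds _ (by linarith)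
    have h1 := (intervalIntegral.hasDerivAt_integral_of_dominated_loc_of_deriv_le
      (μ := volume) (a := t) (b := s)
      (F := fun r s => q (x + r • e) s) (F' := fun r s => dX i q (x + r • e) s) (x₀ := (0:ℝ))
      (bound := fun _ => M) hs ?_ ?_ ?_ ?_ ?_ ?_).2
    · have h2 : HasDerivAt (fun r : ℝ => g (x + r • e) s - g (x + r • e) t)
          (dX i g x s - dX i g x t) 0 := by
        have a1 := hasDerivAt_line (ψ := fun y => g y s) (x := x) (e := e) (r := 0)
          (by simpa using hg.2.1 (x, s) ⟨hx, mem_univ _⟩)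
        have a2 := hasDerivAt_line (ψ := fun y => g y t) (x := x) (e := e) (r := 0)
          (by simpa using hg.2.1 (x, t) ⟨hx, mem_univ _⟩)
        have := a1.sub a2
        simp only [zero_smul, add_zero] at this
        exact this
      have h3 : (fun r : ℝ => g (x + r • e) s - g (x + r • e) t) =ᶠ[𝓝 0]
          fun r => ∫ τ in t..s, q (x + r • e) τ := by
        filter_upwards [hs] with r hr
        have hy := hcO (hcl r hr)
        rw [intervalIntegral.integral_eq_sub_of_hasDerivAt (fun τ _ => hd _ hy τ)
          ((cq hq.1 _ hy).intervalIntegrable _ _)]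
      have h4 := (h1.congr_of_eventuallyEq h3).unique h2
      simp only [zero_smul, add_zero] at h4
      rw [h4]; ring
    · filter_upwards [hs] with r hr
      exact (cq hq.1 _ (hcO (hcl r hr))).aestronglyMeasurable
    · simp only [zero_smul, add_zero]
      exact (cq hq.1 x hx).intervalIntegrable _ _
    · simp only [zero_smul, add_zero]
      exact (cq (hq.2.2 i).cont x hx).aestronglyMeasurable
    · exact Eventually.of_forall fun τ hτ r hr => hM (x + r • e, τ) ⟨hcl r hr, uIoc_subset_uIcc hτ⟩
    · exact intervalIntegrable_const
    · refine Eventually.of_forall fun τ hτ r hr => ?_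
      exact hasDerivAt_line (ψ := fun y => q y τ) (hq.2.1 (x + r • e, τ) ⟨hcO (hcl r hr), mem_univ _⟩)
  have hc := cq (hq.2.2 i).cont x hx
  have := (intervalIntegral.integral_hasDerivAt_right (hc.intervalIntegrable t t)
    (hc.stronglyMeasurableAtFilter _ _) hc.continuousAt).const_add (dX i g x t)
  rw [funext key]
  exact this

/-- the differential algebra generated by a function -/
inductive Alg (Ω : Set (Fin d → ℝ)) (u : (Fin d → ℝ) → ℝ → ℝ) : ((Fin d → ℝ) → ℝ → ℝ) → Prop
  | base : Alg Ω u u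
  | dx (i : Fin d) (g : (Fin d → ℝ) → ℝ → ℝ) : Alg Ω u g → Alg Ω u (dX i g)
  | comp (ι : Type) (inst : Fintype ι) (g : ι → (Fin d → ℝ) → ℝ → ℝ) (F : (Fin d → ℝ) × (ι → ℝ) → ℝ)
      (hF : ContDiffOn ℝ (⊤ : ℕ∞) F (Ω ×ˢ univ)) :
      (∀ j, Alg Ω u (g j)) → Alg Ω u (fun x t => F (x, fun j => g j x t))

variable {f : ((Fin d → ℝ) × ℝ × (Fin d → ℝ)) → ℝ} {u : (Fin d → ℝ) → ℝ → ℝ}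

lemma CX.pi {ι : Type} [Fintype ι] {O : Set ((Fin d → ℝ) × ℝ)} (hO : IsOpen O) {h : Prop} {k : ℕ}
    {g : ι → (Fin d → ℝ) → ℝ → ℝ} (hg : ∀ j, CX h O k (g j)) :
    CX h O k (fun x t => (fun j => g j x t : ι → ℝ)) := by
  classical
  have := CX.sum hO (Finset.univ : Finset ι) (g := fun j x t =>
    (ContinuousLinearMap.single ℝ (fun _ : ι => ℝ) j) (g j x t)) (h := h) (k := k)
    (fun j _ => (hg j).clm hO _)
  refine this.congr hO fun x t _ => ?_
  funext j
  simp

lemma CX.prodMk {X Y : Type} [NormedAddCommGroup X] [NormedSpace ℝ X] [NormedAddCommGroup Y]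
    [NormedSpace ℝ Y] {O : Set ((Fin d → ℝ) × ℝ)} (hO : IsOpen O) {h : Prop} {k : ℕ}
    {g : (Fin d → ℝ) → ℝ → X} {g' : (Fin d → ℝ) → ℝ → Y} (hg : CX h O k g) (hg' : CX h O k g') :
    CX h O k (fun x t => (g x t, g' x t)) := by
  have := (hg.clm hO (ContinuousLinearMap.inl ℝ X Y)).add hO (hg'.clm hO (ContinuousLinearMap.inr ℝ X Y))
  refine this.congr hO fun x t _ => ?_
  simp

lemma Alg.cx (hΩ : IsOpen Ω) (hu : ∀ k, CX False (Ω ×ˢ (univ : Set ℝ)) k u)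
    {g : (Fin d → ℝ) → ℝ → ℝ} (hg : Alg Ω u g) : ∀ k, CX False (Ω ×ˢ (univ : Set ℝ)) k g := by
  have hO : IsOpen (Ω ×ˢ (univ : Set ℝ)) := hΩ.prod isOpen_univ
  induction hg with
  | base => exact hu
  | dx i g _ ih => exact fun k => (ih (k + 1)).2.2 i
  | comp ι inst g F hF _ ih =>
    intro k
    have h1 : CX False (Ω ×ˢ (univ : Set ℝ)) k (fun (x : Fin d → ℝ) (_ : ℝ) => x) :=
      (CX.idq).clm hO (ContinuousLinearMap.fst ℝ (Fin d → ℝ) ℝ)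
    have h2 := CX.prodMk hO h1 (CX.pi hO (fun j => ih j k))
    exact CX.comp hO (hΩ.prod isOpen_univ) hF h2 fun x t h => ⟨h.1, mem_univ _⟩

lemma Alg.time (hΩ : IsOpen Ω) (hs : Sol Ω f u)
    (hf : ContDiffOn ℝ (⊤ : ℕ∞) f (Ω ×ˢ ((univ : Set ℝ) ×ˢ (univ : Set (Fin d → ℝ)))))
    {g : (Fin d → ℝ) → ℝ → ℝ} (hg : Alg Ω u g) :
    ∃ q, Alg Ω u q ∧ ∀ x ∈ Ω, ∀ t, HasDerivAt (g x) (q x t) t := by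
  have hu := hs.smooth hΩ hf
  induction hg with
  | base =>
    refine ⟨_, Alg.comp (Fin d ⊕ (Unit ⊕ Fin d)) inferInstance
      (Sum.elim (fun i => dX i (dX i u)) (Sum.elim (fun _ => u) (fun i => dX i u)))
      (fun z => (∑ i, z.2 (Sum.inl i)) + f (z.1, z.2 (Sum.inr (Sum.inl ())),
        fun i => z.2 (Sum.inr (Sum.inr i)))) ?_ ?_, ?_⟩
    · refine ContDiffOn.add (ContDiff.contDiffOn (by fun_prop)) ?_
      exact hf.comp (ContDiff.contDiffOn (by fun_prop)) fun z hz => ⟨hz.1, mem_univ _, mem_univ _⟩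
    · rintro (i | i | i)
      · exact .dx _ _ (.dx _ _ .base)
      · exact .base
      · exact .dx _ _ .base
    · intro x hx t
      have := (hs.t1 x hx t).hasDerivAt
      rw [hs.eq x hx t] at this
      exact this
  | dx i g hg ih =>
    obtain ⟨q, hq, h⟩ := ih
    exact ⟨dX i q, .dx _ _ hq, fun x hx t => time_dx hΩ (hg.cx hΩ hu 1) (hq.cx hΩ hu 1) h i hx t⟩
  | comp ι inst g F hF hg ih =>
    choose q hq h using ih
    refine ⟨_, Alg.comp (ι ⊕ ι) inferInstance (Sum.elim g q)
      (fun z => fderiv ℝ F (z.1, fun j => z.2 (Sum.inl j)) (0, fun j => z.2 (Sum.inr j))) ?_ ?_, ?_⟩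
    · refine ContDiffOn.clm_apply ?_ (ContDiff.contDiffOn (by fun_prop))
      exact (hF.fderiv_of_isOpen (hΩ.prod isOpen_univ) (m := (⊤ : ℕ∞)) (by simp)).comp
        (ContDiff.contDiffOn (by fun_prop)) fun z hz => ⟨hz.1, mem_univ _⟩
    · rintro (j | j)
      · exact hg j
      · exact hq j
    · intro x hx t
      have h1 : HasDerivAt (fun s => (x, fun j => g j x s)) ((0 : Fin d → ℝ), fun j => q j x t) t :=
        (hasDerivAt_const t x).prodMk (hasDerivAt_pi.2 fun j => h j x hx t)
      have h2 : DifferentiableAt ℝ F (x, fun j => g j x t) :=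
        (hF.contDiffAt ((hΩ.prod isOpen_univ).mem_nhds ⟨hx, mem_univ _⟩)).differentiableAt (by simp)
      exact h2.hasFDerivAt.comp_hasDerivAt t h1

lemma joint_fderiv (hΩ : IsOpen Ω) {g q : (Fin d → ℝ) → ℝ → ℝ}
    (hg : CX False (Ω ×ˢ (univ : Set ℝ)) 1 g) (hq : CX False (Ω ×ˢ (univ : Set ℝ)) 0 q)
    (hd : ∀ x ∈ Ω, ∀ t, HasDerivAt (g x) (q x t) t) {z : (Fin d → ℝ) × ℝ} (hz : z ∈ Ω ×ˢ (univ : Set ℝ)) :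
    HasFDerivAt (fun z : (Fin d → ℝ) × ℝ => g z.1 z.2)
      ((∑ i, dX i g z.1 z.2 • (ContinuousLinearMap.proj (R := ℝ) (φ := fun _ : Fin d => ℝ) i).comp
        (ContinuousLinearMap.fst ℝ (Fin d → ℝ) ℝ)) + q z.1 z.2 • ContinuousLinearMap.snd ℝ (Fin d → ℝ) ℝ) z := by
  have hO : IsOpen (Ω ×ˢ (univ : Set ℝ)) := hΩ.prod isOpen_univ
  have hn := hO.mem_nhds hz
  have := (hasStrictFDerivAt_uncurry_coprod (𝕜 := ℝ) (u := z) (f := g)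
    (f₁ := fun x t => ∑ i, dX i g x t • (ContinuousLinearMap.proj (R := ℝ) (φ := fun _ : Fin d => ℝ) i))
    (f₂ := fun x t => q x t • ContinuousLinearMap.id ℝ ℝ) ?_ ?_ ?_ ?_).hasFDerivAt
  · refine this.congr_fderiv ?_
    refine ContinuousLinearMap.ext fun v => ?_
    simp [Function.HasUncurry.uncurry]
  · filter_upwards [hn] with v hv
    have h1 := (hg.2.1 v hv).hasFDerivAt
    rw [fderiv_eq_sum_dX] at h1
    refine h1.congr_fderiv ?_
    refine ContinuousLinearMap.ext fun v => ?_
    simp [Function.HasUncurry.uncurry, mul_comm]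
  · filter_upwards [hn] with v hv
    refine (hd v.1 hv.1 v.2).hasFDerivAt.congr_fderiv ?_
    ext; simp [Function.HasUncurry.uncurry]
  · have hc : ∀ i, ContinuousAt (fun z : (Fin d → ℝ) × ℝ => dX i g z.1 z.2) z := fun i =>
      (hg.2.2 i).cont.continuousAt hn
    have hc' : ∀ i, ContinuousAt (fun z : (Fin d → ℝ) × ℝ => dX i g z.1 z.2 •
        (ContinuousLinearMap.proj (R := ℝ) (φ := fun _ : Fin d => ℝ) i)) z := fun i =>
      (hc i).smul continuousAt_const
    have hc2 : ContinuousAt (fun z : (Fin d → ℝ) × ℝ => ∑ i, dX i g z.1 z.2 •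
        (ContinuousLinearMap.proj (R := ℝ) (φ := fun _ : Fin d => ℝ) i)) z :=
      tendsto_finsetSum Finset.univ fun i _ => hc' i
    exact hc2
  · exact (hq.cont.continuousAt hn).smul continuousAt_const

lemma Alg.joint (hΩ : IsOpen Ω) (hs : Sol Ω f u)
    (hf : ContDiffOn ℝ (⊤ : ℕ∞) f (Ω ×ˢ ((univ : Set ℝ) ×ˢ (univ : Set (Fin d → ℝ))))) (n : ℕ) :
    ∀ {g : (Fin d → ℝ) → ℝ → ℝ}, Alg Ω u g →
    ContDiffOn ℝ n (fun z : (Fin d → ℝ) × ℝ => g z.1 z.2) (Ω ×ˢ (univ : Set ℝ)) := by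
  have hu := hs.smooth hΩ hf
  have hO : IsOpen (Ω ×ˢ (univ : Set ℝ)) := hΩ.prod isOpen_univ
  induction n with
  | zero => exact fun {g} hg => by simpa using (hg.cx hΩ hu 0).cont
  | succ n ih =>
    intro g hg
    obtain ⟨q, hq, h⟩ := hg.time hΩ hs hf
    have hF := fun z hz => joint_fderiv hΩ (z := z) (hg.cx hΩ hu 1) (hq.cx hΩ hu 0) h hz
    have : ((n + 1 : ℕ) : WithTop ℕ∞) = (n : WithTop ℕ∞) + 1 := by simp
    rw [this, contDiffOn_succ_iff_fderiv_of_isOpen hO]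
    refine ⟨fun z hz => (hF z hz).differentiableAt.differentiableWithinAt, by simp, ?_⟩
    refine ContDiffOn.congr ?_ fun z hz => (hF z hz).fderiv
    refine ContDiffOn.add (ContDiffOn.sum fun i _ => ?_) ?_
    · exact (ih (hg.dx i)).smul contDiffOn_const
    · exact (ih hq).smul contDiffOn_const

/-- solutions are jointly smooth in the interior -/
lemma Sol.joint (hΩ : IsOpen Ω) (hs : Sol Ω f u)
    (hf : ContDiffOn ℝ (⊤ : ℕ∞) f (Ω ×ˢ ((univ : Set ℝ) ×ˢ (univ : Set (Fin d → ℝ))))) :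
    ContDiffOn ℝ (⊤ : ℕ∞) (fun z : (Fin d → ℝ) × ℝ => u z.1 z.2) (Ω ×ˢ (univ : Set ℝ)) :=
  contDiffOn_infty.2 fun n => Alg.joint hΩ hs hf n .base

end Joint


open Set MeasureTheory Filter Topology

section Weighted

variable {d : ℕ}

/-- smooth function vanishing outside `B` -/
def S0 (B : Set (Fin d → ℝ)) (φ : (Fin d → ℝ) → ℝ) : Prop :=
  ContDiff ℝ (⊤ : ℕ∞) φ ∧ ∀ x, x ∉ B → φ x = 0

variable {B : Set (Fin d → ℝ)} {φ ψ : (Fin d → ℝ) → ℝ}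

lemma S0.cs (hB : IsCompact B) (h : S0 B φ) : HasCompactSupport φ :=
  HasCompactSupport.intro hB fun x hx => h.2 x hx

lemma S0.int (hB : IsCompact B) (h : S0 B φ) {w : (Fin d → ℝ) → ℝ} (hw : Continuous w) :
    Integrable (fun y => φ y * w y) :=
  (h.1.continuous.mul hw).integrable_of_hasCompactSupport (h.cs hB).mul_right

lemma S0.pd (hB : IsClosed B) (h : S0 B φ) (i : Fin d) : S0 B (pd i φ) := by
  refine ⟨(h.1.fderiv_right (m := (⊤ : ℕ∞)) (by simp)).clm_apply contDiff_const, fun x hx => ?_⟩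
  have : φ =ᶠ[𝓝 x] fun _ => 0 := by
    filter_upwards [hB.isOpen_compl.mem_nhds hx] with y hy using h.2 y hy
  simp [_root_.pd, this.fderiv_eq]

lemma S0.mul_left (h : S0 B φ) (hψ : ContDiff ℝ (⊤ : ℕ∞) ψ) : S0 B (fun y => ψ y * φ y) :=
  ⟨hψ.mul h.1, fun x hx => by simp [h.2 x hx]⟩

lemma S0.add (h : S0 B φ) (hψ : S0 B ψ) : S0 B (fun y => φ y + ψ y) :=
  ⟨h.1.add hψ.1, fun x hx => by simp [h.2 x hx, hψ.2 x hx]⟩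

lemma S0.sub (h : S0 B φ) (hψ : S0 B ψ) : S0 B (fun y => φ y - ψ y) :=
  ⟨h.1.sub hψ.1, fun x hx => by simp [h.2 x hx, hψ.2 x hx]⟩

lemma S0.sum {ι : Type} {s : Finset ι} {φ : ι → (Fin d → ℝ) → ℝ} (h : ∀ i ∈ s, S0 B (φ i)) :
    S0 B (fun y => ∑ i ∈ s, φ i y) :=
  ⟨ContDiff.sum fun i hi => (h i hi).1, fun x hx => Finset.sum_eq_zero fun i hi => (h i hi).2 x hx⟩

lemma pd_mul {x : Fin d → ℝ} (hφ : DifferentiableAt ℝ φ x) (hψ : DifferentiableAt ℝ ψ x) (i : Fin d) :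
    pd i (fun y => φ y * ψ y) x = pd i φ x * ψ x + φ x * pd i ψ x := by
  unfold pd
  rw [fderiv_fun_mul hφ hψ]
  simp; ring

lemma S0.diff (h : S0 B φ) (x : Fin d → ℝ) : DifferentiableAt ℝ φ x :=
  h.1.differentiable (by simp) x

lemma w_ibp (hB : IsCompact B) (h : S0 B φ) (i : Fin d) (a : ℝ) :
    ∫ y, pd i φ y * gw (1 / 4) y a = ∫ y, (y i / (2 * a) * φ y) * gw (1 / 4) y a := by
  have hw : ContDiff ℝ (⊤ : ℕ∞) (fun y : Fin d → ℝ => gw (1 / 4) y a) := gw_contDiff _ _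
  have h0 := ibp0 (φ := fun y => φ y * gw (1 / 4) y a) ((h.1.mul hw).of_le (by simp))
    (h.cs hB).mul_right (Pi.single i 1)
  have e : (fun y => fderiv ℝ (fun y => φ y * gw (1 / 4) y a) y (Pi.single i 1)) = fun y =>
      pd i φ y * gw (1 / 4) y a - (y i / (2 * a) * φ y) * gw (1 / 4) y a := by
    funext y
    have := pd_mul (ψ := fun y => gw (1 / 4) y a) (h.diff y) (hw.differentiable (by simp) y) i
    unfold pd at this ⊢
    rw [this, gw_fderiv, gi]; ring
  rw [e, integral_sub ((h.pd hB.isClosed i).int hB (gw_slice_cont _ _))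
    ((h.mul_left (by fun_prop)).int hB (gw_slice_cont _ _))] at h0
  linarith

/-- the Ornstein–Uhlenbeck operator -/
noncomputable def Lop (a : ℝ) (φ : (Fin d → ℝ) → ℝ) (y : Fin d → ℝ) : ℝ :=
  ∑ i, (pd i (pd i φ) y - y i / (2 * a) * pd i φ y)

lemma S0.Lop (hB : IsClosed B) (h : S0 B φ) (a : ℝ) : S0 B (Lop a φ) :=
  S0.sum fun i _ => ((h.pd hB i).pd hB i).sub ((h.pd hB i).mul_left (by fun_prop))

lemma w_L (hB : IsCompact B) (h : S0 B φ) (h' : S0 B ψ) (a : ℝ) :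
    ∫ y, (ψ y * Lop a φ y) * gw (1 / 4) y a = - ∫ y, (∑ i, pd i ψ y * pd i φ y) * gw (1 / 4) y a := by
  have hc := hB.isClosed
  have hw := gw_slice_cont (d := d) (1 / 4) a
  have e1 : ∀ i, S0 B (fun y => ψ y * (pd i (pd i φ) y - y i / (2 * a) * pd i φ y)) := fun i =>
    (((h.pd hc i).pd hc i).sub ((h.pd hc i).mul_left (by fun_prop))).mul_left h'.1
  have e2 : ∀ i, S0 B (fun y => pd i ψ y * pd i φ y) := fun i => (h.pd hc i).mul_left (h'.pd hc i).1
  simp only [Lop, Finset.mul_sum, Finset.sum_mul]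
  rw [integral_finsetSum _ fun i _ => (e1 i).int hB hw, integral_finsetSum _ fun i _ => (e2 i).int hB hw,
    ← Finset.sum_neg_distrib]
  refine Finset.sum_congr rfl fun i _ => ?_
  have k := w_ibp hB ((h.pd hc i).mul_left h'.1) i a
  have e3 : (fun y => pd i (fun y => ψ y * pd i φ y) y * gw (1 / 4) y a) = fun y =>
      (pd i ψ y * pd i φ y) * gw (1 / 4) y a + (ψ y * pd i (pd i φ) y) * gw (1 / 4) y a := by
    funext y
    rw [pd_mul (h'.diff y) ((h.pd hc i).diff y)]; ring
  rw [e3, integral_add ((e2 i).int hB hw) ((((h.pd hc i).pd hc i).mul_left h'.1).int hB hw)] at k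
  have e4 : (fun y => ψ y * (pd i (pd i φ) y - y i / (2 * a) * pd i φ y) * gw (1 / 4) y a) = fun y =>
      (ψ y * pd i (pd i φ) y) * gw (1 / 4) y a - (y i / (2 * a) * (ψ y * pd i φ y)) * gw (1 / 4) y a := by
    funext y; ring
  rw [e4, integral_sub ((((h.pd hc i).pd hc i).mul_left h'.1).int hB hw)
    ((((h.pd hc i).mul_left h'.1).mul_left (by fun_prop)).int hB hw)]
  linarith

/-- jointly smooth function, vanishing for `x` outside `B` -/
def SC (B : Set (Fin d → ℝ)) (g : (Fin d → ℝ) → ℝ → ℝ) : Prop :=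
  ContDiff ℝ (⊤ : ℕ∞) (fun q : (Fin d → ℝ) × ℝ => g q.1 q.2) ∧ ∀ x, x ∉ B → ∀ t, g x t = 0

/-- time derivative -/
noncomputable def dT (g : (Fin d → ℝ) → ℝ → ℝ) : (Fin d → ℝ) → ℝ → ℝ := fun x t => deriv (g x) t

variable {g g' : (Fin d → ℝ) → ℝ → ℝ}

lemma SC.slice (h : SC B g) (t : ℝ) : S0 B (fun y => g y t) :=
  ⟨h.1.comp (g := fun q : (Fin d → ℝ) × ℝ => g q.1 q.2) (f := fun y => (y, t)) (by fun_prop),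
    fun x hx => h.2 x hx t⟩

lemma joint_dX (h : ContDiff ℝ (⊤ : ℕ∞) (fun q : (Fin d → ℝ) × ℝ => g q.1 q.2)) (i : Fin d) :
    ContDiff ℝ (⊤ : ℕ∞) (fun q : (Fin d → ℝ) × ℝ => dX i g q.1 q.2) := by
  have e : (fun q : (Fin d → ℝ) × ℝ => dX i g q.1 q.2) = fun q =>
      fderiv ℝ (fun q : (Fin d → ℝ) × ℝ => g q.1 q.2) q (Pi.single i 1, 0) := by
    funext q
    have h1 := (h.differentiable (by simp) (q.1, q.2)).hasFDerivAt.comp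
      (g := fun q : (Fin d → ℝ) × ℝ => g q.1 q.2) (f := fun y : Fin d → ℝ => (y, q.2)) q.1
      ((hasFDerivAt_id q.1).prodMk (hasFDerivAt_const q.2 q.1))
    simp only [Function.comp_def] at h1
    simp only [dX]
    rw [h1.fderiv]; simp
  rw [e]
  exact (h.fderiv_right (m := (⊤ : ℕ∞)) (by simp)).clm_apply contDiff_const

lemma joint_dT (h : ContDiff ℝ (⊤ : ℕ∞) (fun q : (Fin d → ℝ) × ℝ => g q.1 q.2)) :
    ContDiff ℝ (⊤ : ℕ∞) (fun q : (Fin d → ℝ) × ℝ => dT g q.1 q.2) := by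
  have e : (fun q : (Fin d → ℝ) × ℝ => dT g q.1 q.2) = fun q =>
      fderiv ℝ (fun q : (Fin d → ℝ) × ℝ => g q.1 q.2) q (0, 1) := by
    funext q
    have h1 := (h.differentiable (by simp) (q.1, q.2)).hasFDerivAt.comp_hasDerivAt
      (f := fun s : ℝ => (q.1, s)) q.2
      ((hasDerivAt_const q.2 q.1).prodMk (hasDerivAt_id q.2))
    exact h1.deriv
  rw [e]
  exact (h.fderiv_right (m := (⊤ : ℕ∞)) (by simp)).clm_apply contDiff_const

lemma SC.dX (hB : IsClosed B) (h : SC B g) (i : Fin d) : SC B (dX i g) :=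
  ⟨joint_dX h.1 i, fun x hx t => ((h.slice t).pd hB i).2 x hx⟩

lemma SC.dT (h : SC B g) : SC B (dT g) :=
  ⟨joint_dT h.1, fun x hx t => by
    have : g x = fun _ => 0 := funext fun t => h.2 x hx t
    simp [_root_.dT, this]⟩

lemma SC.mul (h : SC B g) (h' : SC B g') : SC B (fun x t => g x t * g' x t) :=
  ⟨h.1.mul h'.1, fun x hx t => by simp [h.2 x hx t]⟩

lemma SC.sum {ι : Type} {s : Finset ι} {g : ι → (Fin d → ℝ) → ℝ → ℝ} (h : ∀ i ∈ s, SC B (g i)) :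
    SC B (fun y t => ∑ i ∈ s, g i y t) :=
  ⟨ContDiff.sum fun i hi => (h i hi).1, fun x hx t => Finset.sum_eq_zero fun i hi => (h i hi).2 x hx t⟩

lemma SC.t_diff (h : SC B g) (x : Fin d → ℝ) (t : ℝ) : HasDerivAt (g x) (_root_.dT g x t) t := by
  have : ContDiff ℝ (⊤ : ℕ∞) (g x) :=
    h.1.comp (g := fun q : (Fin d → ℝ) × ℝ => g q.1 q.2) (f := fun s => (x, s)) (by fun_prop)
  exact (this.differentiable (by simp) t).hasDerivAt

lemma gw_joint {l : ℝ} : ContinuousOn (fun q : (Fin d → ℝ) × ℝ => gw (1 / 4) q.1 (l - q.2))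
    (univ ×ˢ Iio l) := by
  unfold gw
  refine Real.continuous_exp.comp_continuousOn ?_
  have h1 : ∀ q ∈ (univ : Set (Fin d → ℝ)) ×ˢ Iio l, l - q.2 ≠ 0 := fun q hq => (sub_pos.2 hq.2).ne'
  have hn := nsq_cont (d := d)
  refine ContinuousOn.sub (ContinuousOn.neg (ContinuousOn.div ?_ (by fun_prop) h1))
    (continuousOn_const.mul (ContinuousOn.log (by fun_prop) h1))
  exact (continuous_const.mul (hn.comp continuous_fst)).continuousOn

lemma w_T (hB : IsCompact B) (h : SC B g) {l t : ℝ} (ht : t < l) :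
    HasDerivAt (fun t => ∫ y, g y t * gw (1 / 4) y (l - t))
      (∫ y, (dT g y t - ∑ i, y i / (2 * (l - t)) * dX i g y t) * gw (1 / 4) y (l - t)) t := by
  have hc := hB.isClosed
  have ha : 0 < l - t := sub_pos.2 ht
  have hw := gw_slice_cont (d := d) (1 / 4) (l - t)
  set q : (Fin d → ℝ) → ℝ → ℝ := fun y s => (1 / 4 * nsq y / (l - s) ^ 2 - d / (2 * (l - s))) with hq
  have hd : ∀ y, ∀ s < l, HasDerivAt (fun s => g y s * gw (1 / 4) y (l - s))
      ((dT g y s - q y s * g y s) * gw (1 / 4) y (l - s)) s := by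
    intro y s hs
    have h1 := (gw_hasDerivAt (1 / 4) y (sub_pos.2 hs)).comp_const_sub l s
    refine ((h.t_diff y s).mul h1).congr_deriv ?_
    simp only [hq]; ring
  set ε := (l - t) / 2 with hε
  have hε0 : 0 < ε := by positivity
  have hIcc : ∀ s ∈ Icc (t - ε) (t + ε), s < l := fun s hs => by
    have := hs.2; rw [hε] at this; linarith
  have hcont : ContinuousOn (fun z : (Fin d → ℝ) × ℝ => (dT g z.1 z.2 - q z.1 z.2 * g z.1 z.2) *
      gw (1 / 4) z.1 (l - z.2)) (univ ×ˢ Iio l) := by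
    refine ContinuousOn.mul ?_ gw_joint
    refine h.dT.1.continuous.continuousOn.sub (ContinuousOn.mul ?_ h.1.continuous.continuousOn)
    simp only [hq]
    have h1 : ∀ q ∈ (univ : Set (Fin d → ℝ)) ×ˢ Iio l, l - q.2 ≠ 0 := fun q hq => (sub_pos.2 hq.2).ne'
    have hn := nsq_cont (d := d)
    refine ContinuousOn.sub (ContinuousOn.div ?_ (by fun_prop) fun q hq => pow_ne_zero _ (h1 q hq))
      (ContinuousOn.div continuousOn_const (by fun_prop) fun q hq => mul_ne_zero two_ne_zero (h1 q hq))
    exact (continuous_const.mul (hn.comp continuous_fst)).continuousOn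
  obtain ⟨M, hM⟩ := (hB.prod (isCompact_Icc (a := t - ε) (b := t + ε))).exists_bound_of_continuousOn
    (hcont.mono (prod_mono (subset_univ _) hIcc))
  have main := (hasDerivAt_integral_of_dominated_loc_of_deriv_le (μ := (volume : Measure (Fin d → ℝ)))
    (F := fun s y => g y s * gw (1 / 4) y (l - s))
    (F' := fun s y => (dT g y s - q y s * g y s) * gw (1 / 4) y (l - s))
    (x₀ := t) (s := Icc (t - ε) (t + ε)) (bound := B.indicator fun _ => M)
    (Icc_mem_nhds (by linarith) (by linarith)) ?_ ?_ ?_ ?_ ?_ ?_).2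
  · refine main.congr_deriv ?_
    -- rewrite the weight derivative by parts
    have S1 := (h.dT.slice t)
    have S2 : ∀ i, S0 B (fun y => y i / (2 * (l - t)) * g y t) := fun i => (h.slice t).mul_left (by fun_prop)
    have S3 : ∀ i, S0 B (fun y => y i / (2 * (l - t)) * dX i g y t) := fun i =>
      ((h.dX hc i).slice t).mul_left (by fun_prop)
    have k : ∀ i, ∫ y, (y i / (2 * (l - t)) * dX i g y t) * gw (1 / 4) y (l - t) =
        ∫ y, ((y i ^ 2 / (4 * (l - t) ^ 2) - 1 / (2 * (l - t))) * g y t) * gw (1 / 4) y (l - t) := by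
      intro i
      have k1 := w_ibp hB (S2 i) i (l - t)
      have e3 : (fun y => pd i (fun y => y i / (2 * (l - t)) * g y t) y * gw (1 / 4) y (l - t)) = fun y =>
          (1 / (2 * (l - t)) * g y t) * gw (1 / 4) y (l - t) +
          (y i / (2 * (l - t)) * dX i g y t) * gw (1 / 4) y (l - t) := by
        funext y
        rw [pd_mul (by fun_prop) ((h.slice t).diff y)]
        have : pd i (fun y : Fin d → ℝ => y i / (2 * (l - t))) y = 1 / (2 * (l - t)) := by
          unfold pd
          have := ((hasFDerivAt_apply (𝕜 := ℝ) (F' := fun _ : Fin d => ℝ) i y).mul_const (2 * (l - t))⁻¹).fderiv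
          simp only [div_eq_mul_inv]
          rw [this]; simp
        rw [this]
        simp only [dX, pd]; ring
      rw [e3, integral_add (((h.slice t).mul_left contDiff_const).int hB hw) ((S3 i).int hB hw)] at k1
      have e4 : (fun y : Fin d → ℝ => ((y i ^ 2 / (4 * (l - t) ^ 2) - 1 / (2 * (l - t))) * g y t) * gw (1 / 4) y (l - t)) =
        fun y => (y i / (2 * (l - t)) * (y i / (2 * (l - t)) * g y t)) * gw (1 / 4) y (l - t) -
          (1 / (2 * (l - t)) * g y t) * gw (1 / 4) y (l - t) := by
        funext y; field_simp; ring
      rw [e4, integral_sub (((S2 i).mul_left (by fun_prop)).int hB hw)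
        (((h.slice t).mul_left contDiff_const).int hB hw)]
      linarith
    have S4 : ∀ i, S0 B (fun y => (y i ^ 2 / (4 * (l - t) ^ 2) - 1 / (2 * (l - t))) * g y t) := fun i =>
      (h.slice t).mul_left (by fun_prop)
    have L1 : ∫ y, (dT g y t - ∑ i, y i / (2 * (l - t)) * dX i g y t) * gw (1 / 4) y (l - t) =
        (∫ y, dT g y t * gw (1 / 4) y (l - t)) -
          ∑ i, ∫ y, (y i / (2 * (l - t)) * dX i g y t) * gw (1 / 4) y (l - t) := by
      rw [← integral_finsetSum _ fun i _ => (S3 i).int hB hw, ← integral_sub (S1.int hB hw)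
        (integrable_finsetSum _ fun i _ => (S3 i).int hB hw)]
      simp only [sub_mul, Finset.sum_mul]
    rw [L1]
    simp only [k]
    rw [← integral_finsetSum _ fun i _ => (S4 i).int hB hw, ← integral_sub (S1.int hB hw)
        (integrable_finsetSum _ fun i _ => (S4 i).int hB hw)]
    refine integral_congr_ae (Eventually.of_forall fun y => ?_)
    simp only [hq]
    rw [← Finset.sum_mul, ← Finset.sum_mul, Finset.sum_sub_distrib, ← Finset.sum_div]
    simp only [nsq, Finset.sum_const, Finset.card_univ, Fintype.card_fin, nsmul_eq_mul]
    field_simp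
  · exact Eventually.of_forall fun s => ((h.slice s).1.continuous.mul (gw_slice_cont _ _)).aestronglyMeasurable
  · exact (h.slice t).int hB hw
  · refine Continuous.aestronglyMeasurable ?_
    exact (continuousOn_univ.1 (hcont.comp (f := fun y => (y, t)) (by fun_prop)
      fun y _ => ⟨mem_univ _, ht⟩))
  · refine Eventually.of_forall fun y s hs => ?_
    by_cases hy : y ∈ B
    · rw [indicator_of_mem hy]
      exact hM (y, s) ⟨hy, hs⟩
    · rw [indicator_of_notMem hy]
      simp [h.2 y hy s, h.dT.2 y hy s]
  · rw [integrable_indicator_iff hB.measurableSet]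
    exact integrableOn_const hB.measure_lt_top.ne
  · exact Eventually.of_forall fun y s hs => hd y s (hIcc s hs)

end Weighted


open Set MeasureTheory Filter Topology

section Freq

variable {d : ℕ} {B : Set (Fin d → ℝ)} {z : (Fin d → ℝ) → ℝ → ℝ}

/-- the transport operator -/
noncomputable def Pop (l : ℝ) (z : (Fin d → ℝ) → ℝ → ℝ) (y : Fin d → ℝ) (t : ℝ) : ℝ :=
  dT z y t - ∑ i, y i / (2 * (l - t)) * dX i z y t

noncomputable def Hf (z : (Fin d → ℝ) → ℝ → ℝ) (l t : ℝ) : ℝ :=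
  ∫ y, (z y t * z y t) * gw (1 / 4) y (l - t)

noncomputable def Df (z : (Fin d → ℝ) → ℝ → ℝ) (l t : ℝ) : ℝ :=
  ∫ y, (∑ i, dX i z y t * dX i z y t) * gw (1 / 4) y (l - t)

lemma SC.cx1 (hB : IsClosed B) (h : SC B z) (k : ℕ) : CX False ((univ : Set (Fin d → ℝ)) ×ˢ (univ : Set ℝ)) k z := by
  induction k generalizing z with
  | zero => exact ⟨h.1.continuous.continuousOn, fun h => h.elim⟩
  | succ k ih =>
    exact ⟨h.1.continuous.continuousOn, fun q _ => (h.slice q.2).diff q.1, fun i => ih (h.dX hB i)⟩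

lemma SC.dT_dX (hB : IsClosed B) (h : SC B z) (i : Fin d) (x : Fin d → ℝ) (t : ℝ) :
    _root_.dT (_root_.dX i z) x t = _root_.dX i (_root_.dT z) x t :=
  (time_dx isOpen_univ (h.cx1 hB 1) (h.dT.cx1 hB 1) (fun x _ t => h.t_diff x t) i (mem_univ x) t).deriv

lemma SC.comm (hB : IsClosed B) (h : SC B z) (i j : Fin d) (x : Fin d → ℝ) (t : ℝ) :
    _root_.dX i (_root_.dX j z) x t = _root_.dX j (_root_.dX i z) x t :=
  dX_comm (isOpen_univ.prod isOpen_univ) (h.cx1 hB 2) i j ⟨mem_univ _, mem_univ _⟩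

lemma SC.Pop (hB : IsClosed B) (h : SC B z) (l t : ℝ) : S0 B (fun y => Pop l z y t) :=
  (h.dT.slice t).sub (S0.sum fun i _ => ((h.dX hB i).slice t).mul_left (by fun_prop))

lemma SC.heat (hB : IsClosed B) (h : SC B z) : SC B (heat z) := by
  have h1 := h.dT
  have h2 : SC B (fun y t => ∑ i, _root_.dX i (_root_.dX i z) y t) :=
    SC.sum fun i _ => (h.dX hB i).dX hB i
  refine ⟨h1.1.sub h2.1, fun x hx t => ?_⟩
  have a := h1.2 x hx t
  have b := h2.2 x hx t
  simp only [_root_.dT] at a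
  simp only [_root_.heat, a, b, sub_zero]

lemma P_eq_L (l t : ℝ) (y : Fin d → ℝ) :
    Pop l z y t = Lop (l - t) (fun y => z y t) y + heat z y t := by
  have e1 : heat z y t = dT z y t - ∑ i, pd i (pd i fun y => z y t) y := rfl
  have e2 : Pop l z y t = dT z y t - ∑ i, y i / (2 * (l - t)) * pd i (fun y => z y t) y := rfl
  rw [e1, e2, Lop, Finset.sum_sub_distrib]
  ring

lemma dX_mul_self (hz : SC B z) (i : Fin d) (y : Fin d → ℝ) (t : ℝ) :
    dX i (fun y t => z y t * z y t) y t = 2 * z y t * dX i z y t := by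
  have := pd_mul (i := i) ((hz.slice t).diff y) ((hz.slice t).diff y)
  simp only [dX, pd] at this ⊢
  rw [this]; ring

lemma dT_mul_self (hz : SC B z) (y : Fin d → ℝ) (t : ℝ) :
    dT (fun y t => z y t * z y t) y t = 2 * z y t * dT z y t := by
  have := ((hz.t_diff y t).mul (hz.t_diff y t)).deriv
  refine Eq.trans ?_ (this.trans ?_)
  · rfl
  · ring

lemma H_deriv (hB : IsCompact B) (hz : SC B z) {l t : ℝ} (ht : t < l) :
    HasDerivAt (Hf z l) (2 * ∫ y, (z y t * Pop l z y t) * gw (1 / 4) y (l - t)) t := by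
  refine (w_T hB (hz.mul hz) ht).congr_deriv ?_
  rw [← integral_const_mul]
  refine integral_congr_ae (Eventually.of_forall fun y => ?_)
  simp only [dX_mul_self hz, dT_mul_self hz, Pop]
  have : ∑ i, y i / (2 * (l - t)) * (2 * z y t * dX i z y t) =
      2 * z y t * ∑ i, y i / (2 * (l - t)) * dX i z y t := by
    rw [Finset.mul_sum]; exact Finset.sum_congr rfl fun i _ => by ring
  rw [this]; ring

lemma pd_Pop (hB : IsClosed B) (hz : SC B z) (j : Fin d) (l t : ℝ) (y : Fin d → ℝ) :
    pd j (fun y => Pop l z y t) y = dX j (dT z) y t - dX j z y t / (2 * (l - t))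
      - ∑ i, y i / (2 * (l - t)) * dX i (dX j z) y t := by
  have e1 : ∀ i, HasFDerivAt (fun y : Fin d → ℝ => y i / (2 * (l - t)))
      ((2 * (l - t))⁻¹ • ContinuousLinearMap.proj (R := ℝ) (φ := fun _ : Fin d => ℝ) i) y := fun i => by
    simp only [div_eq_mul_inv]
    exact (hasFDerivAt_apply (𝕜 := ℝ) (F' := fun _ : Fin d => ℝ) i y).mul_const _
  have h1 := (hz.dT.slice t).diff y |>.hasFDerivAt
  have h2 : ∀ i, HasFDerivAt (fun y => dX i z y t) (fderiv ℝ (fun y => dX i z y t) y) y := fun i =>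
    ((hz.dX hB i).slice t).diff y |>.hasFDerivAt
  have h3 := h1.sub (HasFDerivAt.fun_sum (u := Finset.univ) fun i _ => (e1 i).mul (h2 i))
  have h4 : pd j (fun y => Pop l z y t) y = _ := congrArg (fun A => A (Pi.single j 1)) h3.fderiv
  rw [h4]
  have h5 : ∀ i, fderiv ℝ (fun y => dX i z y t) y (Pi.single j 1) = dX i (dX j z) y t := fun i =>
    hz.comm hB j i y t
  have h6 : fderiv ℝ (fun y => dT z y t) y (Pi.single j 1) = dX j (dT z) y t := rfl
  simp [h5, h6, Finset.sum_add_distrib, Pi.single_apply]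
  generalize (∑ x, y x / (2 * (l - t)) * dX x (dX j z) y t) = S
  rw [div_eq_mul_inv, mul_inv]
  ring

lemma D_deriv (hB : IsCompact B) (hz : SC B z) {l t : ℝ} (ht : t < l) :
    HasDerivAt (Df z l) (Df z l t / (l - t) -
      2 * ∫ y, (Pop l z y t * Lop (l - t) (fun y => z y t) y) * gw (1 / 4) y (l - t)) t := by
  have hc := hB.isClosed
  have ha : 0 < l - t := sub_pos.2 ht
  have hw := gw_slice_cont (d := d) (1 / 4) (l - t)
  have hG : SC B (fun y t => ∑ i, dX i z y t * dX i z y t) := SC.sum fun i _ => (hz.dX hc i).mul (hz.dX hc i)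
  refine (w_T hB hG ht).congr_deriv ?_
  rw [w_L hB (hz.slice t) (hz.Pop hc l t)]
  have S1 : S0 B (fun y => ∑ i, pd i (fun y => Pop l z y t) y * pd i (fun y => z y t) y) :=
    S0.sum fun i _ => ((hz.slice t).pd hc i).mul_left ((hz.Pop hc l t).pd hc i).1
  rw [Df, ← integral_div, mul_neg, sub_neg_eq_add, ← integral_const_mul,
    ← integral_add (((hG.slice t).int hB hw).div_const _) ((S1.int hB hw).const_mul _)]
  refine integral_congr_ae (Eventually.of_forall fun y => ?_)
  have t1 : dT (fun y t => ∑ i, dX i z y t * dX i z y t) y t = ∑ j, 2 * dX j z y t * dX j (dT z) y t := by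
    have := (HasDerivAt.fun_sum (u := Finset.univ) fun (j : Fin d) _ =>
      ((hz.dX hc j).mul (hz.dX hc j)).t_diff y t).deriv
    refine Eq.trans ?_ (this.trans (Finset.sum_congr rfl fun j _ => ?_))
    · rfl
    · rw [dT_mul_self (hz.dX hc j), hz.dT_dX hc]
  have t2 : ∀ i, dX i (fun y t => ∑ i, dX i z y t * dX i z y t) y t =
      ∑ j, 2 * dX j z y t * dX i (dX j z) y t := by
    intro i
    have := congrArg (fun A => A (Pi.single i 1)) (HasFDerivAt.fun_sum (u := Finset.univ) fun (j : Fin d) _ =>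
      ((((hz.dX hc j).mul (hz.dX hc j)).slice t).diff y).hasFDerivAt).fderiv
    refine Eq.trans ?_ (this.trans ?_)
    · rfl
    · simp only [sum_apply]
      exact Finset.sum_congr rfl fun j _ => dX_mul_self (hz.dX hc j) i y t
  have t3 : ∀ j, pd j (fun y => z y t) y = dX j z y t := fun j => rfl
  simp only [t1, t2, pd_Pop hc hz, t3]
  simp only [Finset.mul_sum, Finset.sum_mul, Finset.sum_div]
  rw [Finset.sum_comm, ← Finset.sum_sub_distrib, Finset.sum_mul, ← Finset.sum_add_distrib]
  refine Finset.sum_congr rfl fun j _ => ?_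
  have e : ∑ i, y i / (2 * (l - t)) * (2 * dX j z y t * dX i (dX j z) y t) =
      2 * dX j z y t * ∑ i, y i / (2 * (l - t)) * dX i (dX j z) y t := by
    rw [Finset.mul_sum]; exact Finset.sum_congr rfl fun i _ => by ring
  rw [e]
  field_simp
  ring

lemma D_eq (hB : IsCompact B) (hz : SC B z) (l t : ℝ) :
    Df z l t = - ∫ y, (z y t * Lop (l - t) (fun y => z y t) y) * gw (1 / 4) y (l - t) := by
  rw [w_L hB (hz.slice t) (hz.slice t), neg_neg]; rfl

/-- the derivative of the frequency function -/
lemma N_deriv (hB : IsCompact B) (hz : SC B z) {l t : ℝ} (ht : t < l) (hH : 0 < Hf z l t) :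
    ∃ N', HasDerivAt (fun t => (l - t) * Df z l t / Hf z l t) N' t ∧
      N' ≤ (l - t) / (2 * Hf z l t) * ∫ y, (heat z y t * heat z y t) * gw (1 / 4) y (l - t) := by
  have hc := hB.isClosed
  have ha : 0 < l - t := sub_pos.2 ht
  have hw := gw_slice_cont (d := d) (1 / 4) (l - t)
  have h1 := (((hasDerivAt_id t).const_sub l).mul (D_deriv hB hz ht)).div (H_deriv hB hz ht) hH.ne'
  refine ⟨_, h1, ?_⟩
  simp only [id, Pi.mul_apply]
  have Sz := hz.slice t
  have SL := Sz.Lop hc (l - t)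
  have Se := (hz.heat hc).slice t
  have Sq : S0 B (fun y => Lop (l - t) (fun y => z y t) y + 1 / 2 * heat z y t) :=
    SL.add (Se.mul_left contDiff_const)
  set q : (Fin d → ℝ) → ℝ := fun y => Lop (l - t) (fun y => z y t) y + 1 / 2 * heat z y t with hq
  set W : (Fin d → ℝ) → ℝ := fun y => gw (1 / 4) y (l - t) with hW
  have izq : Integrable fun y => (z y t * q y) * W y := (Sq.mul_left Sz.1).int hB hw
  have ize : Integrable fun y => (z y t * heat z y t) * W y := (Se.mul_left Sz.1).int hB hw
  have iqq : Integrable fun y => (q y * q y) * W y := (Sq.mul_left Sq.1).int hB hw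
  have iee : Integrable fun y => (heat z y t * heat z y t) * W y := (Se.mul_left Se.1).int hB hw
  have izz : Integrable fun y => (z y t * z y t) * W y := (Sz.mul_left Sz.1).int hB hw
  have E1 : ∫ y, (z y t * Pop l z y t) * W y = (∫ y, (z y t * q y) * W y) + 1 / 2 * ∫ y, (z y t * heat z y t) * W y := by
    rw [← integral_const_mul, ← integral_add izq (ize.const_mul _)]
    refine integral_congr_ae (Eventually.of_forall fun y => ?_)
    simp only [P_eq_L, hq]; ring
  have E2 : Df z l t = -((∫ y, (z y t * q y) * W y) - 1 / 2 * ∫ y, (z y t * heat z y t) * W y) := by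
    rw [D_eq hB hz, ← integral_const_mul, ← integral_sub izq (ize.const_mul _)]
    congr 1
    refine integral_congr_ae (Eventually.of_forall fun y => ?_)
    simp only [hq]; ring
  have E3 : ∫ y, (Pop l z y t * Lop (l - t) (fun y => z y t) y) * W y =
      (∫ y, (q y * q y) * W y) - 1 / 4 * ∫ y, (heat z y t * heat z y t) * W y := by
    rw [← integral_const_mul, ← integral_sub iqq (iee.const_mul _)]
    refine integral_congr_ae (Eventually.of_forall fun y => ?_)
    simp only [P_eq_L, hq]; ring
  have E4 : (∫ y, (z y t * q y) * W y) ^ 2 ≤ Hf z l t * ∫ y, (q y * q y) * W y := by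
    have hp : 0 ≤ ∫ y, ((Hf z l t * q y - (∫ y, (z y t * q y) * W y) * z y t) ^ 2) * W y :=
      integral_nonneg fun y => mul_nonneg (sq_nonneg _) (gw_pos _ _ _).le
    have e : (fun y => ((Hf z l t * q y - (∫ y, (z y t * q y) * W y) * z y t) ^ 2) * W y) = fun y =>
      (Hf z l t ^ 2 * ((q y * q y) * W y) - 2 * Hf z l t * (∫ y, (z y t * q y) * W y) * ((z y t * q y) * W y))
        + (∫ y, (z y t * q y) * W y) ^ 2 * ((z y t * z y t) * W y) := by funext y; ring
    have i12 : Integrable fun y => Hf z l t ^ 2 * ((q y * q y) * W y) -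
        2 * Hf z l t * (∫ y, (z y t * q y) * W y) * ((z y t * q y) * W y) :=
      (iqq.const_mul _).sub (izq.const_mul _)
    rw [e, integral_add i12 (izz.const_mul _),
      integral_sub (iqq.const_mul _) (izq.const_mul _), integral_const_mul, integral_const_mul,
      integral_const_mul] at hp
    have hHd : ∫ y, (z y t * z y t) * W y = Hf z l t := rfl
    rw [hHd] at hp
    have : 0 ≤ Hf z l t * (Hf z l t * (∫ y, (q y * q y) * W y) - (∫ y, (z y t * q y) * W y) ^ 2) := by
      nlinarith
    have := nonneg_of_mul_nonneg_right this hH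
    linarith
  rw [E1, E3]
  set Zq := ∫ y, (z y t * q y) * W y
  set Ze := ∫ y, (z y t * heat z y t) * W y
  set Q := ∫ y, (q y * q y) * W y
  set Ee := ∫ y, (heat z y t * heat z y t) * W y
  set H := Hf z l t
  set D := Df z l t with hD
  have e5 : ((-1 * D + (l - t) * (D / (l - t) - 2 * (Q - 1 / 4 * Ee))) * H - (l - t) * D * (2 * (Zq + 1 / 2 * Ze))) / H ^ 2
      = (l - t) / (2 * H) * Ee - 2 * (l - t) / H ^ 2 * (H * Q - Zq ^ 2 + 1 / 4 * Ze ^ 2) := by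
    rw [E2]
    field_simp
    ring
  rw [e5]
  have : 0 ≤ 2 * (l - t) / H ^ 2 * (H * Q - Zq ^ 2 + 1 / 4 * Ze ^ 2) := by
    refine mul_nonneg (by positivity) ?_
    nlinarith [sq_nonneg Ze]
  linarith

end Freq


open Set MeasureTheory Filter Topology

section Ucp

variable {d : ℕ} {B : Set (Fin d → ℝ)} {z : (Fin d → ℝ) → ℝ → ℝ}

lemma nsq_pow_gw (M : ℕ) (y : Fin d → ℝ) :
    nsq y ^ M * gw (1 / 4) y 1 ≤ (M.factorial * 8 ^ M) * gw (1 / 8) y 1 := by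
  have h0 := nsq_nonneg y
  have h := Real.pow_div_factorial_le_exp (nsq y / 8) (by positivity) M
  have e : gw (1 / 8) y 1 = Real.exp (nsq y / 8) * gw (1 / 4) y 1 := by
    unfold gw; rw [← Real.exp_add]; congr 1; ring
  rw [e, ← mul_assoc]
  refine mul_le_mul_of_nonneg_right ?_ (gw_pos _ _ _).le
  rw [div_pow, div_div, div_le_iff₀ (by positivity)] at h
  linarith

lemma H_upper (hB : IsCompact B) (hz : SC B z) {A : ℝ} {M : ℕ}
    (h : ∀ y, z y 0 ^ 2 ≤ A * nsq y ^ M) :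
    ∃ A', ∀ l, 0 < l → Hf z l 0 ≤ A' * l ^ M := by
  refine ⟨|A| * ∫ y : Fin d → ℝ, (M.factorial * 8 ^ M) * gw (1 / 8) y 1, fun l hl => ?_⟩
  have e : Hf z l 0 = ∫ y, gw (1 / 4) y l * (z y 0 ^ 2) := by
    unfold Hf
    refine integral_congr_ae (Eventually.of_forall fun y => ?_)
    simp only [sub_zero]; ring
  rw [e, gw_scale_integral _ hl, ← integral_const_mul, ← integral_mul_const]
  refine integral_mono_of_nonneg (Eventually.of_forall fun y => ?_) ?_ (Eventually.of_forall fun y => ?_)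
  · exact mul_nonneg (gw_pos _ _ _).le (sq_nonneg _)
  · exact (((gw_integrable (by norm_num) one_pos).const_mul _).const_mul _).mul_const _
  · have h1 := h (Real.sqrt l • y)
    rw [nsq_smul, Real.sq_sqrt hl.le, mul_pow] at h1
    have h2 := nsq_pow_gw M y
    have h3 := gw_pos (1 / 4) y 1
    have h4 : 0 ≤ l ^ M * nsq y ^ M := mul_nonneg (by positivity) (pow_nonneg (nsq_nonneg y) _)
    calc gw (1 / 4) y 1 * z (Real.sqrt l • y) 0 ^ 2 ≤ gw (1 / 4) y 1 * (|A| * (l ^ M * nsq y ^ M)) := by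
          refine mul_le_mul_of_nonneg_left (h1.trans ?_) h3.le
          exact mul_le_mul_of_nonneg_right (le_abs_self A) h4
      _ = |A| * l ^ M * (nsq y ^ M * gw (1 / 4) y 1) := by ring
      _ ≤ |A| * l ^ M * ((M.factorial * 8 ^ M) * gw (1 / 8) y 1) :=
          mul_le_mul_of_nonneg_left h2 (by positivity)
      _ = _ := by ring

/-- reference Gaussian level -/
noncomputable def Gl (d : ℕ) (R a : ℝ) : ℝ := Real.exp (-(1 / 4 * R / a) - d / 2 * Real.log a)

lemma Gl_pos (R a : ℝ) : 0 < Gl d R a := Real.exp_pos _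

lemma gw_ge_Gl {R a : ℝ} (ha : 0 < a) {y : Fin d → ℝ} (h : nsq y ≤ R) : Gl d R a ≤ gw (1 / 4) y a := by
  unfold Gl gw
  refine Real.exp_le_exp.2 ?_
  have : 1 / 4 * nsq y / a ≤ 1 / 4 * R / a := by gcongr
  linarith

lemma gw_le_Gl {R a : ℝ} (ha : 0 < a) {y : Fin d → ℝ} (h : R ≤ nsq y) : gw (1 / 4) y a ≤ Gl d R a := by
  unfold Gl gw
  refine Real.exp_le_exp.2 ?_
  have : 1 / 4 * R / a ≤ 1 / 4 * nsq y / a := by gcongr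
  linarith

lemma gw_le_Gl' {R a τ : ℝ} (hτ : 0 < τ) (ha : τ ≤ a) (hR : 0 ≤ R) (y : Fin d → ℝ) :
    gw (1 / 4) y a ≤ Real.exp (1 / 4 * R / τ) * Gl d R a := by
  unfold Gl gw
  rw [← Real.exp_add]
  refine Real.exp_le_exp.2 ?_
  have h1 : 1 / 4 * R / a ≤ 1 / 4 * R / τ := by gcongr
  have h2 : 0 ≤ 1 / 4 * nsq y / a := div_nonneg (mul_nonneg (by norm_num) (nsq_nonneg y)) (hτ.trans_le ha).le
  linarith

lemma int_le_of_supp (hB : IsCompact B) {φ : (Fin d → ℝ) → ℝ} {c : ℝ} (hφ : Integrable φ)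
    (h1 : ∀ y ∈ B, φ y ≤ c) (h2 : ∀ y, y ∉ B → φ y ≤ 0) : ∫ y, φ y ≤ c * volume.real B := by
  have : ∫ y, φ y ≤ ∫ y, B.indicator (fun _ => c) y := by
    refine integral_mono hφ ((integrable_indicator_iff hB.measurableSet).2
      (integrableOn_const hB.measure_lt_top.ne)) fun y => ?_
    by_cases hy : y ∈ B
    · simpa [hy] using h1 y hy
    · simpa [hy] using h2 y hy
  refine this.trans (le_of_eq ?_)
  rw [integral_indicator hB.measurableSet]
  simp [mul_comm]

lemma int_ge_of_sub {U : Set (Fin d → ℝ)} (hU : MeasurableSet U) (hf : volume U ≠ ⊤)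
    {φ : (Fin d → ℝ) → ℝ} {c : ℝ} (hφ : Integrable φ)
    (h1 : ∀ y ∈ U, c ≤ φ y) (h2 : ∀ y, 0 ≤ φ y) : c * volume.real U ≤ ∫ y, φ y := by
  have : ∫ y, U.indicator (fun _ => c) y ≤ ∫ y, φ y := by
    refine integral_mono ((integrable_indicator_iff hU).2
      (integrableOn_const hf)) hφ fun y => ?_
    by_cases hy : y ∈ U
    · simpa [hy] using h1 y hy
    · simpa [hy] using h2 y
  refine le_trans (le_of_eq ?_) this
  rw [integral_indicator hU]
  simp [mul_comm]

lemma ucp_core (hB : IsCompact B) (hz : SC B z) {R C K : ℝ} (hR : 0 ≤ R) (hC : 0 ≤ C) (hK : 0 ≤ K)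
    (hE : ∀ y, ∀ t ∈ Icc (-1 : ℝ) 0, heat z y t * heat z y t ≤
      C * (z y t * z y t + ∑ i, dX i z y t * dX i z y t) + (if R ≤ nsq y then K else 0))
    (hflat : ∀ M : ℕ, ∃ A, ∀ y, z y 0 ^ 2 ≤ A * nsq y ^ M)
    {y₀ : Fin d → ℝ} (hy₀ : nsq y₀ < R) : z y₀ 0 = 0 := by
  by_contra hne
  have hc := hB.isClosed
  -- neighbourhood where z is bounded below
  obtain ⟨δ, hδ, U, hUm, hUf, hUp, τ, hτ, hτ1, hUz, hUR⟩ : ∃ δ > 0, ∃ U : Set (Fin d → ℝ), MeasurableSet U ∧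
      volume U ≠ ⊤ ∧ 0 < volume.real U ∧ ∃ τ > 0, τ ≤ (1:ℝ) ∧ (∀ y ∈ U, ∀ t ∈ Icc (-τ) 0, δ ≤ z y t * z y t) ∧
      ∀ y ∈ U, nsq y ≤ R := by
    have hzc : Continuous fun q : (Fin d → ℝ) × ℝ => z q.1 q.2 * z q.1 q.2 := hz.1.continuous.mul hz.1.continuous
    have hpos : 0 < z y₀ 0 * z y₀ 0 := mul_self_pos.2 hne
    have ev1 : ∀ᶠ q in 𝓝 (y₀, (0:ℝ)), z y₀ 0 * z y₀ 0 / 2 < z q.1 q.2 * z q.1 q.2 :=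
      hzc.continuousAt.eventually (lt_mem_nhds (by simp only; linarith))
    have ev2 : ∀ᶠ q : (Fin d → ℝ) × ℝ in 𝓝 (y₀, (0:ℝ)), nsq q.1 < R :=
      (nsq_cont.comp continuous_fst).continuousAt.eventually (gt_mem_nhds hy₀)
    obtain ⟨ε, ε0, hε⟩ := Metric.eventually_nhds_iff_ball.1 (ev1.and ev2)
    have hin : ∀ y ∈ Metric.ball y₀ ε, ∀ t ∈ Icc (-(min (ε / 2) 1)) 0, (y, t) ∈ Metric.ball (y₀, (0:ℝ)) ε := by
      intro y hy t ht
      rw [← ball_prod_same]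
      refine ⟨hy, ?_⟩
      rw [mem_ball_zero_iff, Real.norm_eq_abs, abs_lt]
      have := min_le_left (ε / 2) 1
      constructor <;> linarith [ht.1, ht.2]
    have hτ0 : 0 < min (ε / 2) 1 := by positivity
    refine ⟨_, half_pos hpos, Metric.ball y₀ ε, measurableSet_ball, measure_ball_lt_top.ne,
      ENNReal.toReal_pos (Metric.measure_ball_pos _ _ ε0).ne' measure_ball_lt_top.ne, _, hτ0, min_le_right _ _,
      fun y hy t ht => (hε _ (hin y hy t ht)).1.le,
      fun y hy => (hε _ (hin y hy 0 ⟨by linarith, le_rfl⟩)).2.le⟩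
  set m := volume.real U with hm
  set V := volume.real B with hV
  have hV0 : 0 ≤ V := measureReal_nonneg
  set C1 := C + K * V / (δ * m) with hC1
  have hC10 : 0 ≤ C1 := by positivity
  have hDnn : ∀ l t, 0 ≤ Df z l t := fun l t => integral_nonneg fun y =>
    mul_nonneg (Finset.sum_nonneg fun i _ => mul_self_nonneg _) (gw_pos _ _ _).le
  have SD : ∀ t, S0 B (fun y => ∑ i, dX i z y t * dX i z y t) := fun t =>
    (SC.sum fun i _ => (hz.dX hc i).mul (hz.dX hc i)).slice t
  have hHlow : ∀ l t, t ∈ Icc (-τ) 0 → t < l → δ * m * Gl d R (l - t) ≤ Hf z l t := by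
    intro l t ht hl
    have := int_ge_of_sub hUm hUf (c := δ * Gl d R (l - t))
      (((hz.mul hz).slice t).int hB (gw_slice_cont (1 / 4) (l - t))) (fun y hy =>
        mul_le_mul (hUz y hy t ht) (gw_ge_Gl (sub_pos.2 hl) (hUR y hy)) (Gl_pos _ _).le (mul_self_nonneg _))
      (fun y => mul_nonneg (mul_self_nonneg _) (gw_pos _ _ _).le)
    unfold Hf
    rw [← hm] at this
    linarith
  have hHpos : ∀ l t, t ∈ Icc (-τ) 0 → t < l → 0 < Hf z l t := fun l t ht hl =>
    lt_of_lt_of_le (mul_pos (mul_pos hδ hUp) (Gl_pos _ _)) (hHlow l t ht hl)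
  have hEe : ∀ l t, t ∈ Icc (-τ) 0 → t < l →
      ∫ y, (heat z y t * heat z y t) * gw (1 / 4) y (l - t) ≤ C1 * (Hf z l t + Df z l t) := by
    intro l t ht hl
    have ha := sub_pos.2 hl
    have hw := gw_slice_cont (d := d) (1 / 4) (l - t)
    have i1 := (((hz.heat hc).mul (hz.heat hc)).slice t).int hB hw
    have i2 := ((hz.mul hz).slice t).int hB hw
    have i3 := (SD t).int hB hw
    have i23 : Integrable fun y => C * (z y t * z y t * gw (1 / 4) y (l - t) +
        (∑ i, dX i z y t * dX i z y t) * gw (1 / 4) y (l - t)) := (i2.add i3).const_mul C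
    have h1 : ∫ y, ((heat z y t * heat z y t) * gw (1 / 4) y (l - t) -
        C * (z y t * z y t * gw (1 / 4) y (l - t) +
        (∑ i, dX i z y t * dX i z y t) * gw (1 / 4) y (l - t))) ≤ (K * Gl d R (l - t)) * V := by
      refine int_le_of_supp hB (i1.sub i23) (fun y _ => ?_) (fun y hy => ?_)
      · have hE' := hE y t ⟨by linarith [ht.1], ht.2⟩
        have hg := gw_pos (1 / 4) y (l - t)
        have h2 := mul_le_mul_of_nonneg_right hE' hg.le
        have h3 : (if R ≤ nsq y then K else 0) * gw (1 / 4) y (l - t) ≤ K * Gl d R (l - t) := by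
          split_ifs with hn
          · exact mul_le_mul_of_nonneg_left (gw_le_Gl ha hn) hK
          · have := (Gl_pos (d := d) R (l - t)).le
            simp only [zero_mul]; positivity
        rw [add_mul] at h2
        linarith
      · have a1 := (hz.heat hc).2 y hy t
        have a2 := hz.2 y hy t
        have a3 := (SD t).2 y hy
        simp only at a3
        rw [a1, a2, a3]; simp
    rw [integral_sub i1 i23, integral_const_mul, integral_add i2 i3] at h1
    have h4 := hHlow l t ht hl
    have h5 : K * Gl d R (l - t) * V ≤ K * V / (δ * m) * Hf z l t := by
      rw [div_mul_eq_mul_div, le_div_iff₀ (by positivity)]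
      have := mul_le_mul_of_nonneg_left h4 (mul_nonneg hK hV0)
      linarith
    have h6 : 0 ≤ K * V / (δ * m) * Df z l t := mul_nonneg (by positivity) (hDnn l t)
    have e1 : ∫ y, z y t * z y t * gw (1 / 4) y (l - t) = Hf z l t := rfl
    have e2 : ∫ y, (∑ i, dX i z y t * dX i z y t) * gw (1 / 4) y (l - t) = Df z l t := rfl
    rw [e1, e2] at h1
    rw [hC1]
    linarith
  -- bound of the frequency at the initial time
  obtain ⟨S, hS⟩ : ∃ S, ∀ y, ∑ i, dX i z y (-τ) * dX i z y (-τ) ≤ S := by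
    obtain ⟨S, hS⟩ := (SD (-τ)).1.continuous.bounded_above_of_compact_support ((SD (-τ)).cs hB)
    exact ⟨S, fun y => (le_abs_self _).trans (hS y)⟩
  have hS0 : 0 ≤ S := le_trans (Finset.sum_nonneg fun i _ => mul_self_nonneg _) (hS 0)
  set N : ℝ → ℝ → ℝ := fun l t => (l - t) * Df z l t / Hf z l t with hN
  set N0 := 2 * (S * Real.exp (1 / 4 * R / τ) * V) / (δ * m) with hN0
  have hN00 : 0 ≤ N0 := by positivity
  have hNinit : ∀ l ∈ Ioc (0:ℝ) 1, N l (-τ) ≤ N0 := by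
    intro l hl
    have ha : τ ≤ l - -τ := by linarith [hl.1]
    have hl' : -τ < l := by linarith [hl.1]
    have h1 : Df z l (-τ) ≤ (S * (Real.exp (1 / 4 * R / τ) * Gl d R (l - -τ))) * V := by
      refine int_le_of_supp hB ((SD (-τ)).int hB (gw_slice_cont _ _)) (fun y _ => ?_) (fun y hy => ?_)
      · exact mul_le_mul (hS y) (gw_le_Gl' hτ ha hR y) (gw_pos _ _ _).le hS0
      · have a3 := (SD (-τ)).2 y hy
        simp only at a3
        rw [a3]; simp
    have h2 := hHlow l (-τ) ⟨le_rfl, by linarith⟩ hl'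
    have h3 := hHpos l (-τ) ⟨le_rfl, by linarith⟩ hl'
    simp only [hN]
    rw [div_le_iff₀ h3]
    have h4 : N0 * (δ * m * Gl d R (l - -τ)) ≤ N0 * Hf z l (-τ) := mul_le_mul_of_nonneg_left h2 hN00
    have h5 : N0 * (δ * m * Gl d R (l - -τ)) = 2 * (S * Real.exp (1 / 4 * R / τ) * V) * Gl d R (l - -τ) := by
      rw [hN0]; field_simp
    have h6 : (l - -τ) * Df z l (-τ) ≤ 2 * Df z l (-τ) :=
      mul_le_mul_of_nonneg_right (by linarith [hl.2]) (hDnn _ _)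
    linarith
  have hNnn : ∀ l t, t ∈ Icc (-τ) 0 → t < l → 0 ≤ N l t := fun l t ht hl =>
    div_nonneg (mul_nonneg (sub_pos.2 hl).le (hDnn _ _)) (hHpos l t ht hl).le
  set K0 := (1 + N0) * Real.exp (C1 * τ) with hK0
  have hNbd : ∀ l ∈ Ioc (0:ℝ) 1, ∀ t ∈ Icc (-τ) 0, N l t ≤ K0 := by
    intro l hl t ht
    have hlt : ∀ s ∈ Icc (-τ) (0:ℝ), s < l := fun s hs => lt_of_le_of_lt hs.2 hl.1
    have hd : ∀ s ∈ Icc (-τ) (0:ℝ), ∃ N', HasDerivAt (N l) N' s ∧ N' ≤ C1 * (1 + N l s) := by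
      intro s hs
      obtain ⟨N', h1, h2⟩ := N_deriv hB hz (hlt s hs) (hHpos l s hs (hlt s hs))
      refine ⟨N', h1, h2.trans ?_⟩
      have hH := hHpos l s hs (hlt s hs)
      have ha := sub_pos.2 (hlt s hs)
      have ha2 : l - s ≤ 2 := by linarith [hl.2, hs.1]
      have h3 := mul_le_mul_of_nonneg_left (hEe l s hs (hlt s hs)) (show 0 ≤ (l - s) / (2 * Hf z l s) by positivity)
      refine h3.trans ?_
      have e : (l - s) / (2 * Hf z l s) * (C1 * (Hf z l s + Df z l s)) = C1 * ((l - s) / 2 + N l s / 2) := by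
        simp only [hN]; field_simp
      rw [e]
      refine mul_le_mul_of_nonneg_left ?_ hC10
      have := hNnn l s hs (hlt s hs)
      linarith
    choose! N' hN1 hN2 using hd
    have hd2 : ∀ s ∈ Icc (-τ) (0:ℝ), HasDerivAt (fun s => (1 + N l s) * Real.exp (-C1 * s))
        (N' s * Real.exp (-C1 * s) + (1 + N l s) * (Real.exp (-C1 * s) * -C1)) s := by
      intro s hs
      have h1 : HasDerivAt (fun s => Real.exp (-C1 * s)) (Real.exp (-C1 * s) * -C1) s := by
        have := ((hasDerivAt_id s).const_mul (-C1)).exp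
        simpa using this
      exact ((hN1 s hs).const_add 1).mul h1
    have hanti : AntitoneOn (fun s => (1 + N l s) * Real.exp (-C1 * s)) (Icc (-τ) 0) := by
      refine antitoneOn_of_deriv_nonpos (convex_Icc _ _)
        (fun s hs => (hd2 s hs).continuousAt.continuousWithinAt)
        (fun s hs => (hd2 s (interior_subset hs)).differentiableAt.differentiableWithinAt) fun s hs => ?_
      rw [(hd2 s (interior_subset hs)).deriv]
      have := hN2 s (interior_subset hs)
      have he := Real.exp_pos (-C1 * s)
      nlinarith
    have h1 := hanti ⟨le_rfl, by linarith⟩ ht ht.1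
    simp only at h1
    have h2 : 1 ≤ Real.exp (-C1 * t) := Real.one_le_exp (by nlinarith [ht.2])
    have h3 := hNnn l t ht (hlt t ht)
    have h4 : (1 + N l (-τ)) * Real.exp (-C1 * -τ) ≤ K0 := by
      rw [hK0]
      have e : -C1 * -τ = C1 * τ := by ring
      rw [e]
      exact mul_le_mul_of_nonneg_right (by linarith [hNinit l hl]) (Real.exp_pos _).le
    nlinarith
  have hK00 : 0 ≤ K0 := by positivity
  -- lower bound for H at time zero
  obtain ⟨k, hk⟩ := exists_nat_ge (2 * (1 + C1) + (2 + C1) * K0)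
  set c2 := Real.log (δ * m * Real.exp (-(1 / 4 * R / τ) - d / 2 * Real.log 2)) - k * Real.log 2 with hc2
  have hlow : ∀ l ∈ Ioc (0:ℝ) 1, c2 + k * Real.log l ≤ Real.log (Hf z l 0) := by
    intro l hl
    have hlt : ∀ s ∈ Icc (-τ) (0:ℝ), s < l := fun s hs => lt_of_le_of_lt hs.2 hl.1
    have hd : ∀ s ∈ Icc (-τ) (0:ℝ), HasDerivAt (fun s => Real.log (Hf z l s) - k * Real.log (l - s))
        ((2 * ∫ y, (z y s * Pop l z y s) * gw (1 / 4) y (l - s)) / Hf z l s - k * (-1 / (l - s))) s := by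
      intro s hs
      have h1 := (H_deriv hB hz (hlt s hs)).log (hHpos l s hs (hlt s hs)).ne'
      have h2 := (((hasDerivAt_id s).const_sub l).log (sub_pos.2 (hlt s hs)).ne').const_mul (k : ℝ)
      exact h1.sub h2
    have hmono : MonotoneOn (fun s => Real.log (Hf z l s) - k * Real.log (l - s)) (Icc (-τ) 0) := by
      refine monotoneOn_of_deriv_nonneg (convex_Icc _ _)
        (fun s hs => (hd s hs).continuousAt.continuousWithinAt)
        (fun s hs => (hd s (interior_subset hs)).differentiableAt.differentiableWithinAt) fun s hs => ?_
      have hs := interior_subset hs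
      rw [(hd s hs).deriv]
      have hw := gw_slice_cont (d := d) (1 / 4) (l - s)
      have hH := hHpos l s hs (hlt s hs)
      have ha := sub_pos.2 (hlt s hs)
      have ha2 : l - s ≤ 2 := by linarith [hl.2, hs.1]
      have i0 := ((((hz.slice s).Lop hc (l - s)).mul_left (hz.slice s).1)).int hB hw
      have i1 := (((hz.heat hc).slice s).mul_left (hz.slice s).1).int hB hw
      have i2 := ((hz.mul hz).slice s).int hB hw
      have i3 := (((hz.heat hc).mul (hz.heat hc)).slice s).int hB hw
      have e1 : ∫ y, (z y s * Pop l z y s) * gw (1 / 4) y (l - s) = - Df z l s +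
          ∫ y, (z y s * heat z y s) * gw (1 / 4) y (l - s) := by
        rw [D_eq hB hz, neg_neg, ← integral_add i0 i1]
        refine integral_congr_ae (Eventually.of_forall fun y => ?_)
        simp only [P_eq_L]; ring
      have i23 : Integrable fun y => -((z y s * z y s) * gw (1 / 4) y (l - s) +
          (heat z y s * heat z y s) * gw (1 / 4) y (l - s)) := (i2.add i3).neg
      have e2 : -(Hf z l s + ∫ y, (heat z y s * heat z y s) * gw (1 / 4) y (l - s)) ≤
          2 * ∫ y, (z y s * heat z y s) * gw (1 / 4) y (l - s) := by
        rw [Hf, ← integral_add i2 i3, ← integral_neg, ← integral_const_mul]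
        refine integral_mono i23 (i1.const_mul 2) fun y => ?_
        have hg := gw_pos (1 / 4) y (l - s)
        have := mul_nonneg (mul_self_nonneg (z y s + heat z y s)) hg.le
        simp only
        nlinarith
      have e3 := hEe l s hs (hlt s hs)
      have e4 : Df z l s ≤ K0 / (l - s) * Hf z l s := by
        have := hNbd l hl s hs
        simp only [hN] at this
        rw [div_le_iff₀ hH] at this
        rw [div_mul_eq_mul_div, le_div_iff₀ ha]; linarith
      have e5 : Hf z l s ≤ 2 / (l - s) * Hf z l s := by
        have : 1 ≤ 2 / (l - s) := by rw [le_div_iff₀ ha]; linarith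
        nlinarith
      have e6 : -(k / (l - s) * Hf z l s) ≤ 2 * ∫ y, (z y s * Pop l z y s) * gw (1 / 4) y (l - s) := by
        have f1 : (1 + C1) * Hf z l s ≤ (1 + C1) * (2 / (l - s) * Hf z l s) :=
          mul_le_mul_of_nonneg_left e5 (by positivity)
        have f2 : (2 + C1) * Df z l s ≤ (2 + C1) * (K0 / (l - s) * Hf z l s) :=
          mul_le_mul_of_nonneg_left e4 (by positivity)
        have f3 : (2 * (1 + C1) + (2 + C1) * K0) * (1 / (l - s) * Hf z l s) ≤ k * (1 / (l - s) * Hf z l s) :=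
          mul_le_mul_of_nonneg_right hk (by positivity)
        have f4 : k / (l - s) * Hf z l s = k * (1 / (l - s) * Hf z l s) := by ring
        have f5 : (2 * (1 + C1) + (2 + C1) * K0) * (1 / (l - s) * Hf z l s) =
          (1 + C1) * (2 / (l - s) * Hf z l s) + (2 + C1) * (K0 / (l - s) * Hf z l s) := by ring
        rw [f4, e1]
        linarith
      have e7 : -(k / (l - s)) ≤ (2 * ∫ y, (z y s * Pop l z y s) * gw (1 / 4) y (l - s)) / Hf z l s := by
        rw [le_div_iff₀ hH]; linarith
      have e8 : (k : ℝ) * (-1 / (l - s)) = -(k / (l - s)) := by ring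
      rw [e8]; linarith
    have h1 := hmono ⟨le_rfl, by linarith⟩ ⟨by linarith, le_rfl⟩ (by linarith : -τ ≤ 0)
    simp only [sub_zero] at h1
    have hτl : -τ < l := by linarith [hl.1]
    have ha : τ ≤ l - -τ := by linarith [hl.1]
    have h2 : Real.log (l - -τ) ≤ Real.log 2 := Real.log_le_log (by linarith) (by linarith [hl.2])
    have h3 : Real.log (δ * m * Real.exp (-(1 / 4 * R / τ) - d / 2 * Real.log 2)) ≤ Real.log (Hf z l (-τ)) := by
      refine Real.log_le_log (by positivity) (le_trans ?_ (hHlow l (-τ) ⟨le_rfl, by linarith⟩ hτl))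
      refine mul_le_mul_of_nonneg_left (Real.exp_le_exp.2 ?_) (by positivity)
      have f1 : 1 / 4 * R / (l - -τ) ≤ 1 / 4 * R / τ := by gcongr
      have f2 : (d : ℝ) / 2 * Real.log (l - -τ) ≤ d / 2 * Real.log 2 := by gcongr
      linarith
    have h4 : (k : ℝ) * Real.log (l - -τ) ≤ k * Real.log 2 := by gcongr
    rw [hc2]; linarith
  obtain ⟨A, hA⟩ := hflat (k + 1)
  obtain ⟨A', hA'⟩ := H_upper hB hz hA
  have hfin : ∀ l ∈ Ioc (0:ℝ) 1, Real.exp c2 ≤ A' * l := by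
    intro l hl
    have h1 := hlow l hl
    have h2 := hA' l hl.1
    have hp := hHpos l 0 ⟨by linarith, le_rfl⟩ hl.1
    have h3 := Real.exp_le_exp.2 h1
    rw [Real.exp_log hp, Real.exp_add, mul_comm (k : ℝ), Real.exp_mul, Real.exp_log hl.1,
      Real.rpow_natCast] at h3
    have hlk : 0 < l ^ k := pow_pos hl.1 k
    have h4 : Real.exp c2 * l ^ k ≤ (A' * l) * l ^ k := by
      refine (h3.trans h2).trans (le_of_eq ?_); ring
    exact le_of_mul_le_mul_right h4 hlk
  have hlim : Tendsto (fun l : ℝ => A' * l) (𝓝[>] 0) (𝓝 0) := by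
    have : Tendsto (fun l : ℝ => A' * l) (𝓝 0) (𝓝 (A' * 0)) := (continuous_const.mul continuous_id).tendsto 0
    rw [mul_zero] at this
    exact this.mono_left nhdsWithin_le_nhds
  have := ge_of_tendsto hlim (by
    filter_upwards [Ioc_mem_nhdsGT (zero_lt_one' ℝ)] with l hl using hfin l hl)
  exact absurd (Real.exp_pos c2) (not_lt.2 this)

end Ucp


open Set MeasureTheory Filter Topology

section Flat

variable {d : ℕ}

/-- directional derivative of a vector valued function -/
noncomputable def pv {F : Type} [NormedAddCommGroup F] [NormedSpace ℝ F] (i : Fin d)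
    (g : (Fin d → ℝ) → F) (x : Fin d → ℝ) : F := fderiv ℝ g x (Pi.single i 1)

/-- all derivatives of order less than `k` vanish at `x` -/
def FlatK {F : Type} [NormedAddCommGroup F] [NormedSpace ℝ F] :
    ℕ → ((Fin d → ℝ) → F) → (Fin d → ℝ) → Prop
  | 0, _, _ => True
  | k + 1, g, x => g x = 0 ∧ ∀ i, FlatK k (pv i g) x

variable {F G H X : Type} [NormedAddCommGroup F] [NormedSpace ℝ F]
  [NormedAddCommGroup G] [NormedSpace ℝ G] [NormedAddCommGroup H] [NormedSpace ℝ H]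
  [NormedAddCommGroup X] [NormedSpace ℝ X]
variable {U : Set (Fin d → ℝ)} {x : Fin d → ℝ} {k : ℕ}

lemma pv_congr {g g' : (Fin d → ℝ) → F} (h : g =ᶠ[𝓝 x] g') (i : Fin d) :
    pv i g =ᶠ[𝓝 x] pv i g' := by
  filter_upwards [h.fderiv (𝕜 := ℝ)] with y hy
  simp only [pv, hy]

lemma FlatK.congr {g g' : (Fin d → ℝ) → F} (hg : FlatK k g x) (h : g =ᶠ[𝓝 x] g') : FlatK k g' x := by
  induction k generalizing g g' with
  | zero => trivial
  | succ k ih => exact ⟨h.eq_of_nhds ▸ hg.1, fun i => ih (hg.2 i) (pv_congr h i)⟩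

lemma FlatK.congr_on {g g' : (Fin d → ℝ) → F} (hU : IsOpen U) (hx : x ∈ U) (hg : FlatK k g x)
    (h : ∀ y ∈ U, g y = g' y) : FlatK k g' x :=
  hg.congr (by filter_upwards [hU.mem_nhds hx] with y hy using h y hy)

lemma FlatK.pred {g : (Fin d → ℝ) → F} (hg : FlatK (k + 1) g x) : FlatK k g x := by
  induction k generalizing g with
  | zero => trivial
  | succ k ih => exact ⟨hg.1, fun i => ih (hg.2 i)⟩

lemma FlatK.mono {g : (Fin d → ℝ) → F} {j : ℕ} (hj : j ≤ k) (hg : FlatK k g x) : FlatK j g x := by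
  induction k generalizing j with
  | zero => obtain rfl : j = 0 := by omega
            trivial
  | succ k ih =>
    rcases Nat.lt_or_ge k j with h | h
    · obtain rfl : j = k + 1 := by omega
      exact hg
    · exact ih h hg.pred

lemma smooth_pv (hU : IsOpen U) {g : (Fin d → ℝ) → F} (hg : ContDiffOn ℝ (⊤ : ℕ∞) g U) (i : Fin d) :
    ContDiffOn ℝ (⊤ : ℕ∞) (pv i g) U :=
  (hg.fderiv_of_isOpen hU (m := (⊤ : ℕ∞)) (by simp)).clm_apply contDiffOn_const

lemma smooth_diff (hU : IsOpen U) {g : (Fin d → ℝ) → F} (hg : ContDiffOn ℝ (⊤ : ℕ∞) g U) (hx : x ∈ U) :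
    DifferentiableAt ℝ g x := (hg.contDiffAt (hU.mem_nhds hx)).differentiableAt (by simp)

lemma FlatK.add (hU : IsOpen U) (hx : x ∈ U) {g g' : (Fin d → ℝ) → F} (hg : ContDiffOn ℝ (⊤ : ℕ∞) g U)
    (hg' : ContDiffOn ℝ (⊤ : ℕ∞) g' U) (h : FlatK k g x) (h' : FlatK k g' x) :
    FlatK k (fun y => g y + g' y) x := by
  induction k generalizing g g' with
  | zero => trivial
  | succ k ih =>
    refine ⟨by simp [h.1, h'.1], fun i => ?_⟩
    refine (ih (smooth_pv hU hg i) (smooth_pv hU hg' i) (h.2 i) (h'.2 i)).congr_on hU hx fun y hy => ?_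
    simp only [pv]
    rw [fderiv_fun_add (smooth_diff hU hg hy) (smooth_diff hU hg' hy)]; rfl

lemma FlatK.bilin (hU : IsOpen U) (hx : x ∈ U) (B : F →L[ℝ] G →L[ℝ] H) {g : (Fin d → ℝ) → F}
    {g' : (Fin d → ℝ) → G} (hg : ContDiffOn ℝ (⊤ : ℕ∞) g U)
    (hg' : ContDiffOn ℝ (⊤ : ℕ∞) g' U) (h : FlatK k g x) :
    FlatK k (fun y => B (g y) (g' y)) x := by
  induction k generalizing g g' with
  | zero => trivial
  | succ k ih =>
    refine ⟨by simp [h.1], fun i => ?_⟩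
    have a := ih (smooth_pv hU hg i) hg' (h.2 i)
    have b := ih hg (smooth_pv hU hg' i) h.pred
    have sm : ∀ {g : (Fin d → ℝ) → F} {g' : (Fin d → ℝ) → G}, ContDiffOn ℝ (⊤ : ℕ∞) g U →
        ContDiffOn ℝ (⊤ : ℕ∞) g' U → ContDiffOn ℝ (⊤ : ℕ∞) (fun y => B (g y) (g' y)) U := fun h1 h2 =>
      (B.contDiff.comp_contDiffOn h1).clm_apply h2
    refine (FlatK.add hU hx (sm (smooth_pv hU hg i) hg') (sm hg (smooth_pv hU hg' i)) a b).congr_on hU hx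
      fun y hy => ?_
    simp only [pv]
    rw [((B.hasFDerivAt_of_bilinear (smooth_diff hU hg hy).hasFDerivAt
      (smooth_diff hU hg' hy).hasFDerivAt)).fderiv]
    simp [add_comm]

lemma FlatK.bilin' (hU : IsOpen U) (hx : x ∈ U) (B : F →L[ℝ] G →L[ℝ] H) {g : (Fin d → ℝ) → F}
    {g' : (Fin d → ℝ) → G} (hg : ContDiffOn ℝ (⊤ : ℕ∞) g U)
    (hg' : ContDiffOn ℝ (⊤ : ℕ∞) g' U) (h : FlatK k g' x) :
    FlatK k (fun y => B (g y) (g' y)) x :=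
  (FlatK.bilin hU hx B.flip hg' hg h)

lemma FlatK.comp (hU : IsOpen U) (hx : x ∈ U) {S : Set X} (hS : IsOpen S) {f : X → F}
    (hf : ContDiffOn ℝ (⊤ : ℕ∞) f S) {φ ψ : (Fin d → ℝ) → X} (hφ : ContDiffOn ℝ (⊤ : ℕ∞) φ U)
    (hψ : ContDiffOn ℝ (⊤ : ℕ∞) ψ U) (mφ : ∀ y ∈ U, φ y ∈ S) (mψ : ∀ y ∈ U, ψ y ∈ S)
    (h : FlatK k (fun y => φ y - ψ y) x) : FlatK k (fun y => f (φ y) - f (ψ y)) x := by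
  induction k generalizing F with
  | zero => trivial
  | succ k ih =>
    refine ⟨by simp [sub_eq_zero.1 h.1], fun i => ?_⟩
    have hf' : ContDiffOn ℝ (⊤ : ℕ∞) (fderiv ℝ f) S := hf.fderiv_of_isOpen hS (by simp)
    have a := ih hf' h.pred
    have s1 : ContDiffOn ℝ (⊤ : ℕ∞) (fun y => fderiv ℝ f (φ y)) U := hf'.comp hφ mφ
    have s2 : ContDiffOn ℝ (⊤ : ℕ∞) (fun y => fderiv ℝ f (ψ y)) U := hf'.comp hψ mψ
    have a' := FlatK.bilin hU hx (ContinuousLinearMap.id ℝ (X →L[ℝ] F)) (s1.sub s2) (smooth_pv hU hφ i) a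
    have b := FlatK.bilin' hU hx (ContinuousLinearMap.id ℝ (X →L[ℝ] F)) s2
      (smooth_pv hU (hφ.sub hψ) i) (h.2 i)
    refine (FlatK.add hU hx ((s1.sub s2).clm_apply (smooth_pv hU hφ i))
      (s2.clm_apply (smooth_pv hU (hφ.sub hψ) i)) a' b).congr_on hU hx fun y hy => ?_
    have fd : ∀ y ∈ S, DifferentiableAt ℝ f y := fun y hy =>
      (hf.contDiffAt (hS.mem_nhds hy)).differentiableAt (by simp)
    have e1 := ((fd _ (mφ y hy)).hasFDerivAt.comp y (smooth_diff hU hφ hy).hasFDerivAt)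
    have e2 := ((fd _ (mψ y hy)).hasFDerivAt.comp y (smooth_diff hU hψ hy).hasFDerivAt)
    have e3 := (e1.sub e2).fderiv
    have e4 := ((smooth_diff hU hφ hy).hasFDerivAt.sub (smooth_diff hU hψ hy).hasFDerivAt).fderiv
    have e5 : (fun y => f (φ y) - f (ψ y)) = (f ∘ φ - f ∘ ψ) := rfl
    have e6 : (fun y => φ y - ψ y) = (φ - ψ) := rfl
    simp only [pv]
    rw [e5, e3, e6, e4]
    simp

lemma FlatK.bound (hU : IsOpen U) (hx : x ∈ U) {g : (Fin d → ℝ) → F}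
    (hg : ContDiffOn ℝ (⊤ : ℕ∞) g U) (h : FlatK k g x) :
    ∃ C, 0 ≤ C ∧ ∀ᶠ y in 𝓝 x, ‖g y‖ ≤ C * ‖y - x‖ ^ k := by
  induction k generalizing g with
  | zero =>
    refine ⟨‖g x‖ + 1, by positivity, ?_⟩
    have := ((hg.contDiffAt (hU.mem_nhds hx)).continuousAt.norm).eventually_lt
      (continuousAt_const (y := ‖g x‖ + 1)) (by linarith)
    filter_upwards [this] with y hy
    simpa using hy.le
  | succ k ih =>
    choose C hC0 hC using fun i => ih (smooth_pv hU hg i) (h.2 i)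
    obtain ⟨ε, hε, hb⟩ := Metric.eventually_nhds_iff_ball.1
      ((eventually_all.2 hC).and (hU.mem_nhds hx))
    refine ⟨∑ i, C i, Finset.sum_nonneg fun i _ => hC0 i, ?_⟩
    filter_upwards [Metric.ball_mem_nhds x hε] with y hy
    have hsub : Metric.closedBall x ‖y - x‖ ⊆ Metric.ball x ε := by
      intro w hw
      rw [Metric.mem_closedBall] at hw
      rw [Metric.mem_ball, dist_eq_norm] at hy
      exact Metric.mem_ball.2 (hw.trans_lt hy)
    have key := (convex_closedBall x ‖y - x‖).norm_image_sub_le_of_norm_fderiv_le (𝕜 := ℝ) (f := g)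
      (C := (∑ i, C i) * ‖y - x‖ ^ k) (x := x) (y := y)
      (fun w hw => smooth_diff hU hg (hb w (hsub hw)).2) (fun w hw => ?_)
      (Metric.mem_closedBall_self (norm_nonneg _)) (by simp [dist_eq_norm])
    · rw [h.1, sub_zero] at key
      refine key.trans (le_of_eq ?_)
      ring
    · have hn : ‖w - x‖ ≤ ‖y - x‖ := by simpa [dist_eq_norm] using hw
      refine ContinuousLinearMap.opNorm_le_bound _ (mul_nonneg (Finset.sum_nonneg fun i _ => hC0 i)
        (by positivity)) fun v => ?_
      rw [clm_eq_sum]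
      refine (norm_sum_le _ _).trans ?_
      rw [Finset.sum_mul, Finset.sum_mul]
      refine Finset.sum_le_sum fun i _ => ?_
      rw [norm_smul, mul_comm]
      refine mul_le_mul (((hb w (hsub hw)).1 i).trans ?_) (norm_le_pi_norm v i) (norm_nonneg _) (by have := hC0 i; positivity)
      exact mul_le_mul_of_nonneg_left (pow_le_pow_left₀ (norm_nonneg _) hn k) (hC0 i)

lemma flat_of_closure (hU : IsOpen U) (hx : x ∈ U) {g : (Fin d → ℝ) → F}
    (hg : ContDiffOn ℝ (⊤ : ℕ∞) g U) {A : Set (Fin d → ℝ)} (hA : IsOpen A) (h0 : ∀ y ∈ A, g y = 0)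
    (hc : x ∈ closure A) (k : ℕ) : FlatK k g x := by
  induction k generalizing g with
  | zero => trivial
  | succ k ih =>
    refine ⟨?_, fun i => ih (smooth_pv hU hg i) fun y hy => ?_⟩
    · have hc' := (hg.contDiffAt (hU.mem_nhds hx)).continuousAt
      have := hc'.continuousWithinAt (s := A)
      have := mem_closure_iff_nhdsWithin_neBot.1 hc
      refine tendsto_nhds_unique (f := g) (l := 𝓝[A] x) ‹ContinuousWithinAt g A x› ?_
      exact tendsto_const_nhds.congr' (by filter_upwards [self_mem_nhdsWithin] with y hy using (h0 y hy).symm)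
    · have : g =ᶠ[𝓝 y] fun _ => 0 := by filter_upwards [hA.mem_nhds hy] with w hw using h0 w hw
      simp [pv, this.fderiv_eq]

end Flat


open Set MeasureTheory Filter Topology

section Ucp

variable {d : ℕ} {Ω : Set (Fin d → ℝ)} {f : ((Fin d → ℝ) × ℝ × (Fin d → ℝ)) → ℝ}
  {u p : (Fin d → ℝ) → ℝ → ℝ}

/-- translation in space and time -/
def sh (x : Fin d → ℝ) (t : ℝ) (u : (Fin d → ℝ) → ℝ → ℝ) : (Fin d → ℝ) → ℝ → ℝ :=
  fun y r => u (x + y) (t + r)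

lemma dX_sh (x : Fin d → ℝ) (t : ℝ) (u : (Fin d → ℝ) → ℝ → ℝ) (i : Fin d) :
    dX i (sh x t u) = sh x t (dX i u) := by
  funext y r
  simp only [dX, sh]
  rw [fderiv_comp_add_left (f := fun y => u y (t + r))]

/-- difference of two shifted solutions -/
def wd (x : Fin d → ℝ) (t s : ℝ) (u p : (Fin d → ℝ) → ℝ → ℝ) : (Fin d → ℝ) → ℝ → ℝ :=
  fun y r => sh x t u y r - sh x s p y r

lemma f_lip (hΩ : IsOpen Ω)
    (hf : ContDiffOn ℝ (⊤ : ℕ∞) f (Ω ×ˢ ((univ : Set ℝ) ×ˢ (univ : Set (Fin d → ℝ)))))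
    {x₁ : Fin d → ℝ} {r : ℝ} (hr : Metric.closedBall x₁ r ⊆ Ω) (M : ℝ) :
    ∃ L, 0 ≤ L ∧ ∀ x ∈ Metric.closedBall x₁ r, ∀ a b : ℝ × (Fin d → ℝ), ‖a‖ ≤ M → ‖b‖ ≤ M →
      |f (x, a) - f (x, b)| ≤ L * ‖a - b‖ := by
  set Q : Set ((Fin d → ℝ) × ℝ × (Fin d → ℝ)) := Metric.closedBall x₁ r ×ˢ Metric.closedBall 0 M with hQ
  have hO : IsOpen (Ω ×ˢ ((univ : Set ℝ) ×ˢ (univ : Set (Fin d → ℝ)))) :=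
    hΩ.prod (isOpen_univ.prod isOpen_univ)
  have hQs : Q ⊆ Ω ×ˢ ((univ : Set ℝ) ×ˢ (univ : Set (Fin d → ℝ))) := fun q hq => ⟨hr hq.1, trivial, trivial⟩
  have hQc : IsCompact Q := (isCompact_closedBall _ _).prod (isCompact_closedBall _ _)
  have hQx : Convex ℝ Q := (convex_closedBall _ _).prod (convex_closedBall _ _)
  have hc : ContinuousOn (fderiv ℝ f) Q :=
    (hf.continuousOn_fderiv_of_isOpen hO (by simp)).mono hQs
  obtain ⟨L, hL⟩ := hQc.exists_bound_of_continuousOn hc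
  refine ⟨max L 0, le_max_right _ _, fun x hx a b ha hb => ?_⟩
  have := hQx.norm_image_sub_le_of_norm_fderiv_le (𝕜 := ℝ) (f := f) (C := max L 0) (x := (x, b)) (y := (x, a))
    (fun q hq => (hf.contDiffAt (hO.mem_nhds (hQs hq))).differentiableAt (by simp))
    (fun q hq => (hL q hq).trans (le_max_left _ _)) ⟨hx, by simpa using hb⟩ ⟨hx, by simpa using ha⟩
  rw [Real.norm_eq_abs] at this
  refine this.trans (le_of_eq ?_)
  simp [Prod.norm_def]

lemma ucp_local (hΩ : IsOpen Ω) (hu : Sol Ω f u) (hp : Sol Ω f p)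
    (hf : ContDiffOn ℝ (⊤ : ℕ∞) f (Ω ×ˢ ((univ : Set ℝ) ×ˢ (univ : Set (Fin d → ℝ)))))
    {x₁ : Fin d → ℝ} (hx₁ : x₁ ∈ Ω) (t s : ℝ)
    (hflat : ∀ k, FlatK k (fun y => u y t - p y s) x₁) :
    ∀ᶠ y in 𝓝 x₁, u y t - p y s = 0 := by
  obtain ⟨ρ, hρ, hρΩ⟩ := Metric.nhds_basis_closedBall.mem_iff.1 (hΩ.mem_nhds hx₁)
  have hρΩ' : ∀ y ∈ Metric.closedBall (0 : Fin d → ℝ) ρ, x₁ + y ∈ Ω := fun y hy =>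
    hρΩ (by simpa [dist_eq_norm] using hy)
  set χ : ContDiffBump (0 : Fin d → ℝ) := ⟨ρ / 2, ρ, by linarith, by linarith⟩ with hχ
  set B := Metric.closedBall (0 : Fin d → ℝ) ρ with hB
  have hBc : IsCompact B := isCompact_closedBall _ _
  set w := wd x₁ t s u p with hw
  set z : (Fin d → ℝ) → ℝ → ℝ := fun y r => χ y * w y r with hz
  have hΩ' : IsOpen ((fun y => x₁ + y) ⁻¹' Ω) := hΩ.preimage (by fun_prop)
  have hju := hu.joint hΩ hf
  have hjp := hp.joint hΩ hf
  have wsm : ∀ y r, x₁ + y ∈ Ω → ContDiffAt ℝ (⊤ : ℕ∞) (fun q : (Fin d → ℝ) × ℝ => w q.1 q.2) (y, r) := by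
    intro y r hy
    have hsh : ∀ {v : (Fin d → ℝ) → ℝ → ℝ} (τ : ℝ),
        ContDiffOn ℝ (⊤ : ℕ∞) (fun z : (Fin d → ℝ) × ℝ => v z.1 z.2) (Ω ×ˢ (univ : Set ℝ)) →
        ContDiffAt ℝ (⊤ : ℕ∞) (fun q : (Fin d → ℝ) × ℝ => sh x₁ τ v q.1 q.2) (y, r) := by
      intro v τ hv
      have h1 := hv.contDiffAt (x := (x₁ + y, τ + r)) ((hΩ.prod isOpen_univ).mem_nhds ⟨hy, trivial⟩)
      have h2 : ContDiffAt ℝ (⊤ : ℕ∞) (fun q : (Fin d → ℝ) × ℝ => (x₁ + q.1, τ + q.2)) (y, r) := by fun_prop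
      exact ContDiffAt.comp (y, r) (g := fun z : (Fin d → ℝ) × ℝ => v z.1 z.2) h1 h2
    exact (hsh t hju).sub (hsh s hjp)
  have hzSC : SC B z := by
    constructor
    · rw [contDiff_iff_contDiffAt]
      rintro ⟨y, r⟩
      by_cases hy : x₁ + y ∈ Ω
      · have h1 : ContDiffAt ℝ (⊤ : ℕ∞) (fun q : (Fin d → ℝ) × ℝ => χ q.1) (y, r) :=
          (χ.contDiff.comp contDiff_fst).contDiffAt
        exact h1.mul (wsm y r hy)
      · have hyB : y ∉ B := fun h => hy (hρΩ' y h)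
        have : (fun q : (Fin d → ℝ) × ℝ => z q.1 q.2) =ᶠ[𝓝 (y, r)] fun _ => 0 := by
          have : (Bᶜ ×ˢ univ : Set ((Fin d → ℝ) × ℝ)) ∈ 𝓝 (y, r) :=
            (hBc.isClosed.isOpen_compl.prod isOpen_univ).mem_nhds ⟨hyB, trivial⟩
          filter_upwards [this] with q hq
          have : χ q.1 = 0 := χ.zero_of_le_dist (by
            have h := hq.1
            simp only [hB, mem_compl_iff, Metric.mem_closedBall, not_le] at h
            exact h.le)
          simp [hz, this]
        exact contDiffAt_const.congr_of_eventuallyEq this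
    · intro y hy r
      have : χ y = 0 := χ.zero_of_le_dist (by
        simp only [hB, Metric.mem_closedBall, not_le] at hy
        exact hy.le)
      simp [hz, this]
  -- local identification
  set O : Set ((Fin d → ℝ) × ℝ) := Metric.ball 0 (ρ / 2) ×ˢ univ with hO
  have hOo : IsOpen O := Metric.isOpen_ball.prod isOpen_univ
  have hχ1 : ∀ y ∈ Metric.ball (0 : Fin d → ℝ) (ρ / 2), χ y = 1 := fun y hy =>
    χ.one_of_mem_closedBall (Metric.ball_subset_closedBall hy)
  have hzw : ∀ y r, (y, r) ∈ O → z y r = w y r := by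
    intro y r h
    simp [hz, hχ1 y h.1]
  have hdz := fun i => dX_congr hOo hzw i
  have hddz := fun i => dX_congr hOo (hdz i) i
  have hOΩ : ∀ y r, (y, r) ∈ O → x₁ + y ∈ Ω := fun y r h =>
    hρΩ' y (Metric.closedBall_subset_closedBall (by linarith) (Metric.ball_subset_closedBall h.1))
  have hshd : ∀ {v : (Fin d → ℝ) → ℝ → ℝ} {k : ℕ} (τ : ℝ), CX False (Ω ×ˢ (univ : Set ℝ)) (k + 1) v →
      ∀ y r, (y, r) ∈ O → DifferentiableAt ℝ (fun y => sh x₁ τ v y r) y := by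
    intro v k τ hv y r h
    have := hv.2.1 (x₁ + y, τ + r) ⟨hOΩ y r h, trivial⟩
    exact DifferentiableAt.comp y (g := fun y => v y (τ + r)) this (by fun_prop)
  have sub_dX : ∀ {v v' : (Fin d → ℝ) → ℝ → ℝ} {k : ℕ} (τ τ' : ℝ),
      CX False (Ω ×ˢ (univ : Set ℝ)) (k + 1) v → CX False (Ω ×ˢ (univ : Set ℝ)) (k + 1) v' →
      ∀ i y r, (y, r) ∈ O → dX i (fun y r => sh x₁ τ v y r - sh x₁ τ' v' y r) y r =
        sh x₁ τ (dX i v) y r - sh x₁ τ' (dX i v') y r := by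
    intro v v' k τ τ' hv hv' i y r h
    rw [← dX_sh, ← dX_sh]
    simp only [dX]
    rw [fderiv_fun_sub (hshd τ hv y r h) (hshd τ' hv' y r h)]; rfl
  have su := hu.smooth hΩ hf
  have sp := hp.smooth hΩ hf
  have hdw : ∀ i y r, (y, r) ∈ O → dX i w y r = sh x₁ t (dX i u) y r - sh x₁ s (dX i p) y r :=
    fun i y r h => sub_dX t s (su 1) (sp 1) i y r h
  have hddw : ∀ i y r, (y, r) ∈ O → dX i (dX i w) y r =
      sh x₁ t (dX i (dX i u)) y r - sh x₁ s (dX i (dX i p)) y r := by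
    intro i y r h
    rw [dX_congr hOo (hdw i) i y r h]
    exact sub_dX t s ((su 2).2.2 i) ((sp 2).2.2 i) i y r h
  have hheat : ∀ y r, (y, r) ∈ O → heat z y r =
      f (x₁ + y, u (x₁ + y) (t + r), fun i => dX i u (x₁ + y) (t + r)) -
      f (x₁ + y, p (x₁ + y) (s + r), fun i => dX i p (x₁ + y) (s + r)) := by
    intro y r h
    have e1 : z y = fun r => u (x₁ + y) (t + r) - p (x₁ + y) (s + r) := by
      funext r'
      exact hzw y r' ⟨h.1, trivial⟩
    have hx := hOΩ y r h
    have e2 : deriv (z y) r = deriv (u (x₁ + y)) (t + r) - deriv (p (x₁ + y)) (s + r) := by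
      rw [e1]
      have a : HasDerivAt (fun r => u (x₁ + y) (t + r)) (deriv (u (x₁ + y)) (t + r)) r :=
        (hu.t1 _ hx (t + r)).hasDerivAt.comp_const_add t r
      have b : HasDerivAt (fun r => p (x₁ + y) (s + r)) (deriv (p (x₁ + y)) (s + r)) r :=
        (hp.t1 _ hx (s + r)).hasDerivAt.comp_const_add s r
      exact (a.sub b).deriv
    have e3 : ∀ i, dX i (dX i z) y r = dX i (dX i u) (x₁ + y) (t + r) - dX i (dX i p) (x₁ + y) (s + r) :=
      fun i => (hddz i y r h).trans (hddw i y r h)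
    unfold heat
    rw [e2, hu.eq _ hx, hp.eq _ hx]
    simp only [e3, Finset.sum_sub_distrib]
    ring
  obtain ⟨Ru, hRu⟩ := hu.bnd
  obtain ⟨Rp, hRp⟩ := hp.bnd
  obtain ⟨L, hL0, hL⟩ := f_lip hΩ hf hρΩ (max (max Ru Rp) 0)
  -- bound on the heat operator
  obtain ⟨K, hK⟩ := (hBc.prod (isCompact_Icc (a := (-1 : ℝ)) (b := 0))).exists_bound_of_continuousOn
    (hzSC.heat hBc.isClosed).1.continuous.continuousOn
  have hK' : ∀ y, ∀ r ∈ Icc (-1 : ℝ) 0, heat z y r * heat z y r ≤ K * K := by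
    intro y r hr
    by_cases hy : y ∈ B
    · have := hK (y, r) ⟨hy, hr⟩
      rw [Real.norm_eq_abs] at this
      rw [← abs_mul_abs_self (heat z y r)]
      exact mul_self_le_mul_self (abs_nonneg _) this
    · rw [(hzSC.heat hBc.isClosed).2 y hy r]
      nlinarith
  have hnsq : ∀ y : Fin d → ℝ, nsq y < (ρ / 2) ^ 2 → y ∈ Metric.ball (0 : Fin d → ℝ) (ρ / 2) := by
    intro y hy
    have := (norm_sq_le_nsq y).trans_lt hy
    rw [mem_ball_zero_iff]
    exact lt_of_pow_lt_pow_left₀ 2 (by linarith) this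
  have hE : ∀ y, ∀ r ∈ Icc (-1 : ℝ) 0, heat z y r * heat z y r ≤
      L ^ 2 * (z y r * z y r + ∑ i, dX i z y r * dX i z y r) +
        (if (ρ / 2) ^ 2 ≤ nsq y then K * K else 0) := by
    intro y r hr
    split_ifs with h
    · have : 0 ≤ L ^ 2 * (z y r * z y r + ∑ i, dX i z y r * dX i z y r) :=
        mul_nonneg (sq_nonneg _) (add_nonneg (mul_self_nonneg _)
          (Finset.sum_nonneg fun i _ => mul_self_nonneg _))
      linarith [hK' y r hr]
    · have hy := hnsq y (not_le.1 h)
      have hyO : (y, r) ∈ O := ⟨hy, trivial⟩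
      have hx := hOΩ y r hyO
      rw [hheat y r hyO, add_zero]
      set a : ℝ × (Fin d → ℝ) := (u (x₁ + y) (t + r), fun i => dX i u (x₁ + y) (t + r)) with ha
      set b : ℝ × (Fin d → ℝ) := (p (x₁ + y) (s + r), fun i => dX i p (x₁ + y) (s + r)) with hb
      have hxb : x₁ + y ∈ Metric.closedBall x₁ ρ := by
        rw [mem_ball_zero_iff] at hy
        simp [dist_eq_norm]; linarith
      have na : ‖a‖ ≤ max (max Ru Rp) 0 := by
        have := hRu _ hx (t + r)
        rw [Prod.norm_def, max_le_iff, pi_norm_le_iff_of_nonneg (le_max_right _ _)]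
        exact ⟨this.1.trans (by simp), fun i => (this.2 i).trans (by simp)⟩
      have nb : ‖b‖ ≤ max (max Ru Rp) 0 := by
        have := hRp _ hx (s + r)
        rw [Prod.norm_def, max_le_iff, pi_norm_le_iff_of_nonneg (le_max_right _ _)]
        exact ⟨this.1.trans (by simp), fun i => (this.2 i).trans (by simp)⟩
      have key := hL _ hxb a b na nb
      set S := z y r * z y r + ∑ i, dX i z y r * dX i z y r with hS
      have ez : z y r = u (x₁ + y) (t + r) - p (x₁ + y) (s + r) := hzw y r hyO
      have edz : ∀ i, dX i z y r = dX i u (x₁ + y) (t + r) - dX i p (x₁ + y) (s + r) := fun i =>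
        (hdz i y r hyO).trans (hdw i y r hyO)
      have hsum : 0 ≤ ∑ i, dX i z y r * dX i z y r := Finset.sum_nonneg fun i _ => mul_self_nonneg _
      have hS0 : 0 ≤ S := add_nonneg (mul_self_nonneg _) hsum
      have nab : ‖a - b‖ ≤ Real.sqrt S := by
        rw [Prod.norm_def, max_le_iff, pi_norm_le_iff_of_nonneg (Real.sqrt_nonneg _)]
        constructor
        · rw [Real.norm_eq_abs]
          apply Real.abs_le_sqrt
          simp only [ha, hb, Prod.fst_sub, ← ez]
          rw [hS, sq]; linarith
        · intro i
          rw [Real.norm_eq_abs]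
          apply Real.abs_le_sqrt
          simp only [ha, hb, Prod.snd_sub, Pi.sub_apply, ← edz]
          have := Finset.single_le_sum (f := fun i => dX i z y r * dX i z y r)
            (fun _ _ => mul_self_nonneg _) (Finset.mem_univ i)
          rw [hS, sq]; linarith [mul_self_nonneg (z y r)]
      have k2 := key.trans (mul_le_mul_of_nonneg_left nab hL0)
      have k3 := mul_self_le_mul_self (abs_nonneg _) k2
      rw [abs_mul_abs_self] at k3
      refine k3.trans (le_of_eq ?_)
      rw [mul_mul_mul_comm, Real.mul_self_sqrt hS0]; ring
  have hfl : ∀ M : ℕ, ∃ A, ∀ y, z y 0 ^ 2 ≤ A * nsq y ^ M := by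
    intro M
    have hvs : ContDiffOn ℝ (⊤ : ℕ∞) (fun y => u y t - p y s) Ω := by
      have : ∀ {v : (Fin d → ℝ) → ℝ → ℝ} (τ : ℝ),
        ContDiffOn ℝ (⊤ : ℕ∞) (fun z : (Fin d → ℝ) × ℝ => v z.1 z.2) (Ω ×ˢ (univ : Set ℝ)) →
        ContDiffOn ℝ (⊤ : ℕ∞) (fun y => v y τ) Ω := by
        intro v τ hv
        have h2 : ContDiffOn ℝ (⊤ : ℕ∞) (fun y : (Fin d → ℝ) => (y, τ)) Ω := by fun_prop
        exact hv.comp h2 fun y hy => ⟨hy, trivial⟩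
      exact (this t hju).sub (this s hjp)
    obtain ⟨C, hC0, hC⟩ := FlatK.bound hΩ hx₁ hvs (hflat M)
    obtain ⟨ε, hε, hb⟩ := Metric.eventually_nhds_iff_ball.1 hC
    obtain ⟨K2, hK2⟩ := hBc.exists_bound_of_continuousOn (hzSC.slice 0).1.continuous.continuousOn
    have hK2' : ∀ y, z y 0 ^ 2 ≤ K2 ^ 2 := by
      intro y
      by_cases hy : y ∈ B
      · have := hK2 y hy
        rw [Real.norm_eq_abs] at this
        rw [← sq_abs]; exact pow_le_pow_left₀ (abs_nonneg _) this 2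
      · rw [hzSC.2 y hy 0]; nlinarith [sq_nonneg K2]
    refine ⟨C ^ 2 + K2 ^ 2 / (ε ^ 2) ^ M, fun y => ?_⟩
    have hn0 : 0 ≤ nsq y ^ M := pow_nonneg (nsq_nonneg y) M
    rw [add_mul]
    by_cases hy : ‖y‖ < ε
    · have h1 := hb (x₁ + y) (by simpa [dist_eq_norm] using hy)
      have h2 : |z y 0| ≤ C * ‖y‖ ^ M := by
        have e : z y 0 = χ y * (u (x₁ + y) t - p (x₁ + y) s) := by simp [hz, hw, wd, sh]
        rw [e, abs_mul, abs_of_nonneg χ.nonneg]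
        rw [Real.norm_eq_abs, add_sub_cancel_left] at h1
        calc _ ≤ 1 * |u (x₁ + y) t - p (x₁ + y) s| := mul_le_mul_of_nonneg_right χ.le_one (abs_nonneg _)
          _ ≤ _ := by rw [one_mul]; exact h1
      have h3 : z y 0 ^ 2 ≤ C ^ 2 * nsq y ^ M := by
        rw [← sq_abs]
        calc |z y 0| ^ 2 ≤ (C * ‖y‖ ^ M) ^ 2 := pow_le_pow_left₀ (abs_nonneg _) h2 2
          _ = C ^ 2 * (‖y‖ ^ 2) ^ M := by ring
          _ ≤ _ := mul_le_mul_of_nonneg_left (pow_le_pow_left₀ (sq_nonneg _) (norm_sq_le_nsq y) M) (sq_nonneg _)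
      have : 0 ≤ K2 ^ 2 / (ε ^ 2) ^ M * nsq y ^ M := by positivity
      linarith
    · have h1 : ε ^ 2 ≤ nsq y := (pow_le_pow_left₀ hε.le (not_lt.1 hy) 2).trans (norm_sq_le_nsq y)
      have h2 : (ε ^ 2) ^ M ≤ nsq y ^ M := pow_le_pow_left₀ (sq_nonneg _) h1 M
      have h3 : K2 ^ 2 ≤ K2 ^ 2 / (ε ^ 2) ^ M * nsq y ^ M := by
        rw [div_mul_eq_mul_div, le_div_iff₀ (by positivity)]
        exact mul_le_mul_of_nonneg_left h2 (sq_nonneg _)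
      have : 0 ≤ C ^ 2 * nsq y ^ M := by positivity
      linarith [hK2' y]
  have concl : ∀ y, nsq y < (ρ / 2) ^ 2 → z y 0 = 0 := fun y hy =>
    ucp_core hBc hzSC (sq_nonneg _) (sq_nonneg _) (mul_self_nonneg K) hE hfl hy
  have hopen : ∀ᶠ y in 𝓝 x₁, nsq (y - x₁) < (ρ / 2) ^ 2 := by
    have hc : Continuous fun y : Fin d → ℝ => nsq (y - x₁) := nsq_cont.comp (by fun_prop)
    exact hc.continuousAt.eventually_lt continuousAt_const (by simp [nsq]; positivity)
  filter_upwards [hopen] with y hy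
  have h1 := concl _ hy
  rw [hzw _ _ ⟨hnsq _ hy, trivial⟩] at h1
  simpa [hw, wd, sh] using h1

lemma sol_slice (hΩ : IsOpen Ω) (hu : Sol Ω f u)
    (hf : ContDiffOn ℝ (⊤ : ℕ∞) f (Ω ×ˢ ((univ : Set ℝ) ×ˢ (univ : Set (Fin d → ℝ))))) (t : ℝ) :
    ContDiffOn ℝ (⊤ : ℕ∞) (fun y => u y t) Ω := by
  have h2 : ContDiffOn ℝ (⊤ : ℕ∞) (fun y : (Fin d → ℝ) => (y, t)) Ω := by fun_prop
  exact (hu.joint hΩ hf).comp h2 fun y hy => ⟨hy, trivial⟩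

lemma ucp (hΩ : IsOpen Ω) (hΩc : IsPreconnected Ω) (hu : Sol Ω f u) (hp : Sol Ω f p)
    (hf : ContDiffOn ℝ (⊤ : ℕ∞) f (Ω ×ˢ ((univ : Set ℝ) ×ˢ (univ : Set (Fin d → ℝ)))))
    {x₁ : Fin d → ℝ} (hx₁ : x₁ ∈ Ω) (t s : ℝ)
    (hflat : ∀ k, FlatK k (fun y => u y t - p y s) x₁) :
    ∀ y ∈ Ω, u y t = p y s := by
  set A := interior {y | u y t - p y s = 0} with hA
  have hsm : ContDiffOn ℝ (⊤ : ℕ∞) (fun y => u y t - p y s) Ω :=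
    (sol_slice hΩ hu hf t).sub (sol_slice hΩ hp hf s)
  have hm : ∀ {x}, x ∈ Ω → (∀ k, FlatK k (fun y => u y t - p y s) x) → x ∈ A := fun hx h =>
    mem_interior_iff_mem_nhds.2 (ucp_local hΩ hu hp hf hx t s h)
  have h := hΩc.subset_of_closure_inter_subset (u := A) isOpen_interior ⟨x₁, hx₁, hm hx₁ hflat⟩
    fun x hx => hm hx.2 fun k => flat_of_closure hΩ hx.2 hsm isOpen_interior
      (fun y hy => interior_subset (s := {y | u y t - p y s = 0}) hy) hx.1 k
  intro y hy
  exact sub_eq_zero.1 (interior_subset (s := {y | u y t - p y s = 0}) (h hy))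

end Ucp


open Set MeasureTheory Filter Topology

section Dim

variable {d : ℕ}

lemma zero_dim {Z : Type} [NormedAddCommGroup Z] [NormedSpace ℝ Z] [FiniteDimensional ℝ Z]
    {ψ₁ ψ₂ : Z → ℝ} {A₁ A₂ : Z →L[ℝ] ℝ} {q₀ : Z} (h₁ : HasStrictFDerivAt ψ₁ A₁ q₀)
    (h₂ : HasStrictFDerivAt ψ₂ A₂ q₀) (v₁ v₂ : Z) (hD : A₁ v₁ * A₂ v₂ - A₁ v₂ * A₂ v₁ ≠ 0) (n : ℕ)
    (hn : Module.finrank ℝ Z = n + 2) :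
    ∃ N ∈ 𝓝 q₀, dimH (N ∩ {q | ψ₁ q = 0 ∧ ψ₂ q = 0}) ≤ n := by
  set A : Z →L[ℝ] ℝ × ℝ := A₁.prod A₂ with hA
  have hψ : HasStrictFDerivAt (fun q => (ψ₁ q, ψ₂ q)) A q₀ := h₁.prodMk h₂
  have hsurj : Function.Surjective A := by
    rintro ⟨α, β⟩
    set D := A₁ v₁ * A₂ v₂ - A₁ v₂ * A₂ v₁ with hDd
    refine ⟨((α * A₂ v₂ - A₁ v₂ * β) / D) • v₁ + ((A₁ v₁ * β - A₂ v₁ * α) / D) • v₂, ?_⟩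
    simp only [hA, ContinuousLinearMap.prod_apply, map_add, map_smul]
    refine Prod.ext ?_ ?_ <;> simp only [Prod.fst_add, Prod.snd_add, Prod.smul_fst, Prod.smul_snd, smul_eq_mul]
    · field_simp
      rw [hDd]; ring
    · field_simp
      rw [hDd]; ring
  have hker : Module.finrank ℝ (LinearMap.ker (A : Z →ₗ[ℝ] ℝ × ℝ)) = n := by
    have h := LinearMap.finrank_range_add_finrank_ker (A : Z →ₗ[ℝ] ℝ × ℝ)
    rw [LinearMap.range_eq_top.2 hsurj, finrank_top, hn, Module.finrank_prod, Module.finrank_self] at h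
    omega
  obtain ⟨π, hπ⟩ := A.ker_closedComplemented_of_finiteDimensional_range
  set T : Z →L[ℝ] (ℝ × ℝ) × (LinearMap.ker (A : Z →ₗ[ℝ] ℝ × ℝ)) := A.prod π with hT
  have hTi : LinearMap.ker (T : Z →ₗ[ℝ] (ℝ × ℝ) × (LinearMap.ker (A : Z →ₗ[ℝ] ℝ × ℝ))) = ⊥ := by
    rw [LinearMap.ker_eq_bot']
    intro v hv
    have hv' : (A v, π v) = 0 := hv
    have a : A v = 0 := (Prod.mk.injEq _ _ _ _ ▸ hv').1
    have b : π v = 0 := (Prod.mk.injEq _ _ _ _ ▸ hv').2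
    have := hπ ⟨v, a⟩
    simp only at this
    rw [b] at this
    exact (congrArg Subtype.val this).symm
  obtain ⟨C, hC, hanti⟩ := LinearMap.exists_antilipschitzWith
    (T : Z →ₗ[ℝ] (ℝ × ℝ) × (LinearMap.ker (A : Z →ₗ[ℝ] ℝ × ℝ))) hTi
  have hCr : (0 : ℝ) < C := hC
  obtain ⟨N, hN, hap⟩ := hψ.approximates_deriv_on_nhds (c := (2 * C)⁻¹) (Or.inr (by positivity))
  refine ⟨N, hN, ?_⟩
  set S := N ∩ {q | ψ₁ q = 0 ∧ ψ₂ q = 0} with hS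
  have hal : AntilipschitzWith C (fun q : S => π q.1) := by
    refine AntilipschitzWith.of_le_mul_dist fun x y => ?_
    rcases eq_or_ne x y with rfl | hne
    · simp
    have h1 := hap x.1 x.2.1 y.1 y.2.1
    simp only [x.2.2.1, x.2.2.2, y.2.2.1, y.2.2.2, sub_self, zero_sub, norm_neg] at h1
    have h2 := hanti.le_mul_dist x.1 y.1
    have h3 : dist (T x.1) (T y.1) = max ‖A (x.1 - y.1)‖ ‖π (x.1 - y.1)‖ := by
      rw [dist_eq_norm, ← map_sub]; rfl
    have hpos : 0 < ‖x.1 - y.1‖ := norm_pos_iff.2 (sub_ne_zero.2 fun h => hne (Subtype.ext h))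
    have h2' : ‖x.1 - y.1‖ ≤ C * max ‖A (x.1 - y.1)‖ ‖π (x.1 - y.1)‖ := by
      rw [← h3, ← dist_eq_norm]; exact h2
    rw [Subtype.dist_eq, dist_eq_norm, dist_eq_norm, ← map_sub]
    rcases le_total ‖A (x.1 - y.1)‖ ‖π (x.1 - y.1)‖ with h | h
    · rwa [max_eq_right h] at h2'
    · rw [max_eq_left h] at h2'
      exfalso
      have h4 : ‖A (x.1 - y.1)‖ ≤ (2 * (C : ℝ))⁻¹ * ‖x.1 - y.1‖ :=
        h1.trans (le_of_eq (by push_cast; rfl))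
      have h5 := mul_le_mul_of_nonneg_left h4 hCr.le
      have h6 : (C : ℝ) * ((2 * (C : ℝ))⁻¹ * ‖x.1 - y.1‖) = ‖x.1 - y.1‖ / 2 := by
        field_simp
      linarith
  have e1 : dimH S = dimH (univ : Set S) := by
    rw [← (isometry_subtype_coe (s := S)).dimH_image univ, image_univ, Subtype.range_coe]
  rw [e1]
  refine (hal.le_dimH_image univ).trans ((dimH_mono (subset_univ _)).trans ?_)
  rw [Real.dimH_univ_eq_finrank, hker]

lemma trace_minor {M : Fin d → Fin d → ℝ} (hs : ∀ i j, M i j = M j i) {i₀ j₀ : Fin d} (h : M i₀ j₀ ≠ 0)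
    (ht : ∑ i, M i i = 0) : ∃ i j, M i i * M j j - M i j * M j i ≠ 0 := by
  by_cases hd : ∃ i, M i i ≠ 0
  · obtain ⟨i, hi⟩ := hd
    have : ∃ j, M i i * M j j < 0 := by
      by_contra hc
      push Not at hc
      have h1 : ∑ j, M i i * M j j = 0 := by rw [← Finset.mul_sum, ht, mul_zero]
      have := (Finset.sum_eq_zero_iff_of_nonneg fun j _ => hc j).1 h1 i (Finset.mem_univ i)
      exact hi (mul_self_eq_zero.1 this)
    obtain ⟨j, hj⟩ := this
    refine ⟨i, j, ?_⟩
    rw [hs j i]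
    have := mul_self_nonneg (M i j)
    exact ne_of_lt (by linarith)
  · push Not at hd
    refine ⟨i₀, j₀, ?_⟩
    rw [hd, hs j₀ i₀]
    have := mul_self_pos.2 h
    exact ne_of_lt (by linarith)

/-- iterated derivatives (slices) -/
noncomputable def Dl : List (Fin d) → ((Fin d → ℝ) → ℝ) → (Fin d → ℝ) → ℝ
  | [], g => g
  | i :: l, g => Dl l (pv i g)

/-- iterated derivatives (time dependent) -/
noncomputable def DX : List (Fin d) → ((Fin d → ℝ) → ℝ → ℝ) → (Fin d → ℝ) → ℝ → ℝ
  | [], g => g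
  | i :: l, g => DX l (dX i g)

variable {U : Set (Fin d → ℝ)} {x : Fin d → ℝ}

lemma pv_congr_on (hU : IsOpen U) {g g' : (Fin d → ℝ) → ℝ} (h : ∀ y ∈ U, g y = g' y) (i : Fin d) :
    ∀ y ∈ U, pv i g y = pv i g' y := fun y hy =>
  (pv_congr (x := y) (by filter_upwards [hU.mem_nhds hy] with z hz using h z hz) i).eq_of_nhds

lemma Dl_congr (hU : IsOpen U) (l : List (Fin d)) : ∀ {g g' : (Fin d → ℝ) → ℝ}, (∀ y ∈ U, g y = g' y) →
    ∀ y ∈ U, Dl l g y = Dl l g' y := by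
  induction l with
  | nil => exact fun h => h
  | cons i l ih => exact fun h => ih (pv_congr_on hU h i)

lemma Dl_smooth (hU : IsOpen U) (l : List (Fin d)) : ∀ {g : (Fin d → ℝ) → ℝ}, ContDiffOn ℝ (⊤ : ℕ∞) g U →
    ContDiffOn ℝ (⊤ : ℕ∞) (Dl l g) U := by
  induction l with
  | nil => exact fun h => h
  | cons i l ih => exact fun h => ih (smooth_pv hU h i)

lemma pv_comm (hU : IsOpen U) {g : (Fin d → ℝ) → ℝ} (hg : ContDiffOn ℝ (⊤ : ℕ∞) g U) (i j : Fin d) :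
    ∀ y ∈ U, pv i (pv j g) y = pv j (pv i g) y := by
  intro y hy
  have hs : IsSymmSndFDerivAt ℝ g y :=
    ((contDiffOn_infty.1 hg 2).contDiffAt (hU.mem_nhds hy)).isSymmSndFDerivAt (by simp)
  have hd : DifferentiableAt ℝ (fderiv ℝ g) y :=
    ((hg.fderiv_of_isOpen hU (m := (⊤ : ℕ∞)) (by simp)).contDiffAt (hU.mem_nhds hy)).differentiableAt (by simp)
  have e : ∀ i j : Fin d, pv i (pv j g) y = fderiv ℝ (fderiv ℝ g) y (Pi.single i 1) (Pi.single j 1) := by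
    intro i j
    have h1 : pv j g = fun z => fderiv ℝ g z (Pi.single j 1) := rfl
    rw [h1]
    simp only [pv]
    rw [fderiv_clm_apply hd (by fun_prop)]
    simp
  rw [e, e]
  exact hs _ _

lemma Dl_pv (hU : IsOpen U) (i : Fin d) (l : List (Fin d)) : ∀ {g : (Fin d → ℝ) → ℝ},
    ContDiffOn ℝ (⊤ : ℕ∞) g U → ∀ y ∈ U, Dl l (pv i g) y = pv i (Dl l g) y := by
  induction l with
  | nil => exact fun h y hy => rfl
  | cons j l ih =>
    intro g hg y hy
    have := ih (smooth_pv hU hg j) y hy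
    simp only [Dl]
    rw [← this]
    exact Dl_congr hU l (pv_comm hU hg j i) y hy

lemma Dl_add (hU : IsOpen U) (l : List (Fin d)) : ∀ {g g' : (Fin d → ℝ) → ℝ},
    ContDiffOn ℝ (⊤ : ℕ∞) g U → ContDiffOn ℝ (⊤ : ℕ∞) g' U →
    ∀ y ∈ U, Dl l (fun y => g y + g' y) y = Dl l g y + Dl l g' y := by
  induction l with
  | nil => exact fun _ _ _ _ => rfl
  | cons i l ih =>
    intro g g' hg hg' y hy
    simp only [Dl]
    rw [← ih (smooth_pv hU hg i) (smooth_pv hU hg' i) y hy]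
    refine Dl_congr hU l (fun z hz => ?_) y hy
    simp only [pv]
    rw [fderiv_fun_add (smooth_diff hU hg hz) (smooth_diff hU hg' hz)]; rfl

lemma Dl_zero (l : List (Fin d)) : Dl l (fun _ => (0 : ℝ)) = fun _ => 0 := by
  induction l with
  | nil => rfl
  | cons i l ih =>
    have : pv i (fun _ : Fin d → ℝ => (0 : ℝ)) = fun _ => 0 := by funext y; simp [pv]
    simp only [Dl, this, ih]

lemma Dl_sum (hU : IsOpen U) (l : List (Fin d)) {ι : Type} (s : Finset ι) {g : ι → (Fin d → ℝ) → ℝ}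
    (hg : ∀ j, ContDiffOn ℝ (⊤ : ℕ∞) (g j) U) :
    ∀ y ∈ U, Dl l (fun y => ∑ j ∈ s, g j y) y = ∑ j ∈ s, Dl l (g j) y := by
  classical
  induction s using Finset.induction_on with
  | empty => intro y _; simp [Dl_zero]
  | insert a s ha ih =>
    intro y hy
    simp only [Finset.sum_insert ha]
    rw [Dl_add hU l (hg a) (ContDiffOn.sum fun j _ => hg j) y hy, ih y hy]

lemma flat_Dl (l : List (Fin d)) {k : ℕ} : ∀ {g : (Fin d → ℝ) → ℝ}, FlatK (k + l.length) g x →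
    FlatK k (Dl l g) x := by
  induction l with
  | nil => exact fun h => h
  | cons i l ih => exact fun h => ih (h.2 i)

lemma exists_Dl (k : ℕ) : ∀ {g : (Fin d → ℝ) → ℝ}, FlatK (k + 2) g x → ¬ FlatK (k + 3) g x →
    ∃ l : List (Fin d), l.length = k ∧ ¬ FlatK 3 (Dl l g) x := by
  induction k with
  | zero => exact fun h h' => ⟨[], rfl, h'⟩
  | succ k ih =>
    intro g h h'
    have : ∃ i, ¬ FlatK (k + 3) (pv i g) x := by
      by_contra hc
      push Not at hc
      exact h' ⟨h.1, hc⟩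
    obtain ⟨i, hi⟩ := this
    obtain ⟨l, hl, h3⟩ := ih (h.2 i) hi
    exact ⟨i :: l, by simp [hl], h3⟩

lemma flat3 {h : (Fin d → ℝ) → ℝ} (h2 : FlatK 2 h x) (h3 : ¬ FlatK 3 h x) : ∃ i j, pv j (pv i h) x ≠ 0 := by
  by_contra hc
  push Not at hc
  exact h3 ⟨h2.1, fun i => ⟨(h2.2 i).1, fun j => ⟨hc i j, fun _ => trivial⟩⟩⟩

variable {Ω : Set (Fin d → ℝ)}

lemma pv_sub_dX {g g' : (Fin d → ℝ) → ℝ → ℝ} (hg : CX False (Ω ×ˢ (univ : Set ℝ)) 1 g)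
    (hg' : CX False (Ω ×ˢ (univ : Set ℝ)) 1 g') (t s : ℝ) (i : Fin d) :
    ∀ y ∈ Ω, pv i (fun y => g y t - g' y s) y = dX i g y t - dX i g' y s := by
  intro y hy
  simp only [pv, dX]
  rw [fderiv_fun_sub (hg.2.1 (y, t) ⟨hy, trivial⟩) (hg'.2.1 (y, s) ⟨hy, trivial⟩)]; rfl

lemma Dl_sub (hΩ : IsOpen Ω) (t s : ℝ) (l : List (Fin d)) : ∀ {g g' : (Fin d → ℝ) → ℝ → ℝ},
    (∀ k, CX False (Ω ×ˢ (univ : Set ℝ)) k g) → (∀ k, CX False (Ω ×ˢ (univ : Set ℝ)) k g') →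
    ∀ y ∈ Ω, Dl l (fun y => g y t - g' y s) y = DX l g y t - DX l g' y s := by
  induction l with
  | nil => exact fun _ _ _ _ => rfl
  | cons i l ih =>
    intro g g' hg hg' y hy
    have := ih (fun k => (hg (k + 1)).2.2 i) (fun k => (hg' (k + 1)).2.2 i) y hy
    simp only [Dl, DX]
    rw [← this]
    exact Dl_congr hΩ l (pv_sub_dX (hg 1) (hg' 1) t s i) y hy

lemma DX_time (hΩ : IsOpen Ω) (l : List (Fin d)) : ∀ {g q : (Fin d → ℝ) → ℝ → ℝ},
    (∀ k, CX False (Ω ×ˢ (univ : Set ℝ)) k g) → (∀ k, CX False (Ω ×ˢ (univ : Set ℝ)) k q) →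
    (∀ x ∈ Ω, ∀ t, HasDerivAt (g x) (q x t) t) →
    ∀ x ∈ Ω, ∀ t, HasDerivAt (DX l g x) (DX l q x t) t := by
  induction l with
  | nil => exact fun _ _ h => h
  | cons i l ih =>
    intro g q hg hq h
    exact ih (fun k => (hg (k + 1)).2.2 i) (fun k => (hq (k + 1)).2.2 i)
      fun x hx t => time_dx hΩ (hg 1) (hq 1) h i hx t

lemma Alg.DX {u g : (Fin d → ℝ) → ℝ → ℝ} (l : List (Fin d)) (h : Alg Ω u g) : Alg Ω u (DX l g) := by
  induction l generalizing g with
  | nil => exact h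
  | cons i l ih => exact ih (.dx i g h)

end Dim


open Set MeasureTheory Filter Topology

section Dim2

variable {d : ℕ}

lemma FlatK.sum {F : Type} [NormedAddCommGroup F] [NormedSpace ℝ F] {U : Set (Fin d → ℝ)}
    {x : Fin d → ℝ} {k : ℕ} (hU : IsOpen U) (hx : x ∈ U) {ι : Type} (s : Finset ι)
    {g : ι → (Fin d → ℝ) → F} (hg : ∀ j, ContDiffOn ℝ (⊤ : ℕ∞) (g j) U) (h : ∀ j, FlatK k (g j) x) :
    FlatK k (fun y => ∑ j ∈ s, g j y) x := by
  classical
  induction s using Finset.induction_on with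
  | empty =>
    simp only [Finset.sum_empty]
    exact flat_of_closure isOpen_univ (mem_univ x) contDiffOn_const isOpen_univ (fun _ _ => rfl)
      (by simp) k
  | insert a s ha ih =>
    simp only [Finset.sum_insert ha]
    exact FlatK.add hU hx (hg a) (ContDiffOn.sum fun j _ => hg j) (h a) ih

lemma fd_space {ψ : (Fin d → ℝ) × ℝ × ℝ → ℝ} {x : Fin d → ℝ} {t s : ℝ}
    (h : DifferentiableAt ℝ ψ (x, t, s)) (j : Fin d) :
    fderiv ℝ ψ (x, t, s) (Pi.single j 1, 0, 0) = pv j (fun y => ψ (y, t, s)) x := by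
  have h1 : HasFDerivAt (fun y : Fin d → ℝ => (y, t, s))
      (ContinuousLinearMap.inl ℝ (Fin d → ℝ) (ℝ × ℝ)) x :=
    hasFDerivAt_prodMk_left x (t, s)
  have h2 := (HasFDerivAt.comp x (g := ψ) h.hasFDerivAt h1).fderiv
  have h3 : (ψ ∘ fun y : Fin d → ℝ => (y, t, s)) = fun y => ψ (y, t, s) := rfl
  rw [h3] at h2
  simp only [pv]
  rw [h2]
  simp
  rfl

lemma fd_time {ψ : (Fin d → ℝ) × ℝ × ℝ → ℝ} {x : Fin d → ℝ} {t s c : ℝ}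
    (h : DifferentiableAt ℝ ψ (x, t, s)) (hc : HasDerivAt (fun τ => ψ (x, t + τ, s + τ)) c 0) :
    fderiv ℝ ψ (x, t, s) (0, 1, 1) = c := by
  have h1 : HasDerivAt (fun τ : ℝ => (x, t + τ, s + τ)) (0, 1, 1) 0 :=
    (hasDerivAt_const 0 x).prodMk (((hasDerivAt_id (0 : ℝ)).const_add t).prodMk
      ((hasDerivAt_id (0 : ℝ)).const_add s))
  have h' : HasFDerivAt ψ (fderiv ℝ ψ (x, t, s)) (x, t + 0, s + 0) := by
    simpa using h.hasFDerivAt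
  have h2 := HasFDerivAt.comp_hasDerivAt (0 : ℝ) h' h1
  exact h2.unique hc

variable {Ω : Set (Fin d → ℝ)} {f : ((Fin d → ℝ) × ℝ × (Fin d → ℝ)) → ℝ}
  {u p : (Fin d → ℝ) → ℝ → ℝ}

lemma trace_time (hΩ : IsOpen Ω) (hu : Sol Ω f u) (hp : Sol Ω f p)
    (hf : ContDiffOn ℝ (⊤ : ℕ∞) f (Ω ×ˢ ((univ : Set ℝ) ×ˢ (univ : Set (Fin d → ℝ)))))
    {x : Fin d → ℝ} (hx : x ∈ Ω) (t s : ℝ) (l : List (Fin d))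
    (hfl : FlatK (l.length + 2) (fun y => u y t - p y s) x) :
    HasDerivAt (fun τ => DX l u x (t + τ) - DX l p x (s + τ))
      (∑ i, pv i (pv i (Dl l (fun y => u y t - p y s))) x) 0 := by
  obtain ⟨qu, aqu, hqu⟩ := Alg.time hΩ hu hf .base
  obtain ⟨qp, aqp, hqp⟩ := Alg.time hΩ hp hf .base
  have su := hu.smooth hΩ hf
  have sp := hp.smooth hΩ hf
  have squ := aqu.cx hΩ su
  have sqp := aqp.cx hΩ sp
  set v := fun y => u y t - p y s with hv
  have hvs : ContDiffOn ℝ (⊤ : ℕ∞) v Ω := (sol_slice hΩ hu hf t).sub (sol_slice hΩ hp hf s)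
  have h1 := DX_time hΩ l su squ hqu x hx t
  have h2 := DX_time hΩ l sp sqp hqp x hx s
  have h1' : HasDerivAt (fun τ => DX l u x (t + τ)) (DX l qu x t) 0 :=
    HasDerivAt.comp_const_add t 0 (by simpa using h1)
  have h2' : HasDerivAt (fun τ => DX l p x (s + τ)) (DX l qp x s) 0 :=
    HasDerivAt.comp_const_add s 0 (by simpa using h2)
  refine (h1'.sub h2').congr_deriv ?_
  rw [← Dl_sub hΩ t s l squ sqp x hx]
  -- the two nonlinear terms
  have hφ : ∀ {w : (Fin d → ℝ) → ℝ → ℝ} (τ : ℝ), Sol Ω f w →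
      ContDiffOn ℝ (⊤ : ℕ∞) (fun y => (y, w y τ, fun i => dX i w y τ)) Ω := by
    intro w τ hw
    have a := sol_slice hΩ hw hf τ
    exact contDiffOn_id.prodMk (a.prodMk (contDiffOn_pi.2 fun i => smooth_pv hΩ a i))
  have hpv : ∀ i, ∀ y ∈ Ω, pv i v y = dX i u y t - dX i p y s := fun i =>
    pv_sub_dX (su 1) (sp 1) t s i
  have hpv2 : ∀ i, ∀ y ∈ Ω, pv i (pv i v) y = dX i (dX i u) y t - dX i (dX i p) y s := by
    intro i y hy
    rw [pv_congr_on hΩ (hpv i) i y hy]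
    exact pv_sub_dX ((su 2).2.2 i) ((sp 2).2.2 i) t s i y hy
  set W := fun y => f (y, u y t, fun i => dX i u y t) - f (y, p y s, fun i => dX i p y s) with hW
  have hOp : IsOpen (Ω ×ˢ ((univ : Set ℝ) ×ˢ (univ : Set (Fin d → ℝ)))) :=
    hΩ.prod (isOpen_univ.prod isOpen_univ)
  have hWs : ContDiffOn ℝ (⊤ : ℕ∞) W Ω :=
    (hf.comp (hφ t hu) fun y hy => ⟨hy, trivial, trivial⟩).sub
      (hf.comp (hφ s hp) fun y hy => ⟨hy, trivial, trivial⟩)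
  have hdiff : FlatK (l.length + 1) (fun y => ((y, u y t, fun i => dX i u y t) -
      (y, p y s, fun i => dX i p y s) : (Fin d → ℝ) × ℝ × (Fin d → ℝ))) x := by
    have c1 := FlatK.bilin hΩ hx (ContinuousLinearMap.lsmul ℝ ℝ) hvs
      (contDiffOn_const (c := ((0, 1, 0) : (Fin d → ℝ) × ℝ × (Fin d → ℝ)))) hfl.pred
    have c2 := fun i => FlatK.bilin hΩ hx (ContinuousLinearMap.lsmul ℝ ℝ) (smooth_pv hΩ hvs i)
      (contDiffOn_const (c := ((0, 0, Pi.single i 1) : (Fin d → ℝ) × ℝ × (Fin d → ℝ)))) (hfl.2 i)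
    have c3 := FlatK.sum hΩ hx Finset.univ (fun i => (smooth_pv hΩ hvs i).smul contDiffOn_const) c2
    refine (FlatK.add hΩ hx (hvs.smul contDiffOn_const)
      (ContDiffOn.sum fun i _ => (smooth_pv hΩ hvs i).smul contDiffOn_const) c1 c3).congr_on hΩ hx ?_
    intro y hy
    refine Prod.ext ?_ (Prod.ext ?_ ?_)
    · simp [Prod.fst_sum]
    · simp [Prod.fst_sum, Prod.snd_sum, hv]
    · simp only [ContinuousLinearMap.lsmul_apply, Prod.snd_add, Prod.snd_sum, Prod.smul_snd, Prod.snd_sub]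
      funext j
      simp [Finset.sum_apply, Pi.single_apply, hpv j y hy]
  have hWf : FlatK (l.length + 1) W x :=
    FlatK.comp hΩ hx hOp hf (hφ t hu) (hφ s hp) (fun y hy => ⟨hy, trivial, trivial⟩)
      (fun y hy => ⟨hy, trivial, trivial⟩) hdiff
  have hW0 : Dl l W x = 0 := (flat_Dl l (k := 1) (by rw [add_comm]; exact hWf)).1
  have e : ∀ y ∈ Ω, qu y t - qp y s = (∑ i, pv i (pv i v) y) + W y := by
    intro y hy
    rw [← (hqu y hy t).deriv, ← (hqp y hy s).deriv, hu.eq y hy, hp.eq y hy]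
    simp only [hpv2 _ y hy, Finset.sum_sub_distrib, hW]
    ring
  rw [Dl_congr hΩ l e x hx]
  have s2 : ∀ i, ContDiffOn ℝ (⊤ : ℕ∞) (pv i (pv i v)) Ω := fun i => smooth_pv hΩ (smooth_pv hΩ hvs i) i
  rw [Dl_add hΩ l (ContDiffOn.sum fun i _ => s2 i) hWs x hx, hW0, add_zero, Dl_sum hΩ l _ s2 x hx]
  refine Finset.sum_congr rfl fun i _ => ?_
  rw [Dl_pv hΩ i l (smooth_pv hΩ hvs i) x hx]
  exact pv_congr_on hΩ (Dl_pv hΩ i l hvs) i x hx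

/-- points where the difference vanishes to order exactly `k + 2` -/
def Kset (Ω : Set (Fin d → ℝ)) (u p : (Fin d → ℝ) → ℝ → ℝ) (k : ℕ) : Set ((Fin d → ℝ) × ℝ × ℝ) :=
  {q | q.1 ∈ Ω ∧ FlatK (k + 2) (fun y => u y q.2.1 - p y q.2.2) q.1 ∧
    ¬ FlatK (k + 3) (fun y => u y q.2.1 - p y q.2.2) q.1}

lemma K_local (hΩ : IsOpen Ω) (hu : Sol Ω f u) (hp : Sol Ω f p)
    (hf : ContDiffOn ℝ (⊤ : ℕ∞) f (Ω ×ˢ ((univ : Set ℝ) ×ˢ (univ : Set (Fin d → ℝ))))) (k : ℕ)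
    {q₀ : (Fin d → ℝ) × ℝ × ℝ} (hq : q₀ ∈ Kset Ω u p k) :
    ∃ N ∈ 𝓝 q₀, dimH (N ∩ Kset Ω u p k) ≤ d := by
  obtain ⟨x, t, s⟩ := q₀
  obtain ⟨hx, hfl, hnf⟩ := hq
  simp only at hx hfl hnf
  obtain ⟨l, rfl, h3⟩ := exists_Dl k hfl hnf
  have su := hu.smooth hΩ hf
  have sp := hp.smooth hΩ hf
  set v := fun y => u y t - p y s with hv
  have hvs : ContDiffOn ℝ (⊤ : ℕ∞) v Ω := (sol_slice hΩ hu hf t).sub (sol_slice hΩ hp hf s)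
  set h := Dl l v with hh
  have hhs : ContDiffOn ℝ (⊤ : ℕ∞) h Ω := Dl_smooth hΩ l hvs
  have h2 : FlatK 2 h x := flat_Dl l (by rw [add_comm]; exact hfl)
  obtain ⟨i₀, j₀, hij⟩ := flat3 h2 h3
  have aa : Alg Ω u (DX l u) := Alg.DX l .base
  have ab : Alg Ω p (DX l p) := Alg.DX l .base
  set a := DX l u with ha
  set b := DX l p with hb
  have hab : ∀ y ∈ Ω, h y = a y t - b y s := Dl_sub hΩ t s l su sp
  have hsa := aa.cx hΩ su
  have hsb := ab.cx hΩ sp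
  -- differentiability of the defining functions
  have hC1 : ∀ {a' b' : (Fin d → ℝ) → ℝ → ℝ}, Alg Ω u a' → Alg Ω p b' →
      ContDiffAt ℝ 1 (fun q : (Fin d → ℝ) × ℝ × ℝ => a' q.1 q.2.1 - b' q.1 q.2.2) (x, t, s) := by
    intro a' b' h1 h2
    have j1 := (h1.joint hΩ hu hf 1).contDiffAt (x := (x, t)) ((hΩ.prod isOpen_univ).mem_nhds ⟨hx, trivial⟩)
    have j2 := (h2.joint hΩ hp hf 1).contDiffAt (x := (x, s)) ((hΩ.prod isOpen_univ).mem_nhds ⟨hx, trivial⟩)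
    have k1 : ContDiffAt ℝ 1 (fun q : (Fin d → ℝ) × ℝ × ℝ => (q.1, q.2.1)) (x, t, s) := by fun_prop
    have k2 : ContDiffAt ℝ 1 (fun q : (Fin d → ℝ) × ℝ × ℝ => (q.1, q.2.2)) (x, t, s) := by fun_prop
    exact (ContDiffAt.comp (x, t, s) (g := fun z : (Fin d → ℝ) × ℝ => a' z.1 z.2) j1 k1).sub
      (ContDiffAt.comp (x, t, s) (g := fun z : (Fin d → ℝ) × ℝ => b' z.1 z.2) j2 k2)
  set ψ : (Fin d → ℝ) × ℝ × ℝ → ℝ := fun q => a q.1 q.2.1 - b q.1 q.2.2 with hψ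
  set θ : Fin d → (Fin d → ℝ) × ℝ × ℝ → ℝ := fun i q => dX i a q.1 q.2.1 - dX i b q.1 q.2.2 with hθ
  have cψ := hC1 aa ab
  have cθ := fun i => hC1 (.dx i a aa) (.dx i b ab)
  have sψ : HasStrictFDerivAt ψ (fderiv ℝ ψ (x, t, s)) (x, t, s) := cψ.hasStrictFDerivAt (by simp)
  have sθ : ∀ i, HasStrictFDerivAt (θ i) (fderiv ℝ (θ i) (x, t, s)) (x, t, s) := fun i =>
    (cθ i).hasStrictFDerivAt (by simp)
  have hpi : ∀ i, ∀ y ∈ Ω, pv i h y = dX i a y t - dX i b y s := by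
    intro i y hy
    rw [pv_congr_on hΩ hab i y hy]
    exact pv_sub_dX (hsa 1) (hsb 1) t s i y hy
  have eψ : ∀ j, fderiv ℝ ψ (x, t, s) (Pi.single j 1, 0, 0) = 0 := by
    intro j
    rw [fd_space (cψ.differentiableAt (by simp)), ← (h2.2 j).1]
    exact (pv_congr_on hΩ hab j x hx).symm
  have eθ : ∀ i j, fderiv ℝ (θ i) (x, t, s) (Pi.single j 1, 0, 0) = pv j (pv i h) x := by
    intro i j
    rw [fd_space ((cθ i).differentiableAt (by simp))]
    exact (pv_congr_on hΩ (hpi i) j x hx).symm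
  have eT : fderiv ℝ ψ (x, t, s) (0, 1, 1) = ∑ i, pv i (pv i h) x :=
    fd_time (cψ.differentiableAt (by simp)) (trace_time hΩ hu hp hf hx t s l hfl)
  have hrank : Module.finrank ℝ ((Fin d → ℝ) × ℝ × ℝ) = d + 2 := by simp
  have hz : ∀ q ∈ Kset Ω u p l.length, ψ q = 0 ∧ ∀ i, θ i q = 0 := by
    rintro ⟨x', t', s'⟩ ⟨hx', hfl', -⟩
    simp only at hx' hfl'
    have h2' : FlatK 2 (Dl l (fun y => u y t' - p y s')) x' := flat_Dl l (by rw [add_comm]; exact hfl')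
    have hab' := Dl_sub hΩ t' s' l su sp
    refine ⟨?_, fun i => ?_⟩
    · rw [← h2'.1]; exact (hab' x' hx').symm
    · rw [← (h2'.2 i).1, pv_congr_on hΩ hab' i x' hx']
      exact (pv_sub_dX (hsa 1) (hsb 1) t' s' i x' hx').symm
  by_cases htr : ∑ i, pv i (pv i h) x = 0
  · obtain ⟨i, j, hm⟩ := trace_minor (M := fun i j => pv j (pv i h) x) (fun i j => pv_comm hΩ hhs j i x hx)
      hij htr
    obtain ⟨N, hN, hd⟩ := zero_dim (sθ i) (sθ j) (Pi.single i 1, 0, 0) (Pi.single j 1, 0, 0)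
      (by simp only [eθ]; exact hm) d hrank
    refine ⟨N, hN, le_trans (dimH_mono ?_) hd⟩
    exact fun q hq => ⟨hq.1, (hz q hq.2).2 i, (hz q hq.2).2 j⟩
  · obtain ⟨N, hN, hd⟩ := zero_dim sψ (sθ i₀) (Pi.single j₀ 1, 0, 0) (0, 1, 1)
      (by rw [eψ, eT, eθ]; simpa using ⟨htr, hij⟩) d hrank
    refine ⟨N, hN, le_trans (dimH_mono ?_) hd⟩
    exact fun q hq => ⟨hq.1, (hz q hq.2).1, (hz q hq.2).2 i₀⟩

lemma K_dim (hΩ : IsOpen Ω) (hu : Sol Ω f u) (hp : Sol Ω f p)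
    (hf : ContDiffOn ℝ (⊤ : ℕ∞) f (Ω ×ˢ ((univ : Set ℝ) ×ˢ (univ : Set (Fin d → ℝ))))) (k : ℕ) :
    dimH (Kset Ω u p k) ≤ d := by
  by_contra hc
  obtain ⟨q, hq, h⟩ := exists_mem_nhdsWithin_lt_dimH_of_lt_dimH (not_le.1 hc)
  obtain ⟨N, hN, hd⟩ := K_local hΩ hu hp hf k hq
  exact absurd (h (N ∩ Kset Ω u p k) (inter_mem (mem_nhdsWithin_of_mem_nhds hN) self_mem_nhdsWithin))
    (not_lt.2 hd)

/-- the bad set -/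
def Bad (Ω : Set (Fin d → ℝ)) (u p : (Fin d → ℝ) → ℝ → ℝ) : Set ((Fin d → ℝ) × ℝ) :=
  {q | q.1 ∈ Ω ∧ ∃ s, u q.1 q.2 = p q.1 s ∧ ∀ i, dX i u q.1 q.2 = dX i p q.1 s}

lemma bad_dense (hΩ : IsOpen Ω) (hΩc : IsPreconnected Ω) (hu : Sol Ω f u) (hp : Sol Ω f p)
    (hf : ContDiffOn ℝ (⊤ : ℕ∞) f (Ω ×ˢ ((univ : Set ℝ) ×ˢ (univ : Set (Fin d → ℝ)))))
    (hdiff : ∀ t s : ℝ, ∃ x ∈ Ω, p x t ≠ u x s) : Dense (Bad Ω u p)ᶜ := by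
  have su := hu.smooth hΩ hf
  have sp := hp.smooth hΩ hf
  apply dense_compl_of_dimH_lt_finrank
  have hsub : Bad Ω u p ⊆ (fun q : (Fin d → ℝ) × ℝ × ℝ => (q.1, q.2.1)) '' ⋃ k, Kset Ω u p k := by
    rintro ⟨x, t⟩ ⟨hx, s, h0, h1⟩
    simp only at hx h0 h1
    refine ⟨(x, t, s), mem_iUnion.2 ?_, rfl⟩
    by_contra hc
    push Not at hc
    obtain ⟨y, hy, hne⟩ := hdiff s t
    refine hne (ucp hΩ hΩc hu hp hf hx t s (fun k => ?_) y hy).symm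
    suffices H : ∀ k, FlatK (k + 2) (fun y => u y t - p y s) x from (H k).mono (by omega)
    intro k
    induction k with
    | zero =>
      refine ⟨sub_eq_zero.2 h0, fun i => ⟨?_, fun _ => trivial⟩⟩
      rw [pv_sub_dX (su 1) (sp 1) t s i x hx, sub_eq_zero]
      exact h1 i
    | succ k ih =>
      by_contra h3
      exact hc k ⟨hx, ih, h3⟩
  have hl : LipschitzWith 1 (fun q : (Fin d → ℝ) × ℝ × ℝ => (q.1, q.2.1)) := by
    have := (LipschitzWith.prod_fst (α := Fin d → ℝ) (β := ℝ × ℝ)).prodMk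
      ((LipschitzWith.prod_fst (α := ℝ) (β := ℝ)).comp (LipschitzWith.prod_snd (α := Fin d → ℝ) (β := ℝ × ℝ)))
    simpa using this
  have h1 : dimH (Bad Ω u p) ≤ d := by
    refine (dimH_mono hsub).trans ((hl.dimH_image_le _).trans ?_)
    rw [dimH_iUnion]
    exact iSup_le fun k => K_dim hΩ hu hp hf k
  refine h1.trans_lt ?_
  have : Module.finrank ℝ ((Fin d → ℝ) × ℝ) = d + 1 := by simp
  rw [this]
  exact_mod_cast Nat.lt_succ_self d

end Dim2

open Set MeasureTheory Filter Topology

section Final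
variable {d : ℕ} {Ω : Set (Fin d → ℝ)} {f : ((Fin d → ℝ) × ℝ × (Fin d → ℝ)) → ℝ}
  {u p : (Fin d → ℝ) → ℝ → ℝ}

lemma dX_time_congr (hΩ : IsOpen Ω) {s s' : ℝ} (h : ∀ x ∈ Ω, p x s = p x s') (i : Fin d)
    {x : Fin d → ℝ} (hx : x ∈ Ω) : dX i p x s = dX i p x s' := by
  have : (fun y => p y s) =ᶠ[𝓝 x] (fun y => p y s') := by
    filter_upwards [hΩ.mem_nhds hx] with y hy using h y hy
  simp only [dX, this.fderiv_eq]

/-- The times of a periodic orbit or equilibrium reduce to a compact interval. -/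
lemma time_reduce {ω : ℝ}
    (hper : (0 < ω ∧ (∀ x ∈ closure Ω, ∀ t : ℝ, p x (t + ω) = p x t) ∧
        ∀ ω' : ℝ, 0 < ω' → (∀ x ∈ closure Ω, ∀ t : ℝ, p x (t + ω') = p x t) → ω ≤ ω')
      ∨ (ω = 0 ∧ ∀ x ∈ closure Ω, ∀ t s : ℝ, p x t = p x s)) (s : ℝ) :
    ∃ s' ∈ Icc (0 : ℝ) ω, ∀ x ∈ Ω, p x s = p x s' := by
  rcases hper with ⟨h0, hp, -⟩ | ⟨h0, hp⟩
  · refine ⟨toIcoMod h0 0 s, ?_, fun x hx => ?_⟩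
    · have := toIcoMod_mem_Ico h0 0 s
      rw [zero_add] at this
      exact Ico_subset_Icc_self this
    · have hper : Function.Periodic (p x) ω := hp x (subset_closure hx)
      rw [toIcoMod, hper.sub_zsmul_eq]
  · exact ⟨0, by simp [h0], fun x hx => hp x (subset_closure hx) _ _⟩

lemma bad_open (hΩ : IsOpen Ω) (hu : Sol Ω f u) (hp : Sol Ω f p)
    (hf : ContDiffOn ℝ (⊤ : ℕ∞) f (Ω ×ˢ ((univ : Set ℝ) ×ˢ (univ : Set (Fin d → ℝ))))) {ω : ℝ}
    (hred : ∀ s, ∃ s' ∈ Icc (0 : ℝ) ω, ∀ x ∈ Ω, p x s = p x s') :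
    IsOpen ((Ω ×ˢ (univ : Set ℝ)) ∩ (Bad Ω u p)ᶜ) := by
  have su := hu.smooth hΩ hf 1
  have sp := hp.smooth hΩ hf 1
  have hO : IsOpen (Ω ×ˢ (univ : Set ℝ)) := hΩ.prod isOpen_univ
  rw [isOpen_iff_mem_nhds]
  rintro ⟨x, t⟩ ⟨hq, hbad⟩
  have hx : x ∈ Ω := hq.1
  have key : ∀ᶠ q in 𝓝 (x, t), ∀ s ∈ Icc (0 : ℝ) ω,
      ¬ (u q.1 q.2 = p q.1 s ∧ ∀ i, dX i u q.1 q.2 = dX i p q.1 s) := by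
    refine isCompact_Icc.eventually_forall_of_forall_eventually fun s _ => ?_
    have hn : ¬ (u x t = p x s ∧ ∀ i, dX i u x t = dX i p x s) := fun h => hbad ⟨hx, s, h⟩
    have c1 : ∀ {g : (Fin d → ℝ) → ℝ → ℝ},
        ContinuousOn (fun q : (Fin d → ℝ) × ℝ => g q.1 q.2) (Ω ×ˢ univ) →
        ContinuousAt (fun z : ((Fin d → ℝ) × ℝ) × ℝ => g z.1.1 z.1.2) ((x, t), s) := by
      intro g hg
      exact ContinuousAt.comp (f := fun z : ((Fin d → ℝ) × ℝ) × ℝ => (z.1.1, z.1.2))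
        (g := fun q : (Fin d → ℝ) × ℝ => g q.1 q.2) (hg.continuousAt (hO.mem_nhds ⟨hx, trivial⟩))
        (by fun_prop)
    have c2 : ∀ {g : (Fin d → ℝ) → ℝ → ℝ},
        ContinuousOn (fun q : (Fin d → ℝ) × ℝ => g q.1 q.2) (Ω ×ˢ univ) →
        ContinuousAt (fun z : ((Fin d → ℝ) × ℝ) × ℝ => g z.1.1 z.2) ((x, t), s) := by
      intro g hg
      exact ContinuousAt.comp (f := fun z : ((Fin d → ℝ) × ℝ) × ℝ => (z.1.1, z.2))
        (g := fun q : (Fin d → ℝ) × ℝ => g q.1 q.2) (hg.continuousAt (hO.mem_nhds ⟨hx, trivial⟩))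
        (by fun_prop)
    by_cases h0 : u x t = p x s
    · have : ∃ i, dX i u x t ≠ dX i p x s := by
        by_contra hc
        push Not at hc
        exact hn ⟨h0, hc⟩
      obtain ⟨i, hi⟩ := this
      filter_upwards [((c1 (su.2.2 i).cont).sub (c2 (sp.2.2 i).cont)).eventually_ne (sub_ne_zero.2 hi)] with z hz h
      exact hz (sub_eq_zero.2 (h.2 i))
    · filter_upwards [((c1 su.cont).sub (c2 sp.cont)).eventually_ne (sub_ne_zero.2 h0)] with z hz h
      exact hz (sub_eq_zero.2 h.1)
  filter_upwards [key, hO.mem_nhds hq] with q hk hqO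
  refine ⟨hqO, ?_⟩
  rintro ⟨hqx, s, h0, h1⟩
  obtain ⟨s', hs', he⟩ := hred s
  exact hk s' hs' ⟨h0.trans (he _ hqx), fun i => (h1 i).trans (dX_time_congr hΩ he i hqx)⟩

end Final

/-- Proposition `prop-1to1-up`: separation of a bounded complete
solution from a periodic orbit (or equilibrium) at a dense open set of points. -/
theorem separation_solution_from_periodic_orbit
    (d : ℕ) (hd : 2 ≤ d) (γ : NNReal) (hγ0 : 0 < γ) (hγ1 : γ ≤ 1)
    (Ω : Set (Fin d → ℝ)) (hΩo : IsOpen Ω) (hΩc : IsConnected Ω)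
    (hΩb : Bornology.IsBounded Ω) (hΩreg : HasC2HolderBoundary Ω γ)
    (f : ((Fin d → ℝ) × ℝ × (Fin d → ℝ)) → ℝ)
    (hf : ContDiffOn ℝ (⊤ : ℕ∞) f
      (closure Ω ×ˢ ((univ : Set ℝ) ×ˢ (univ : Set (Fin d → ℝ)))))
    -- `p` is a classical solution
    (p : (Fin d → ℝ) → ℝ → ℝ)
    (hpc : ContinuousOn (fun q : (Fin d → ℝ) × ℝ => p q.1 q.2)
      (closure Ω ×ˢ (univ : Set ℝ)))
    (hpx : ∀ t : ℝ, ContDiffOn ℝ 2 (fun x => p x t) Ω)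
    (hpt : ∀ x ∈ Ω, ContDiff ℝ 1 (p x))
    (hpeq : ∀ x ∈ Ω, ∀ t : ℝ,
      deriv (p x) t = lap (fun y => p y t) x
        + f (x, p x t, fun i => pd i (fun y => p y t) x))
    (hpbc : ∀ x ∈ frontier Ω, ∀ t : ℝ, p x t = 0)
    -- `p` is either periodic with minimal period `ω > 0`, or an equilibrium (`ω = 0`)
    (ω : ℝ)
    (hper : (0 < ω ∧ (∀ x ∈ closure Ω, ∀ t : ℝ, p x (t + ω) = p x t) ∧
        ∀ ω' : ℝ, 0 < ω' → (∀ x ∈ closure Ω, ∀ t : ℝ, p x (t + ω') = p x t) → ω ≤ ω')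
      ∨ (ω = 0 ∧ ∀ x ∈ closure Ω, ∀ t s : ℝ, p x t = p x s))
    (hpbnd : ∃ R : ℝ, ∀ x ∈ Ω, ∀ t : ℝ, |p x t| ≤ R ∧ ∀ i, |pd i (fun y => p y t) x| ≤ R)
    -- `u` is a bounded complete classical solution
    (u : (Fin d → ℝ) → ℝ → ℝ)
    (huc : ContinuousOn (fun q : (Fin d → ℝ) × ℝ => u q.1 q.2)
      (closure Ω ×ˢ (univ : Set ℝ)))
    (hux : ∀ t : ℝ, ContDiffOn ℝ 2 (fun x => u x t) Ω)
    (hut : ∀ x ∈ Ω, ContDiff ℝ 1 (u x))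
    (hueq : ∀ x ∈ Ω, ∀ t : ℝ,
      deriv (u x) t = lap (fun y => u y t) x
        + f (x, u x t, fun i => pd i (fun y => u y t) x))
    (hubc : ∀ x ∈ frontier Ω, ∀ t : ℝ, u x t = 0)
    (hubnd : ∃ R : ℝ, ∀ x ∈ Ω, ∀ t : ℝ, |u x t| ≤ R ∧ ∀ i, |pd i (fun y => u y t) x| ≤ R)
    -- `p(t) ≠ u(s)` as functions on `Ω`, for all times `t, s`
    (hdiff : ∀ t s : ℝ, ∃ x ∈ Ω, p x t ≠ u x s) :
    ∃ D : Set ((Fin d → ℝ) × ℝ), IsOpen D ∧ D ⊆ Ω ×ˢ (univ : Set ℝ) ∧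
      Ω ×ˢ (univ : Set ℝ) ⊆ closure D ∧
      ∀ q ∈ D, ∀ t : ℝ,
        ¬ (u q.1 q.2 = p q.1 t ∧
           ∀ i, pd i (fun y => u y q.2) q.1 = pd i (fun y => p y t) q.1) := by
  have hs : Ω ×ˢ ((univ : Set ℝ) ×ˢ (univ : Set (Fin d → ℝ))) ⊆
      closure Ω ×ˢ ((univ : Set ℝ) ×ˢ (univ : Set (Fin d → ℝ))) :=
    prod_mono subset_closure subset_rfl
  have hf' := hf.mono hs
  have hu : Sol Ω f u :=
    ⟨huc.mono (prod_mono subset_closure subset_rfl), hux,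
      fun x hx => (hut x hx).differentiable (by simp), hueq, hubnd⟩
  have hp : Sol Ω f p :=
    ⟨hpc.mono (prod_mono subset_closure subset_rfl), hpx,
      fun x hx => (hpt x hx).differentiable (by simp), hpeq, hpbnd⟩
  refine ⟨(Ω ×ˢ (univ : Set ℝ)) ∩ (Bad Ω u p)ᶜ, bad_open hΩo hu hp hf' (time_reduce hper),
    inter_subset_left, ?_, ?_⟩
  · exact (bad_dense hΩo hΩc.isPreconnected hu hp hf' hdiff).open_subset_closure_inter
      (hΩo.prod isOpen_univ)
  · rintro q ⟨hq, hb⟩ t ⟨h0, h1⟩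
    exact hb ⟨hq.1, t, h0, h1⟩
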